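/- arXiv:0812.0020 — 2 statements merged into one kernel-verified Lean document; each statement's English description precedes it below -/
import Mathlib

section
/- Let n ≥ 2 and 1 < p, q ≤ ∞, and let q' be the dual exponent of q (1/q + 1/q' = 1). Then there is NO constant C > 0 such that ‖Tr f‖_{M^0_{p,q}(ℝ^{n−1})} ≤ C ‖f‖_{M^{1/q'}_{p,q}(ℝⁿ)} holds for all Schwartz functions f ∈ 𝒮(ℝⁿ). -/
open MeasureTheory FourierTransform
open scoped ENNReal NNReal

noncomputable section

/-- `η` is an admissible bump function: smooth, valued in `[0,1]`, equal to `1` on `|t| ≤ 1`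
and vanishing for `|t| ≥ 2`. -/
def IsBump (η : ℝ → ℝ) : Prop :=
  ContDiff ℝ (⊤ : ℕ∞) η ∧ (∀ t, η t ∈ Set.Icc (0:ℝ) 1) ∧ (∀ t, |t| ≤ 1 → η t = 1) ∧
    (∀ t, 2 ≤ |t| → η t = 0)

/-- Japanese bracket `⟨k⟩ = (1+|k|²)^{1/2}` of an integer vector. -/
def jbr {d : ℕ} (k : Fin d → ℤ) : ℝ := (1 + ∑ i, ((k i : ℝ))^2) ^ ((1:ℝ)/2)

/-- `ψ_k`, the normalized window at frequency `k ∈ ℤ^d`. -/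
def unifWindow (η : ℝ → ℝ) {d : ℕ} (k : Fin d → ℤ) (ξ : EuclideanSpace ℝ (Fin d)) : ℝ :=
  (∏ i, η (2 * (ξ i - k i))) / ∑' l : Fin d → ℤ, ∏ i, η (2 * (ξ i - l i))

/-- The frequency-uniform decomposition operator `□_k f = 𝓕⁻¹(ψ_k 𝓕 f)`. -/
def unifBox (η : ℝ → ℝ) {d : ℕ} (k : Fin d → ℤ) (f : EuclideanSpace ℝ (Fin d) → ℂ) :
    EuclideanSpace ℝ (Fin d) → ℂ :=
  𝓕⁻ (fun ξ => (unifWindow η k ξ : ℂ) * 𝓕 f ξ)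

/-- The `ℓ^q` combination of a family of extended nonnegative reals, with the supremum
modification for `q = ∞`. -/
def lqSum {ι : Type*} (q : ℝ≥0∞) (a : ι → ℝ≥0∞) : ℝ≥0∞ :=
  if q = ∞ then ⨆ i, a i else (∑' i, a i ^ q.toReal) ^ (1 / q.toReal)

/-- The modulation space quasi-norm `‖f‖_{M^s_{p,q}(ℝ^d)}`. -/
def modNorm (η : ℝ → ℝ) {d : ℕ} (s : ℝ) (p q : ℝ≥0∞) (f : EuclideanSpace ℝ (Fin d) → ℂ) :
    ℝ≥0∞ :=
  lqSum q (fun k : Fin d → ℤ =>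
    ENNReal.ofReal (jbr k ^ s) * eLpNorm (unifBox η k f) p volume)

/-- The anisotropic modulation space quasi-norm `‖f‖_{M^s_{p,q,r}(ℝ^{m+1})}`. -/
def modNormAniso (η : ℝ → ℝ) {m : ℕ} (s : ℝ) (p q r : ℝ≥0∞)
    (f : EuclideanSpace ℝ (Fin (m+1)) → ℂ) : ℝ≥0∞ :=
  lqSum r (fun kn : ℤ => lqSum q (fun kb : Fin m → ℤ =>
    ENNReal.ofReal (jbr kb ^ s) *
      eLpNorm (unifBox η (Fin.snoc kb kn) f) p volume))

/-- The trace `(Tr f)(x̄) = f(x̄, 0)` on the hyperplane `x_n = 0`. -/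
def traceFn {m : ℕ} (f : EuclideanSpace ℝ (Fin (m+1)) → ℂ)
    (x : EuclideanSpace ℝ (Fin m)) : ℂ :=
  f ((WithLp.equiv 2 (Fin (m+1) → ℝ)).symm
      (Fin.snoc ((WithLp.equiv 2 (Fin m → ℝ)) x) 0))


namespace TraceSharp
open SchwartzMap
open scoped SchwartzMap RealInnerProductSpace

abbrev E (d : ℕ) := EuclideanSpace ℝ (Fin d)

variable {η : ℝ → ℝ}

lemma bump_ne {η : ℝ → ℝ} (hη : IsBump η) {t : ℝ} {l : ℤ} (h : η (2 * (t - l)) ≠ 0) :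
    |t - l| < 1 := by
  by_contra hc
  apply h
  apply hη.2.2.2
  rw [abs_mul]
  norm_num
  linarith [not_lt.1 hc]

lemma prod_ne {η : ℝ → ℝ} (hη : IsBump η) {d : ℕ} {ξ : E d} {l : Fin d → ℤ}
    (h : ∏ i, η (2 * (ξ i - l i)) ≠ 0) (i : Fin d) : |ξ i - l i| < 1 :=
  bump_ne hη (Finset.prod_ne_zero_iff.1 h i (Finset.mem_univ i))

/-- Finite box of frequencies. -/
def box {d : ℕ} (x : E d) : Finset (Fin d → ℤ) :=
  Fintype.piFinset fun i => Finset.Icc (⌊x i⌋ - 3) (⌊x i⌋ + 3)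

lemma mem_box {d : ℕ} {x y : E d} {l : Fin d → ℤ} (hy : ∀ i, |y i - x i| < 1)
    (h : ∀ i, |y i - l i| < 1) : l ∈ box x := by
  simp only [box, Fintype.mem_piFinset, Finset.mem_Icc]
  intro i
  have h1 := abs_lt.1 (hy i)
  have h2 := abs_lt.1 (h i)
  have h3 := Int.floor_le (x i)
  have h4 := Int.lt_floor_add_one (x i)
  constructor
  · have : ((⌊x i⌋ - 3 : ℤ) : ℝ) ≤ l i := by push_cast; linarith
    exact_mod_cast this
  · have : (l i : ℝ) ≤ ((⌊x i⌋ + 3 : ℤ) : ℝ) := by push_cast; linarith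
    exact_mod_cast this

lemma den_eq (hη : IsBump η) {d : ℕ} {x y : E d} (hy : ∀ i, |y i - x i| < 1) :
    ∑' l : Fin d → ℤ, ∏ i, η (2 * (y i - l i)) = ∑ l ∈ box x, ∏ i, η (2 * (y i - l i)) := by
  apply tsum_eq_sum
  intro l hl
  by_contra hne
  exact hl (mem_box hy (prod_ne hη hne))

lemma prod_nonneg (hη : IsBump η) {d : ℕ} (y : E d) (l : Fin d → ℤ) :
    0 ≤ ∏ i, η (2 * (y i - l i)) :=
  Finset.prod_nonneg fun _ _ => (hη.2.1 _).1

lemma prod_round (hη : IsBump η) {d : ℕ} (y : E d) :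
    ∏ i, η (2 * (y i - ((fun i => round (y i)) : Fin d → ℤ) i)) = 1 := by
  apply Finset.prod_eq_one
  intro i _
  apply hη.2.2.1
  rw [abs_mul]
  have := abs_sub_round (y i)
  norm_num
  linarith

lemma den_ge (hη : IsBump η) {d : ℕ} (y : E d) :
    1 ≤ ∑' l : Fin d → ℤ, ∏ i, η (2 * (y i - l i)) := by
  have hyy : ∀ i, |y i - y i| < 1 := by simp
  rw [den_eq hη hyy, ← prod_round hη y]
  apply Finset.single_le_sum (f := fun l : Fin d → ℤ => ∏ i, η (2 * (y i - l i)))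
  · intro l _; exact prod_nonneg hη y l
  · apply mem_box hyy
    intro i
    have := abs_sub_round (y i)
    linarith

lemma contDiff_prodEta (hη : IsBump η) {d : ℕ} (l : Fin d → ℤ) :
    ContDiff ℝ (⊤ : ℕ∞) (fun y : E d => ∏ i, η (2 * (y i - l i))) := by
  apply _root_.contDiff_prod
  intro i _
  have := hη.1
  fun_prop

lemma contDiff_window (hη : IsBump η) {d : ℕ} (k : Fin d → ℤ) :
    ContDiff ℝ (⊤ : ℕ∞) (fun y : E d => unifWindow η k y) := by
  unfold unifWindow
  refine (contDiff_prodEta hη k).div ?_ (fun y => (zero_lt_one.trans_le (den_ge hη y)).ne')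
  rw [contDiff_iff_contDiffAt]
  intro x
  have hs : ContDiff ℝ (⊤ : ℕ∞) (fun y : E d => ∑ l ∈ box x, ∏ i, η (2 * (y i - l i))) :=
    ContDiff.sum fun l _ => contDiff_prodEta hη l
  refine hs.contDiffAt.congr_of_eventuallyEq ?_
  filter_upwards [Metric.ball_mem_nhds x one_pos] with y hy
  apply den_eq hη
  intro i
  have := PiLp.norm_apply_le (y - x) i
  rw [Metric.mem_ball, dist_eq_norm] at hy
  exact lt_of_le_of_lt this hy

lemma window_ne (hη : IsBump η) {d : ℕ} {k : Fin d → ℤ} {y : E d} (h : unifWindow η k y ≠ 0)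
    (i : Fin d) : |y i - k i| < 1 := by
  apply prod_ne hη
  intro h0
  apply h
  unfold unifWindow
  rw [h0, zero_div]

lemma window_round (hη : IsBump η) {d : ℕ} (y : E d) :
    unifWindow η (fun i => round (y i)) y ≠ 0 := by
  unfold unifWindow
  apply div_ne_zero
  · rw [prod_round hη]; exact one_ne_zero
  · exact (zero_lt_one.trans_le (den_ge hη y)).ne'

lemma window_shift {d : ℕ} (k v : Fin d → ℤ) (a y : E d) (ha : ∀ i, a i = v i) :
    unifWindow η k y = unifWindow η (k - v) (y - a) := by
  unfold unifWindow
  congr 1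
  · apply Finset.prod_congr rfl
    intro i _
    congr 2
    simp [ha]
  · rw [← (Equiv.addRight v).tsum_eq]
    apply tsum_congr
    intro l
    apply Finset.prod_congr rfl
    intro i _
    congr 2
    simp [ha]
    ring

lemma window_compact (hη : IsBump η) {d : ℕ} (k : Fin d → ℤ) :
    HasCompactSupport (fun y : E d => (unifWindow η k y : ℂ)) := by
  set c : E d := WithLp.toLp 2 (fun i => (k i : ℝ))
  apply HasCompactSupport.of_support_subset_isCompact
    (isCompact_closedBall c (Real.sqrt d))
  intro y hy
  have h : unifWindow η k y ≠ 0 := by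
    intro h0; simp [h0] at hy
  rw [Metric.mem_closedBall, EuclideanSpace.dist_eq]
  apply Real.sqrt_le_sqrt
  calc ∑ i, dist (y i) (c i) ^ 2 ≤ ∑ i : Fin d, (1:ℝ) := by
        apply Finset.sum_le_sum
        intro i _
        have := window_ne hη h i
        rw [Real.dist_eq]
        have h2 : |y i - c i| < 1 := this
        nlinarith [abs_nonneg (y i - c i)]
    _ = d := by simp

lemma window_growth (hη : IsBump η) {d : ℕ} (k : Fin d → ℤ) :
    (fun y : E d => (unifWindow η k y : ℂ)).HasTemperateGrowth := by
  have h1 : ContDiff ℝ (⊤ : ℕ∞) (fun y : E d => (unifWindow η k y : ℂ)) :=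
    Complex.ofRealCLM.contDiff.comp (contDiff_window hη k)
  exact ((window_compact hη k).toSchwartzMap h1).hasTemperateGrowth

/-- `□_k` on Schwartz functions. -/
def boxS (η : ℝ → ℝ) {d : ℕ} (k : Fin d → ℤ) (f : 𝓢(E d, ℂ)) : 𝓢(E d, ℂ) :=
  𝓕⁻ (smulLeftCLM ℂ (fun y : E d => (unifWindow η k y : ℂ)) (𝓕 f))

lemma box_eq (hη : IsBump η) {d : ℕ} (k : Fin d → ℤ) (f : 𝓢(E d, ℂ)) :
    unifBox η k (⇑f) = ⇑(boxS η k f) := by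
  unfold unifBox boxS
  rw [fourierInv_coe, ← fourier_coe]
  congr 1
  ext y
  rw [smulLeftCLM_apply_apply (window_growth hη k), smul_eq_mul]

lemma boxS_sum {d : ℕ} (k : Fin d → ℤ) {ι : Type*} (s : Finset ι) (c : ι → ℂ)
    (f : ι → 𝓢(E d, ℂ)) :
    boxS η k (∑ i ∈ s, c i • f i) = ∑ i ∈ s, c i • boxS η k (f i) := by
  have h : ∀ g, boxS η k g = (fourierInvCLM ℂ 𝓢(E d, ℂ))
      (smulLeftCLM ℂ (fun y : E d => (unifWindow η k y : ℂ)) (fourierCLM ℂ 𝓢(E d, ℂ) g)) := by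
    intro g; rfl
  simp only [h, map_sum, map_smul]

lemma boxS_smul {d : ℕ} (k : Fin d → ℤ) (c : ℂ) (f : 𝓢(E d, ℂ)) :
    boxS η k (c • f) = c • boxS η k f := by
  have := boxS_sum (η := η) k {()} (fun _ => c) (fun _ => f)
  simpa using this

lemma inv_shift {d : ℕ} (a : E d) (Φ : 𝓢(E d, ℂ)) (x : E d) :
    (𝓕⁻ (compSubConstCLM ℂ a Φ)) x = (Real.fourierChar ⟪a, x⟫ : ℂ) * (𝓕⁻ Φ) x := by
  rw [fourierInv_coe, fourierInv_coe, Real.fourierInv_eq, Real.fourierInv_eq,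
    ← integral_const_mul, ← integral_add_right_eq_self _ a]
  congr 1
  ext v
  simp only [compSubConstCLM_apply, add_sub_cancel_right, inner_add_left, AddChar.map_add_eq_mul,
    Circle.smul_def, Circle.coe_mul, smul_eq_mul]
  ring

lemma box_shift (hη : IsBump η) {d : ℕ} (k v : Fin d → ℤ) (a : E d) (ha : ∀ i, a i = v i)
    (Φ : 𝓢(E d, ℂ)) (p : ℝ≥0∞) :
    eLpNorm (boxS η k (𝓕⁻ (compSubConstCLM ℂ a Φ))) p volume =
      eLpNorm (boxS η (k - v) (𝓕⁻ Φ)) p volume := by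
  have h : boxS η k (𝓕⁻ (compSubConstCLM ℂ a Φ)) =
      𝓕⁻ (compSubConstCLM ℂ a
        (smulLeftCLM ℂ (fun y : E d => (unifWindow η (k - v) y : ℂ)) Φ)) := by
    unfold boxS
    congr 1
    rw [fourier_fourierInv_eq]
    ext y
    rw [smulLeftCLM_apply_apply (window_growth hη k), compSubConstCLM_apply,
      compSubConstCLM_apply, smulLeftCLM_apply_apply (window_growth hη (k - v)),
      window_shift k v a y ha]
  rw [h]
  unfold boxS
  rw [fourier_fourierInv_eq]
  apply eLpNorm_congr_norm_ae
  filter_upwards with x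
  rw [inv_shift, norm_mul, Circle.norm_coe, one_mul]

lemma exists_box_ne (hη : IsBump η) {d : ℕ} (f : 𝓢(E d, ℂ)) (hf : f ≠ 0) (p : ℝ≥0∞)
    (hp : p ≠ 0) : ∃ k, eLpNorm (boxS η k f) p volume ≠ 0 := by
  by_contra! hc
  apply hf
  have h : ∀ k, boxS η k f = 0 := by
    intro k
    have h1 := (eLpNorm_eq_zero_iff (boxS η k f).continuous.aestronglyMeasurable hp).1 (hc k)
    have h2 := (Continuous.ae_eq_iff_eq volume (boxS η k f).continuous continuous_zero).1 h1
    ext x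
    exact congrFun h2 x
  have hF : 𝓕 f = 0 := by
    ext y
    have h3 := h (fun i => round (y i))
    have h4 : smulLeftCLM ℂ (fun z : E d => (unifWindow η (fun i => round (y i)) z : ℂ)) (𝓕 f)
        = 0 := by
      have h8 : ∀ g : 𝓢(E d, ℂ), 𝓕 (𝓕⁻ g : 𝓢(E d, ℂ)) = g := fun g => fourier_fourierInv_eq g
      rw [← h8 (smulLeftCLM ℂ
        (fun z : E d => (unifWindow η (fun i => round (y i)) z : ℂ)) (𝓕 f))]
      change 𝓕 (boxS η _ f) = 0
      rw [h3]
      exact map_zero (fourierCLM ℂ 𝓢(E d, ℂ))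
    have h5 := congrArg (fun g : 𝓢(E d, ℂ) => g y) h4
    simp only at h5
    rw [smulLeftCLM_apply_apply (window_growth hη _)] at h5
    rcases smul_eq_zero.1 h5 with h6 | h6
    · exact absurd (Complex.ofReal_eq_zero.1 h6) (window_round hη y)
    · exact h6
  have h7 : 𝓕⁻ (𝓕 f : 𝓢(E d, ℂ)) = f := fourierInv_fourier_eq f
  rw [← h7, hF]
  exact map_zero (fourierInvCLM ℂ 𝓢(E d, ℂ))

/-- The frequency bump. -/
def bumpF (d : ℕ) : ContDiffBump (0 : E d) := ⟨1/2, 1, by norm_num, by norm_num⟩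

lemma bumpC_compact (d : ℕ) : HasCompactSupport (fun y : E d => ((bumpF d) y : ℂ)) :=
  (bumpF d).hasCompactSupport.comp_left (g := Complex.ofReal) rfl

lemma bumpC_contDiff (d : ℕ) : ContDiff ℝ (⊤ : ℕ∞) (fun y : E d => ((bumpF d) y : ℂ)) :=
  Complex.ofRealCLM.contDiff.comp (bumpF d).contDiff

/-- Frequency bump as a Schwartz function. -/
def Phi (d : ℕ) : 𝓢(E d, ℂ) := (bumpC_compact d).toSchwartzMap (bumpC_contDiff d)

lemma Phi_apply (d : ℕ) (y : E d) : Phi d y = ((bumpF d y : ℝ) : ℂ) := rfl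

lemma inv_Phi_zero (d : ℕ) : (𝓕⁻ (Phi d)) 0 ≠ 0 := by
  rw [fourierInv_coe, Real.fourierInv_eq]
  simp only [inner_zero_right, AddChar.map_zero_eq_one, one_smul, Phi_apply]
  rw [integral_complex_ofReal]
  exact Complex.ofReal_ne_zero.2 (bumpF d).integral_pos.ne'

lemma box_Phi_ne (hη : IsBump η) {d : ℕ} {k : Fin d → ℤ} {p : ℝ≥0∞}
    (h : eLpNorm (boxS η k (𝓕⁻ (Phi d))) p volume ≠ 0) (i : Fin d) : |k i| ≤ 1 := by
  by_contra hk
  apply h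
  have : boxS η k (𝓕⁻ (Phi d)) = 0 := by
    unfold boxS
    rw [fourier_fourierInv_eq]
    have h0 : smulLeftCLM ℂ (fun y : E d => (unifWindow η k y : ℂ)) (Phi d) = 0 := by
      ext y
      rw [smulLeftCLM_apply_apply (window_growth hη k), Phi_apply]
      by_contra hne
      have h1 : unifWindow η k y ≠ 0 := fun h0 => hne (by simp [h0])
      have h2 : bumpF d y ≠ 0 := fun h0 => hne (by simp [h0])
      have h3 := window_ne hη h1 i
      have h4 : ‖y‖ < 1 := by
        by_contra hy
        apply h2
        apply (bumpF d).zero_of_le_dist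
        rw [dist_zero_right]
        exact not_lt.1 hy
      have h5 : |y i| < 1 := lt_of_le_of_lt (PiLp.norm_apply_le y i) h4
      have h6 : (2:ℝ) ≤ |(k i : ℝ)| := by
        have : (2:ℤ) ≤ |k i| := by omega
        exact_mod_cast this
      have h7 : |(k i : ℝ)| ≤ |y i| + |y i - k i| := by
        have := abs_sub (y i) (y i - k i)
        simpa using this
      linarith
    rw [h0]
    exact map_zero (fourierInvCLM ℂ 𝓢(E d, ℂ))
  rw [this]
  exact eLpNorm_zero

/-- The embedding of the hyperplane. -/
def emb (m : ℕ) : E m →ₗᵢ[ℝ] E (m+1) where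
  toFun x := (WithLp.equiv 2 (Fin (m+1) → ℝ)).symm
      (Fin.snoc ((WithLp.equiv 2 (Fin m → ℝ)) x) 0)
  map_add' x y := by
    ext i
    refine Fin.lastCases ?_ (fun j => ?_) i <;> simp
  map_smul' c x := by
    ext i
    refine Fin.lastCases ?_ (fun j => ?_) i <;> simp
  norm_map' x := by
    simp [EuclideanSpace.norm_eq, Fin.sum_univ_castSucc]

lemma emb_last (m : ℕ) (x : E m) : emb m x (Fin.last m) = 0 := by
  simp [emb]

/-- The trace of a Schwartz function. -/
def trS {m : ℕ} (f : 𝓢(E (m+1), ℂ)) : 𝓢(E m, ℂ) :=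
  compCLMOfAntilipschitz ℂ (g := emb m)
    ((emb m).toContinuousLinearMap.hasTemperateGrowth) (emb m).isometry.antilipschitz f

lemma tr_eq {m : ℕ} (f : 𝓢(E (m+1), ℂ)) : traceFn (⇑f) = ⇑(trS f) := rfl

/-- Integer frequency shift. -/
def vk (m : ℕ) (k : ℕ) : Fin (m+1) → ℤ := Pi.single (Fin.last m) (4 * ((k:ℤ) + 1))

/-- Real frequency shift. -/
def ak (m : ℕ) (k : ℕ) : E (m+1) := WithLp.toLp 2 (fun i => (vk m k i : ℝ))

/-- The test functions. -/
def fN (m N : ℕ) : 𝓢(E (m+1), ℂ) :=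
  ∑ k ∈ Finset.range N, (((1 / ((k:ℝ) + 1) : ℝ)) : ℂ) •
    𝓕⁻ (compSubConstCLM ℂ (ak m k) (Phi (m+1)))

/-- Harmonic sums. -/
def HN (N : ℕ) : ℝ := ∑ k ∈ Finset.range N, 1 / ((k:ℝ) + 1)

lemma inner_ak (m k : ℕ) (x : E m) : ⟪ak m k, emb m x⟫ = 0 := by
  rw [PiLp.inner_apply]
  apply Finset.sum_eq_zero
  intro i _
  refine Fin.lastCases ?_ (fun j => ?_) i
  · rw [emb_last]; simp
  · simp [ak, vk]

lemma tr_fN (m N : ℕ) : trS (fN m N) = ((HN N : ℝ) : ℂ) • trS (𝓕⁻ (Phi (m+1))) := by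
  ext x
  change (fN m N) (emb m x) = ((HN N : ℝ) : ℂ) * (𝓕⁻ (Phi (m+1))) (emb m x)
  unfold fN HN
  rw [_root_.sum_apply, Complex.ofReal_sum, Finset.sum_mul]
  apply Finset.sum_congr rfl
  intro k _
  rw [_root_.smul_apply, inv_shift, inner_ak]
  simp

lemma box_fN_le (hη : IsBump η) (m N : ℕ) (l : Fin (m+1) → ℤ) {p : ℝ≥0∞} (hp : 1 ≤ p) :
    eLpNorm (boxS η l (fN m N)) p volume ≤ ∑ k ∈ Finset.range N,
      ENNReal.ofReal (1 / ((k:ℝ) + 1)) *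
        eLpNorm (boxS η (l - vk m k) (𝓕⁻ (Phi (m+1)))) p volume := by
  unfold fN
  rw [boxS_sum]
  have hc : ⇑(∑ k ∈ Finset.range N, (((1 / ((k:ℝ) + 1) : ℝ)) : ℂ) •
      boxS η l (𝓕⁻ (compSubConstCLM ℂ (ak m k) (Phi (m+1))))) =
      ∑ k ∈ Finset.range N, (((1 / ((k:ℝ) + 1) : ℝ)) : ℂ) •
      ⇑(boxS η l (𝓕⁻ (compSubConstCLM ℂ (ak m k) (Phi (m+1))))) := by
    ext x
    rw [_root_.sum_apply, Finset.sum_apply]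
    rfl
  rw [hc]
  refine (eLpNorm_sum_le (fun k _ => ?_) hp).trans ?_
  · exact ((boxS η l _).continuous.aestronglyMeasurable).const_smul _
  · apply Finset.sum_le_sum
    intro k _
    rw [eLpNorm_const_smul, box_shift hη l (vk m k) (ak m k) (fun i => rfl)]
    gcongr
    rw [← ofReal_norm, Complex.norm_real, Real.norm_of_nonneg (by positivity)]

lemma jbr_le {m k : ℕ} {l : Fin (m+1) → ℤ} (h : ∀ i, |(l - vk m k) i| ≤ 1) :
    jbr l ≤ Real.sqrt (1 + 25 * ((m:ℝ)+1)) * ((k:ℝ)+1) := by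
  unfold jbr
  rw [← Real.sqrt_eq_rpow]
  apply Real.sqrt_le_iff.2 ⟨by positivity, ?_⟩
  rw [mul_pow, Real.sq_sqrt (by positivity)]
  have h1 : ∀ i, ((l i : ℝ))^2 ≤ 25 * ((k:ℝ)+1)^2 := by
    intro i
    have h2 : |(l i : ℤ)| ≤ 5 * ((k:ℤ)+1) := by
      have h3 := abs_le.1 (h i)
      have h4 : 0 ≤ vk m k i ∧ vk m k i ≤ 4 * ((k:ℤ)+1) := by
        unfold vk
        by_cases hi : i = Fin.last m
        · subst hi; simp; positivity
        · rw [Pi.single_eq_of_ne hi]; constructor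
          · rfl
          · positivity
      simp only [Pi.sub_apply] at h3
      rw [abs_le]; constructor <;> omega
    have h5 : |(l i : ℝ)| ≤ 5 * ((k:ℝ)+1) := by exact_mod_cast h2
    have h6 : |(l i : ℝ)|^2 ≤ (5 * ((k:ℝ)+1))^2 := by gcongr
    rw [sq_abs] at h6
    linarith
  have h7 : ∑ i, ((l i : ℝ))^2 ≤ ∑ _i : Fin (m+1), 25 * ((k:ℝ)+1)^2 :=
    Finset.sum_le_sum fun i _ => h1 i
  simp at h7
  nlinarith [sq_nonneg (k:ℝ), (Nat.cast_nonneg k : (0:ℝ) ≤ k)]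

lemma unique_k {m k k' : ℕ} {l : Fin (m+1) → ℤ} (h : ∀ i, |(l - vk m k) i| ≤ 1)
    (h' : ∀ i, |(l - vk m k') i| ≤ 1) : k = k' := by
  have h1 := abs_le.1 (h (Fin.last m))
  have h2 := abs_le.1 (h' (Fin.last m))
  simp [vk] at h1 h2
  omega

lemma term_le {m N : ℕ} {s r : ℝ} (hs : 0 ≤ s) (hsr : r + s = 1) (b : (Fin (m+1) → ℤ) → ℝ≥0∞)
    (hb : ∀ j, b j ≠ 0 → ∀ i, |j i| ≤ 1) (l : Fin (m+1) → ℤ) :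
    ENNReal.ofReal (jbr l ^ s) * ∑ k ∈ Finset.range N,
      ENNReal.ofReal (1 / ((k:ℝ) + 1)) * b (l - vk m k) ≤
    ∑ k ∈ Finset.range N, ENNReal.ofReal (Real.sqrt (1 + 25 * ((m:ℝ)+1)) ^ s) *
      ENNReal.ofReal (((k:ℝ)+1) ^ (-r)) * b (l - vk m k) := by
  rw [Finset.mul_sum]
  apply Finset.sum_le_sum
  intro k _
  by_cases h : b (l - vk m k) = 0
  · simp [h]
  rw [← mul_assoc]
  refine mul_le_mul' ?_ le_rfl
  have hj : 0 ≤ jbr l := by unfold jbr; positivity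
  rw [← ENNReal.ofReal_mul (Real.rpow_nonneg hj _), ← ENNReal.ofReal_mul (by positivity)]
  apply ENNReal.ofReal_le_ofReal
  calc jbr l ^ s * (1 / ((k:ℝ)+1))
      ≤ (Real.sqrt (1 + 25 * ((m:ℝ)+1)) * ((k:ℝ)+1)) ^ s * (1 / ((k:ℝ)+1)) := by
        gcongr
        exact jbr_le (hb _ h)
    _ = _ := by
        rw [Real.mul_rpow (by positivity) (by positivity), mul_assoc]
        congr 1
        have : -r = s - 1 := by linarith
        rw [this, Real.rpow_sub_one (by positivity)]
        ring

lemma sum_single_cases {m N : ℕ} (b : (Fin (m+1) → ℤ) → ℝ≥0∞)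
    (hb : ∀ j, b j ≠ 0 → ∀ i, |j i| ≤ 1) (w : ℕ → ℝ≥0∞) (l : Fin (m+1) → ℤ) :
    (∀ k ∈ Finset.range N, w k * b (l - vk m k) = 0) ∨
    ∃ k ∈ Finset.range N, ∑ k ∈ Finset.range N, w k * b (l - vk m k) = w k * b (l - vk m k) := by
  by_cases h : ∀ k ∈ Finset.range N, w k * b (l - vk m k) = 0
  · exact Or.inl h
  · right
    push Not at h
    obtain ⟨k, hk, hne⟩ := h
    refine ⟨k, hk, Finset.sum_eq_single_of_mem k hk ?_⟩
    intro k' _ hkk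
    by_contra hne'
    exact hkk (unique_k (hb _ (right_ne_zero_of_mul hne')) (hb _ (right_ne_zero_of_mul hne)))

lemma lq_bound {m : ℕ} {q : ℝ≥0∞} (hq : 1 < q) (b : (Fin (m+1) → ℤ) → ℝ≥0∞)
    (hb : ∀ j, b j ≠ 0 → ∀ i, |j i| ≤ 1) (hbt : ∀ j, b j ≠ ∞) (A : ℝ≥0∞) (hA : A ≠ ∞) :
    ∃ K : ℝ≥0∞, K ≠ ∞ ∧ ∀ N (c : (Fin (m+1) → ℤ) → ℝ≥0∞),
      (∀ l, c l ≤ ∑ k ∈ Finset.range N,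
        A * ENNReal.ofReal (((k:ℝ)+1) ^ (-(1 / q.toReal))) * b (l - vk m k)) →
      lqSum q c ≤ K * ENNReal.ofReal (HN N) ^ (1 / q.toReal) := by
  set S : Finset (Fin (m+1) → ℤ) := Fintype.piFinset fun _ => Finset.Icc (-1) 1 with hS
  have hbS : ∀ j, j ∉ S → b j = 0 := by
    intro j hj
    by_contra hne
    apply hj
    rw [hS, Fintype.mem_piFinset]
    intro i
    rw [Finset.mem_Icc]
    exact abs_le.1 (hb j hne i)
  by_cases hqt : q = ∞
  · refine ⟨A * ∑ j ∈ S, b j, ENNReal.mul_ne_top hA (ENNReal.sum_ne_top.2 fun j _ => hbt j), ?_⟩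
    intro N c hc
    have hble : ∀ j, b j ≤ ∑ j ∈ S, b j := by
      intro j
      by_cases hj : j ∈ S
      · exact Finset.single_le_sum (f := b) (fun _ _ => zero_le) hj
      · rw [hbS j hj]; exact zero_le
    simp only [lqSum, hqt, if_true]
    simp only [ENNReal.toReal_top, div_zero, ENNReal.rpow_zero, mul_one]
    apply iSup_le
    intro l
    refine (hc l).trans ?_
    simp only [hqt, ENNReal.toReal_top, div_zero, neg_zero, Real.rpow_zero, ENNReal.ofReal_one,
      mul_one]
    rcases sum_single_cases (N := N) b hb (fun _ => A) l with h | ⟨k, _, h⟩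
    · rw [Finset.sum_eq_zero h]; exact zero_le
    · rw [h]; gcongr; exact hble _
  · set t := q.toReal with ht
    have ht0 : 0 < t := ENNReal.toReal_pos (zero_lt_one.trans hq).ne' hqt
    refine ⟨A * (∑' j, b j ^ t) ^ (1 / t), ?_, ?_⟩
    · apply ENNReal.mul_ne_top hA
      apply ENNReal.rpow_ne_top_of_nonneg (by positivity)
      rw [tsum_eq_sum (s := S) (fun j hj => by rw [hbS j hj, ENNReal.zero_rpow_of_pos ht0])]
      exact ENNReal.sum_ne_top.2 fun j _ => ENNReal.rpow_ne_top_of_nonneg ht0.le (hbt j)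
    · intro N c hc
      simp only [lqSum, hqt, if_false]
      rw [← ht]
      have h1 : ∀ l, c l ^ t ≤ ∑ k ∈ Finset.range N,
          A ^ t * ENNReal.ofReal (1 / ((k:ℝ)+1)) * b (l - vk m k) ^ t := by
        intro l
        have hw : ∀ k : ℕ, (A * ENNReal.ofReal (((k:ℝ)+1) ^ (-(1 / t))) * b (l - vk m k)) ^ t =
            A ^ t * ENNReal.ofReal (1 / ((k:ℝ)+1)) * b (l - vk m k) ^ t := by
          intro k
          rw [ENNReal.mul_rpow_of_nonneg _ _ ht0.le, ENNReal.mul_rpow_of_nonneg _ _ ht0.le,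
            ENNReal.ofReal_rpow_of_nonneg (by positivity) ht0.le, ← Real.rpow_mul (by positivity)]
          have : -(1 / t) * t = -1 := by field_simp
          rw [this, Real.rpow_neg_one, one_div]
        refine (ENNReal.rpow_le_rpow (hc l) ht0.le).trans ?_
        rcases sum_single_cases (N := N) b hb
          (fun k => A * ENNReal.ofReal (((k:ℝ)+1) ^ (-(1 / t)))) l with h | ⟨k, hk, h⟩
        · rw [Finset.sum_eq_zero h, ENNReal.zero_rpow_of_pos ht0]; exact zero_le
        · rw [h, hw]
          exact Finset.single_le_sum (f := fun k : ℕ =>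
            A ^ t * ENNReal.ofReal (1 / ((k:ℝ)+1)) * b (l - vk m k) ^ t)
            (fun _ _ => zero_le) hk
      have h2 : ∑' l, c l ^ t ≤ A ^ t * (∑' j, b j ^ t) * ENNReal.ofReal (HN N) := by
        calc ∑' l, c l ^ t ≤ ∑' l, ∑ k ∈ Finset.range N,
              A ^ t * ENNReal.ofReal (1 / ((k:ℝ)+1)) * b (l - vk m k) ^ t :=
              ENNReal.tsum_le_tsum h1
          _ = ∑ k ∈ Finset.range N, ∑' l,
              A ^ t * ENNReal.ofReal (1 / ((k:ℝ)+1)) * b (l - vk m k) ^ t :=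
              Summable.tsum_finsetSum fun _ _ => ENNReal.summable
          _ = ∑ k ∈ Finset.range N,
              A ^ t * ENNReal.ofReal (1 / ((k:ℝ)+1)) * ∑' j, b j ^ t := by
              apply Finset.sum_congr rfl
              intro k _
              rw [ENNReal.tsum_mul_left]
              congr 1
              exact (Equiv.subRight (vk m k)).tsum_eq (fun j => b j ^ t)
          _ = _ := by
              unfold HN
              rw [ENNReal.ofReal_sum_of_nonneg (fun k _ => by positivity), Finset.mul_sum]
              apply Finset.sum_congr rfl
              intro k _
              ring
      refine (ENNReal.rpow_le_rpow h2 (by positivity)).trans ?_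
      rw [ENNReal.mul_rpow_of_nonneg _ _ (by positivity),
        ENNReal.mul_rpow_of_nonneg _ _ (by positivity), ← ENNReal.rpow_mul]
      have : t * (1 / t) = 1 := by field_simp
      rw [this, ENNReal.rpow_one]

lemma final_contra {r : ℝ} (hr : r < 1) {X B : ℝ≥0∞} (hX : X ≠ ∞) (hB : B ≠ 0)
    (h : ∀ N, ENNReal.ofReal (HN N) * B ≤ X * ENNReal.ofReal (HN N) ^ r) : False := by
  have hY : X / B ≠ ∞ := ENNReal.div_ne_top hX hB
  set Z := (X / B) ^ (1 / (1 - r)) with hZ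
  have hr' : 0 < 1 - r := by linarith
  have hZt : Z ≠ ∞ := ENNReal.rpow_ne_top_of_nonneg (by positivity) hY
  have htend : Filter.Tendsto HN Filter.atTop Filter.atTop :=
    Real.tendsto_sum_range_one_div_nat_succ_atTop
  obtain ⟨N, hN⟩ := (htend.eventually_gt_atTop Z.toReal).exists
  have hH : 0 < HN N := lt_of_le_of_lt ENNReal.toReal_nonneg hN
  set x := ENNReal.ofReal (HN N) with hx
  have hx0 : x ≠ 0 := (ENNReal.ofReal_pos.2 hH).ne'
  have hxt : x ≠ ∞ := ENNReal.ofReal_ne_top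
  have hlt : Z < x := (ENNReal.lt_ofReal_iff_toReal_lt hZt).2 hN
  have h1 := h N
  rw [← hx] at h1
  have h2 : x = x ^ (1 - r) * x ^ r := by
    rw [← ENNReal.rpow_add _ _ hx0 hxt]; simp
  have hxr0 : x ^ r ≠ 0 := by
    simp [ENNReal.rpow_eq_zero_iff, hx0, hxt]
  have hxrt : x ^ r ≠ ∞ := by
    simp [ENNReal.rpow_eq_top_iff, hx0, hxt]
  have h3 : x ^ (1 - r) * B ≤ X := by
    have h4 : (x ^ (1 - r) * B) * x ^ r ≤ X * x ^ r := by
      calc (x ^ (1 - r) * B) * x ^ r = (x ^ (1 - r) * x ^ r) * B := by ring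
        _ = x * B := by rw [← h2]
        _ ≤ _ := h1
    exact (ENNReal.mul_le_mul_iff_left hxr0 hxrt).1 h4
  have h5 : x ^ (1 - r) ≤ X / B := (ENNReal.le_div_iff_mul_le (Or.inl hB) (Or.inr hX)).2 h3
  have h6 : x ≤ Z := by
    rw [hZ]
    calc x = (x ^ (1 - r)) ^ (1 / (1 - r)) := by
          rw [← ENNReal.rpow_mul, mul_one_div_cancel hr'.ne', ENNReal.rpow_one]
      _ ≤ _ := ENNReal.rpow_le_rpow h5 (by positivity)
  exact absurd hlt (not_lt.2 h6)

lemma le_lqSum {ι : Type*} {q : ℝ≥0∞} (hq : 1 < q) (c : ι → ℝ≥0∞) (i : ι) : c i ≤ lqSum q c := by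
  unfold lqSum
  split_ifs with h
  · exact le_iSup c i
  · have ht0 : 0 < q.toReal := ENNReal.toReal_pos (zero_lt_one.trans hq).ne' h
    calc c i = (c i ^ q.toReal) ^ (1 / q.toReal) := by
          rw [← ENNReal.rpow_mul, mul_one_div_cancel ht0.ne', ENNReal.rpow_one]
      _ ≤ _ := ENNReal.rpow_le_rpow (ENNReal.le_tsum i) (by positivity)

end TraceSharp

/-- For `n = m+1 ≥ 2` and `1 < p, q ≤ ∞`, with `q'` the dual exponent of `q`
(`1/q + 1/q' = 1`), there is no constant `C > 0` with
`‖Tr f‖_{M^0_{p,q}(ℝ^{n-1})} ≤ C ‖f‖_{M^{1/q'}_{p,q}(ℝⁿ)}` for all Schwartz `f`. -/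
theorem trace_modulation_limit_sharp
    (m : ℕ) (hm : 1 ≤ m) (η : ℝ → ℝ) (hη : IsBump η)
    (p q : ℝ≥0∞) (hp : 1 < p) (hq : 1 < q) (q' : ℝ)
    (hq' : (if q = ∞ then 0 else 1 / q.toReal) + 1 / q' = 1) :
    ¬ ∃ C : ℝ≥0∞, 0 < C ∧ C ≠ ∞ ∧
        ∀ f : SchwartzMap (EuclideanSpace ℝ (Fin (m+1))) ℂ,
          modNorm η 0 p q (traceFn (⇑f)) ≤ C * modNorm η (1 / q') p q (⇑f) := by
  open TraceSharp in
  rintro ⟨C, -, hC, hall⟩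
  set r : ℝ := 1 / q.toReal with hr
  have hrs : r + 1 / q' = 1 := by
    have hr2 : (if q = ∞ then 0 else r) = r := by
      split_ifs with h
      · simp [hr, h]
      · rfl
    rwa [hr2] at hq'
  have hr1 : r < 1 := by
    rw [hr]
    by_cases h : q = ∞
    · simp [h]
    · have : 1 < q.toReal := by
        rw [← ENNReal.toReal_one]
        exact (ENNReal.toReal_lt_toReal ENNReal.one_ne_top h).2 hq
      rw [div_lt_one (by linarith)]
      exact this
  have hs : 0 ≤ 1 / q' := by linarith
  have htr : trS (𝓕⁻ (Phi (m+1))) ≠ 0 := by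
    intro h0
    apply inv_Phi_zero (m+1)
    have h1 : (trS (𝓕⁻ (Phi (m+1)))) 0 = (𝓕⁻ (Phi (m+1))) (emb m 0) := rfl
    rw [(emb m).map_zero, h0] at h1
    exact h1.symm
  obtain ⟨k0, hk0⟩ := exists_box_ne hη _ htr p (zero_lt_one.trans hp).ne'
  set b : (Fin (m+1) → ℤ) → ℝ≥0∞ := fun j => eLpNorm (boxS η j (𝓕⁻ (Phi (m+1)))) p volume with hb
  have hb1 : ∀ j, b j ≠ 0 → ∀ i, |j i| ≤ 1 := fun j hj => box_Phi_ne hη hj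
  have hbt : ∀ j, b j ≠ ∞ := fun j => (SchwartzMap.eLpNorm_lt_top _ p volume).ne
  obtain ⟨K, hK, hbound⟩ := lq_bound hq b hb1 hbt
    (ENNReal.ofReal (Real.sqrt (1 + 25 * ((m:ℝ)+1)) ^ (1 / q'))) ENNReal.ofReal_ne_top
  refine final_contra hr1 (ENNReal.mul_ne_top hC hK) hk0 (fun N => ?_)
  have h1 := hall (fN m N)
  have h2 : modNorm η (1 / q') p q (⇑(fN m N)) ≤ K * ENNReal.ofReal (HN N) ^ r := by
    apply hbound N
    intro l
    refine le_trans ?_ (term_le hs hrs b hb1 l)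
    gcongr
    rw [box_eq hη]
    exact box_fN_le hη m N l hp.le
  have h3 : ENNReal.ofReal (HN N) * eLpNorm (boxS η k0 (trS (𝓕⁻ (Phi (m+1))))) p volume ≤
      modNorm η 0 p q (traceFn (⇑(fN m N))) := by
    refine le_trans (le_of_eq ?_) (le_lqSum hq _ k0)
    rw [tr_eq, tr_fN, box_eq hη, boxS_smul, Real.rpow_zero, ENNReal.ofReal_one, one_mul]
    have hH : 0 ≤ HN N := Finset.sum_nonneg fun k _ => by positivity
    have hcoe : ⇑(((HN N : ℝ) : ℂ) • boxS η k0 (trS (𝓕⁻ (Phi (m+1))))) =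
        ((HN N : ℝ) : ℂ) • ⇑(boxS η k0 (trS (𝓕⁻ (Phi (m+1))))) := rfl
    rw [hcoe, eLpNorm_const_smul, ← ofReal_norm, Complex.norm_real,
      Real.norm_of_nonneg hH]
  calc _ ≤ _ := h3
    _ ≤ _ := h1
    _ ≤ C * (K * ENNReal.ofReal (HN N) ^ r) := by gcongr
    _ = _ := by rw [mul_assoc]
end
end

section
/- Let n ≥ 2, 0 < α < 1, 0 < p, q ≤ ∞, and let s_p = (n−1)(1/min(p,1) − 1). Assume s ≥ α(n−1)/q + α s_p (with 1/q = 0 when q = ∞). Then there exists a constant C > 0 such that for every Schwartz function f ∈ 𝒮(ℝⁿ), ‖Tr f‖_{M^{s,α}_{p,q}(ℝ^{n−1})} ≤ C ‖f‖_{M^{s+α/p, α}_{p, min(p,q,1)}(ℝⁿ)}. -/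
open MeasureTheory FourierTransform
open scoped ENNReal NNReal

noncomputable section

/-- The `i`-th coordinate of the center `|k|^{α/(1-α)} k` of the cube `Q_k`. -/
def alphaCenter (α : ℝ) {d : ℕ} (k : Fin d → ℤ) (i : Fin d) : ℝ :=
  Real.sqrt (∑ j, ((k j : ℝ))^2) ^ (α/(1-α)) * k i

/-- `φ^α_k(ξ) = ∏_i η((ξ_i - |k|^{α/(1-α)} k_i)/(r⟨k⟩^{α/(1-α)}))`. -/
def alphaPhi (η : ℝ → ℝ) (α r : ℝ) {d : ℕ} (k : Fin d → ℤ)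
    (ξ : EuclideanSpace ℝ (Fin d)) : ℝ :=
  ∏ i, η ((ξ i - alphaCenter α k i) / (r * jbr k ^ (α/(1-α))))

/-- `ψ^α_k = φ^α_k / Σ_l φ^α_l`. -/
def alphaPsi (η : ℝ → ℝ) (α r : ℝ) {d : ℕ} (k : Fin d → ℤ)
    (ξ : EuclideanSpace ℝ (Fin d)) : ℝ :=
  alphaPhi η α r k ξ / ∑' l : Fin d → ℤ, alphaPhi η α r l ξ

/-- `□^α_k f = 𝓕⁻¹(ψ^α_k 𝓕 f)`. -/
def alphaBox (η : ℝ → ℝ) (α r : ℝ) {d : ℕ} (k : Fin d → ℤ)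
    (f : EuclideanSpace ℝ (Fin d) → ℂ) : EuclideanSpace ℝ (Fin d) → ℂ :=
  𝓕⁻ (fun ξ => (alphaPsi η α r k ξ : ℂ) * 𝓕 f ξ)

/-- The α-modulation space quasi-norm
`‖f‖_{M^{s,α}_{p,q}(ℝ^d)} = (Σ_k ⟨k⟩^{sq/(1-α)} ‖□^α_k f‖_p^q)^{1/q}`. -/
def alphaModNorm (η : ℝ → ℝ) (α r : ℝ) {d : ℕ} (s : ℝ) (p q : ℝ≥0∞)
    (f : EuclideanSpace ℝ (Fin d) → ℂ) : ℝ≥0∞ :=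
  lqSum q (fun k : Fin d → ℤ =>
    ENNReal.ofReal (jbr k ^ (s/(1-α))) * eLpNorm (alphaBox η α r k f) p volume)

/-- `r` is admissible for the `α`-covering in dimension `d`: the cubes
`Q_k = {ξ : ∀ i, |ξ_i - |k|^{α/(1-α)} k_i| ≤ r⟨k⟩^{α/(1-α)}}` cover `ℝ^d` with bounded
overlap of the windows `φ^α_k`. -/
def AlphaAdmissible (η : ℝ → ℝ) (α r : ℝ) (d : ℕ) : Prop :=
  (∀ ξ : EuclideanSpace ℝ (Fin d), ∃ k : Fin d → ℤ,
      ∀ i, |ξ i - alphaCenter α k i| ≤ r * jbr k ^ (α/(1-α))) ∧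
  (∃ n₀ : ℕ, ∀ ξ : EuclideanSpace ℝ (Fin d),
      {k : Fin d → ℤ | alphaPhi η α r k ξ ≠ 0}.encard ≤ n₀)

section Geometry

/-- The centre of the cube `Q_k` as a vector. -/
def cen (α : ℝ) {d : ℕ} (k : Fin d → ℤ) : EuclideanSpace ℝ (Fin d) :=
  WithLp.toLp 2 (alphaCenter α k)

/-- The scale `⟨k⟩^{α/(1-α)}`. -/
def lam (α : ℝ) {d : ℕ} (k : Fin d → ℤ) : ℝ := jbr k ^ (α/(1-α))

/-- `ξ` lies in the closed window of `φ_k`. -/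
def InWin (α r : ℝ) {d : ℕ} (k : Fin d → ℤ) (ξ : EuclideanSpace ℝ (Fin d)) : Prop :=
  ∀ i, |ξ i - alphaCenter α k i| ≤ 2 * r * lam α k

variable {d : ℕ}

lemma one_le_jbr (k : Fin d → ℤ) : 1 ≤ jbr k := by
  unfold jbr
  apply Real.one_le_rpow _ (by norm_num)
  have : 0 ≤ ∑ i, ((k i : ℝ))^2 := Finset.sum_nonneg (fun i _ => sq_nonneg _)
  linarith

lemma jbr_pos (k : Fin d → ℤ) : 0 < jbr k := lt_of_lt_of_le one_pos (one_le_jbr k)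

lemma jbr_sq (k : Fin d → ℤ) : jbr k ^ 2 = 1 + ∑ i, ((k i : ℝ))^2 := by
  have : 0 ≤ ∑ i, ((k i : ℝ))^2 := Finset.sum_nonneg (fun i _ => sq_nonneg _)
  unfold jbr
  rw [← Real.rpow_natCast, ← Real.rpow_mul (by linarith)]
  norm_num

lemma abs_le_jbr (k : Fin d → ℤ) (i : Fin d) : |(k i : ℝ)| ≤ jbr k := by
  apply abs_le_of_sq_le_sq _ (jbr_pos k).le
  rw [jbr_sq]
  have := Finset.single_le_sum (f := fun i => ((k i : ℝ))^2) (fun i _ => sq_nonneg _) (Finset.mem_univ i)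
  linarith

lemma aexp_pos {α : ℝ} (h0 : 0 < α) (h1 : α < 1) : 0 < α/(1-α) := div_pos h0 (by linarith)

lemma one_le_lam {α : ℝ} (h0 : 0 < α) (h1 : α < 1) (k : Fin d → ℤ) : 1 ≤ lam α k :=
  Real.one_le_rpow (one_le_jbr k) (aexp_pos h0 h1).le

lemma lam_pos {α : ℝ} (k : Fin d → ℤ) : 0 < lam α k := Real.rpow_pos_of_pos (jbr_pos k) _

lemma norm_le_sum_abs (x : EuclideanSpace ℝ (Fin d)) : ‖x‖ ≤ ∑ i, |x i| := by
  rw [EuclideanSpace.norm_eq]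
  apply Real.sqrt_le_iff.mpr
  refine ⟨Finset.sum_nonneg fun i _ => abs_nonneg _, ?_⟩
  simpa using Finset.sum_sq_le_sq_sum_of_nonneg (s := Finset.univ) (f := fun i => |x i|)
    (fun i _ => abs_nonneg _)

lemma abs_coord_le_norm (x : EuclideanSpace ℝ (Fin d)) (i : Fin d) : |x i| ≤ ‖x‖ := by
  simpa using PiLp.norm_apply_le x i

lemma norm_cen (α : ℝ) (k : Fin d → ℤ) :
    ‖cen α k‖ = Real.sqrt (∑ j, ((k j : ℝ))^2) ^ (α/(1-α)) * Real.sqrt (∑ j, ((k j : ℝ))^2) := by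
  have : cen α k = (Real.sqrt (∑ j, ((k j : ℝ))^2) ^ (α/(1-α))) •
      (WithLp.toLp 2 (fun i => (k i : ℝ)) : EuclideanSpace ℝ (Fin d)) := by
    ext i; simp [cen, alphaCenter]
  rw [this, norm_smul, EuclideanSpace.norm_eq]
  rw [Real.norm_of_nonneg (by positivity)]
  simp

lemma InWin.norm_sub_le {α r : ℝ} {k : Fin d → ℤ} {ξ : EuclideanSpace ℝ (Fin d)}
    (h : InWin α r k ξ) : ‖ξ - cen α k‖ ≤ d * (2 * r * lam α k) := by
  refine (norm_le_sum_abs _).trans ?_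
  calc ∑ i, |(ξ - cen α k) i| ≤ ∑ i : Fin d, 2 * r * lam α k :=
        Finset.sum_le_sum fun i _ => by simpa [cen] using h i
    _ = _ := by simp

lemma jbr_le_sqrt (k : Fin d → ℤ) : jbr k ≤ 1 + Real.sqrt (∑ j, ((k j : ℝ))^2) := by
  apply le_of_sq_le_sq _ (by positivity)
  rw [jbr_sq]
  have h : 0 ≤ ∑ j, ((k j : ℝ))^2 := Finset.sum_nonneg fun i _ => sq_nonneg _
  nlinarith [Real.sq_sqrt h, Real.sqrt_nonneg (∑ j, ((k j : ℝ))^2)]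

lemma sqrt_le_jbr (k : Fin d → ℤ) : Real.sqrt (∑ j, ((k j : ℝ))^2) ≤ jbr k := by
  apply Real.sqrt_le_iff.mpr
  refine ⟨(jbr_pos k).le, ?_⟩
  rw [jbr_sq]; linarith

lemma size_compare {α r : ℝ} (h0 : 0 < α) (h1 : α < 1) (hr : 0 < r) (d : ℕ) :
    ∃ C : ℝ, 0 < C ∧ ∀ (k : Fin d → ℤ) (ξ : EuclideanSpace ℝ (Fin d)), InWin α r k ξ →
      jbr k ^ (α/(1-α) + 1) ≤ C * (1 + ‖ξ‖) ∧ 1 + ‖ξ‖ ≤ C * jbr k ^ (α/(1-α) + 1) := by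
  set a := α/(1-α) with ha
  have hapos : 0 < a := aexp_pos h0 h1
  set D : ℝ := d * (2 * r) with hD
  have hD0 : 0 ≤ D := by positivity
  set T : ℝ := 2 ^ (a+1) with hT
  have hT0 : 0 < T := by positivity
  set L0 : ℝ := 2 * T * D + 1 with hL0
  have hL00 : 0 < L0 := by positivity
  refine ⟨2 * T + L0 ^ (a+1) + (2 + D), by positivity, fun k ξ h => ?_⟩
  have hJ := one_le_jbr k
  have hJ0 := jbr_pos k
  have hn := h.norm_sub_le
  have hlam : lam α k = jbr k ^ a := rfl
  rw [hlam] at hn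
  have hJa : jbr k ^ (a+1) = jbr k ^ a * jbr k := Real.rpow_add_one hJ0.ne' a
  have hJa0 : 0 < jbr k ^ a := by positivity
  have hJa1 : jbr k ^ a ≤ jbr k ^ (a+1) := by rw [hJa]; nlinarith
  have hJ1 : 1 ≤ jbr k ^ (a+1) := Real.one_le_rpow hJ (by linarith)
  set σ := Real.sqrt (∑ j, ((k j : ℝ))^2) with hσ
  have hσ0 : 0 ≤ σ := Real.sqrt_nonneg _
  have hc : ‖cen α k‖ = σ ^ (a+1) := by
    rw [norm_cen, Real.rpow_add_one' hσ0 (by positivity)]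
  have hL0p : 0 < L0 ^ (a+1) := by positivity
  have hx := norm_nonneg ξ
  constructor
  · have e1 : jbr k ^ (a+1) ≤ T * (1 + σ ^ (a+1)) := by
      have : jbr k ≤ 2 * max 1 σ := by
        have := jbr_le_sqrt k
        have := le_max_left 1 σ
        have := le_max_right 1 σ
        linarith
      calc jbr k ^ (a+1) ≤ (2 * max 1 σ) ^ (a+1) := Real.rpow_le_rpow hJ0.le this (by linarith)
        _ = T * (max 1 σ) ^ (a+1) := Real.mul_rpow (by norm_num) (by positivity)
        _ ≤ T * (1 + σ ^ (a+1)) := by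
          gcongr
          rcases max_cases 1 σ with ⟨h, _⟩ | ⟨h, _⟩ <;> rw [h]
          · simp; positivity
          · linarith
    have e2 : σ ^ (a+1) ≤ ‖ξ‖ + D * jbr k ^ a := by
      rw [← hc]
      have := norm_sub_norm_le (cen α k) ξ
      rw [norm_sub_rev] at this
      rw [hD]; linarith
    rcases le_total (2 * T * D) (jbr k) with hcase | hcase
    · have : T * (D * jbr k ^ a) ≤ jbr k ^ (a+1) / 2 := by
        rw [hJa]; nlinarith
      have : jbr k ^ (a+1) ≤ 2 * T * (1 + ‖ξ‖) := by nlinarith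
      refine this.trans ?_
      gcongr
      linarith
    · have : jbr k ^ (a+1) ≤ L0 ^ (a+1) := Real.rpow_le_rpow hJ0.le (by linarith) (by linarith)
      nlinarith
  · have : ‖ξ‖ ≤ σ ^ (a+1) + D * jbr k ^ a := by
      rw [← hc]
      have := norm_sub_norm_le ξ (cen α k)
      rw [hD]; linarith
    have h3 : σ ^ (a+1) ≤ jbr k ^ (a+1) := Real.rpow_le_rpow hσ0 (sqrt_le_jbr k) (by linarith)
    have : 1 + ‖ξ‖ ≤ (2 + D) * jbr k ^ (a+1) := by nlinarith
    refine this.trans (mul_le_mul_of_nonneg_right ?_ (by linarith))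
    linarith

lemma jbr_compare {α r : ℝ} (h0 : 0 < α) (h1 : α < 1) (hr : 0 < r) (d d' : ℕ) :
    ∃ C : ℝ, 1 ≤ C ∧ ∀ (k : Fin d → ℤ) (ξ : EuclideanSpace ℝ (Fin d)) (l : Fin d' → ℤ)
      (ξ' : EuclideanSpace ℝ (Fin d')), InWin α r k ξ → InWin α r l ξ' → ‖ξ'‖ ≤ ‖ξ‖ →
      jbr l ≤ C * jbr k ∧ lam α l ≤ C * lam α k := by
  obtain ⟨C, hC, hk⟩ := size_compare h0 h1 hr d
  obtain ⟨C', hC', hl⟩ := size_compare h0 h1 hr d'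
  set a := α/(1-α) with ha
  have hapos : 0 < a := aexp_pos h0 h1
  set B := (C' * C) ^ ((a+1)⁻¹) with hB
  have hB0 : 0 < B := by positivity
  refine ⟨max 1 (max B (B ^ a)), le_max_left _ _, fun k ξ l ξ' h h' hle => ?_⟩
  have e1 : jbr l ^ (a+1) ≤ (C' * C) * jbr k ^ (a+1) := by
    have := (hk k ξ h).2
    have := (hl l ξ' h').1
    nlinarith
  have e2 : jbr l ≤ B * jbr k := by
    have := Real.rpow_le_rpow (by have := jbr_pos l; positivity) e1 (z := (a+1)⁻¹) (by positivity)
    rwa [Real.rpow_rpow_inv (jbr_pos l).le (by positivity), Real.mul_rpow (by positivity)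
      (by have := jbr_pos k; positivity), Real.rpow_rpow_inv (jbr_pos k).le (by positivity)] at this
  have hk0 := jbr_pos k
  constructor
  · refine e2.trans ?_
    gcongr
    exact (le_max_left _ _).trans (le_max_right _ _)
  · have : lam α l ≤ B ^ a * lam α k := by
      unfold lam
      rw [← Real.mul_rpow hB0.le hk0.le]
      exact Real.rpow_le_rpow (jbr_pos l).le e2 hapos.le
    refine this.trans ?_
    have := lam_pos (α := α) k
    gcongr
    exact (le_max_right _ _).trans (le_max_right _ _)

lemma win_finite {α r : ℝ} (h0 : 0 < α) (h1 : α < 1) (hr : 0 < r) (d : ℕ) (ρ : ℝ) :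
    {k : Fin d → ℤ | ∃ ξ : EuclideanSpace ℝ (Fin d), ‖ξ‖ ≤ ρ ∧ InWin α r k ξ}.Finite := by
  obtain ⟨C, hC, hk⟩ := size_compare h0 h1 hr d
  set N : ℤ := ⌈C * (1 + ρ)⌉ with hN
  apply (Set.finite_Icc (fun _ : Fin d => -N) (fun _ => N)).subset
  rintro k ⟨ξ, hξ, hw⟩
  have h2 := (hk k ξ hw).1
  have h3 : jbr k ≤ jbr k ^ (α/(1-α) + 1) := by
    conv_lhs => rw [← Real.rpow_one (jbr k)]
    apply Real.rpow_le_rpow_of_exponent_le (one_le_jbr k)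
    linarith [aexp_pos h0 h1]
  have h4 : ∀ i, |k i| ≤ N := by
    intro i
    have : |(k i : ℝ)| ≤ N := by
      calc |(k i : ℝ)| ≤ jbr k := abs_le_jbr k i
        _ ≤ C * (1 + ‖ξ‖) := h3.trans h2
        _ ≤ C * (1 + ρ) := by gcongr
        _ ≤ N := Int.le_ceil _
    exact_mod_cast this
  exact ⟨fun i => (abs_le.mp (h4 i)).1, fun i => (abs_le.mp (h4 i)).2⟩

variable {η : ℝ → ℝ}

lemma alphaPhi_nonneg (hη : IsBump η) (α r : ℝ) (k : Fin d → ℤ) (ξ) : 0 ≤ alphaPhi η α r k ξ :=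
  Finset.prod_nonneg fun _ _ => (hη.2.1 _).1

lemma alphaPhi_eq_zero (hη : IsBump η) {α r : ℝ} (hr : 0 < r) {k : Fin d → ℤ}
    {ξ : EuclideanSpace ℝ (Fin d)} (h : ¬ InWin α r k ξ) : alphaPhi η α r k ξ = 0 := by
  unfold InWin at h
  push Not at h
  obtain ⟨i, hi⟩ := h
  apply Finset.prod_eq_zero (Finset.mem_univ i)
  apply hη.2.2.2
  have hl := lam_pos (α := α) k
  change 2 ≤ |(ξ i - alphaCenter α k i) / (r * lam α k)|
  rw [abs_div, abs_of_pos (by positivity : 0 < r * lam α k), le_div_iff₀ (by positivity)]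
  linarith

lemma alphaPhi_eq_one (hη : IsBump η) {α r : ℝ} (hr : 0 < r) {k : Fin d → ℤ}
    {ξ : EuclideanSpace ℝ (Fin d)} (h : ∀ i, |ξ i - alphaCenter α k i| ≤ r * lam α k) :
    alphaPhi η α r k ξ = 1 := by
  apply Finset.prod_eq_one
  intro i _
  apply hη.2.2.1
  have hl := lam_pos (α := α) k
  change |(ξ i - alphaCenter α k i) / (r * lam α k)| ≤ 1
  rw [abs_div, abs_of_pos (by positivity : 0 < r * lam α k), div_le_iff₀ (by positivity)]
  linarith [h i]

lemma packing (hη : IsBump η) {α r : ℝ} (hr : 0 < r) (hadm : AlphaAdmissible η α r d) :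
    ∃ C : ℝ≥0∞, C ≠ ∞ ∧ ∀ (z : EuclideanSpace ℝ (Fin d)) (ρ : ℝ) (A : Set (Fin d → ℤ)), 0 ≤ ρ →
      (∀ l ∈ A, Metric.closedBall (cen α l) (r * lam α l) ⊆ Metric.closedBall z ρ) →
      ∑' l, A.indicator (fun l => ENNReal.ofReal (lam α l) ^ d) l ≤ C * ENNReal.ofReal ρ ^ d := by
  obtain ⟨n₀, hn₀⟩ := hadm.2
  set v : ℝ≥0∞ := volume (Metric.ball (0 : EuclideanSpace ℝ (Fin d)) 1) with hv
  have hv0 : v ≠ 0 := (Metric.measure_ball_pos _ _ one_pos).ne'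
  have hvt : v ≠ ∞ := measure_ball_lt_top.ne
  refine ⟨n₀ * (ENNReal.ofReal r ^ d)⁻¹, by
    apply ENNReal.mul_ne_top (by simp)
    simp [hr], fun z ρ A hρ hA => ?_⟩
  have hvol : ∀ (x : EuclideanSpace ℝ (Fin d)) (t : ℝ), 0 ≤ t →
      volume (Metric.closedBall x t) = ENNReal.ofReal t ^ d * v := by
    intro x t ht
    rw [Measure.addHaar_closedBall _ _ ht, finrank_euclideanSpace_fin, ENNReal.ofReal_pow ht]
  have key : ∑' l, A.indicator (fun l => volume (Metric.closedBall (cen α l) (r * lam α l))) l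
      ≤ n₀ * volume (Metric.closedBall z ρ) := by
    calc ∑' l, A.indicator (fun l => volume (Metric.closedBall (cen α l) (r * lam α l))) l
        = ∑' l, ∫⁻ ξ, A.indicator (fun l =>
            (Metric.closedBall (cen α l) (r * lam α l)).indicator (fun _ => (1:ℝ≥0∞)) ξ) l := by
          congr 1; ext l
          by_cases hl : l ∈ A
          · simp [hl, lintegral_indicator, measurableSet_closedBall]
          · simp [hl]
      _ = ∫⁻ ξ, ∑' l, A.indicator (fun l =>
            (Metric.closedBall (cen α l) (r * lam α l)).indicator (fun _ => (1:ℝ≥0∞)) ξ) l := by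
          rw [lintegral_tsum]
          intro l
          by_cases hl : l ∈ A
          · simp only [Set.indicator_of_mem hl]
            exact (measurable_const.indicator measurableSet_closedBall).aemeasurable
          · simp [hl]
      _ ≤ ∫⁻ ξ, (Metric.closedBall z ρ).indicator (fun _ => (n₀ : ℝ≥0∞)) ξ := by
          apply lintegral_mono
          intro ξ
          by_cases hξ : ξ ∈ Metric.closedBall z ρ
          · simp only [Set.indicator_of_mem hξ]
            calc ∑' l, A.indicator (fun l =>
                  (Metric.closedBall (cen α l) (r * lam α l)).indicator (fun _ => (1:ℝ≥0∞)) ξ) l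
                ≤ ∑' l, ({k : Fin d → ℤ | alphaPhi η α r k ξ ≠ 0}).indicator
                    (fun _ => (1 : ℝ≥0∞)) l := by
                  apply ENNReal.tsum_le_tsum
                  intro l
                  by_cases hl : l ∈ A
                  · simp only [Set.indicator_of_mem hl]
                    by_cases hb : ξ ∈ Metric.closedBall (cen α l) (r * lam α l)
                    · have : l ∈ {k : Fin d → ℤ | alphaPhi η α r k ξ ≠ 0} := by
                        simp only [Set.mem_ofPred_eq]
                        rw [alphaPhi_eq_one hη hr]
                        · exact one_ne_zero
                        · intro i
                          have h1 := abs_coord_le_norm (ξ - cen α l) i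
                          rw [Metric.mem_closedBall, dist_eq_norm] at hb
                          simp only [cen] at h1 hb
                          simpa using h1.trans hb
                      rw [Set.indicator_of_mem this, Set.indicator_of_mem hb]
                    · rw [Set.indicator_of_notMem hb]; exact zero_le
                  · simp [hl]
              _ = ({k : Fin d → ℤ | alphaPhi η α r k ξ ≠ 0}).encard := by
                  rw [← tsum_subtype, ENNReal.tsum_set_one]
              _ ≤ n₀ := by exact_mod_cast hn₀ ξ
          · rw [Set.indicator_of_notMem hξ]
            simp only [nonpos_iff_eq_zero, ENNReal.tsum_eq_zero]
            intro l
            by_cases hl : l ∈ A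
            · simp only [Set.indicator_of_mem hl]
              rw [Set.indicator_of_notMem]
              exact fun hb => hξ (hA l hl hb)
            · simp [hl]
      _ = _ := by simp [lintegral_indicator, measurableSet_closedBall]
  have key2 : ∑' l, A.indicator (fun l => ENNReal.ofReal (lam α l) ^ d) l *
      (ENNReal.ofReal r ^ d * v) ≤ (n₀ * ENNReal.ofReal ρ ^ d) * v := by
    calc _ = ∑' l, A.indicator (fun l => volume (Metric.closedBall (cen α l) (r * lam α l))) l := by
          congr 1; ext l
          by_cases hl : l ∈ A
          · simp only [Set.indicator_of_mem hl]
            rw [hvol _ _ (by have := lam_pos (α := α) l; positivity), ENNReal.ofReal_mul hr.le, mul_pow]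
            ring
          · simp [hl]
      _ ≤ _ := key
      _ = _ := by rw [hvol _ _ hρ]; ring
  rw [ENNReal.tsum_mul_right, ← mul_assoc] at key2
  have key3 := (ENNReal.mul_le_mul_iff_left hv0 hvt).mp key2
  have hr0 : ENNReal.ofReal r ^ d ≠ 0 := by simp [hr]
  have hrt : ENNReal.ofReal r ^ d ≠ ∞ := by finiteness
  rw [← ENNReal.le_div_iff_mul_le (Or.inl hr0) (Or.inl hrt)] at key3
  refine key3.trans (le_of_eq ?_)
  rw [div_eq_mul_inv]; ring

end Geometry

section Smooth

variable {d : ℕ} {η : ℝ → ℝ} {α r : ℝ}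

open Set Filter Topology

lemma alphaPhi_contDiff (hη : IsBump η) (k : Fin d → ℤ) :
    ContDiff ℝ (⊤ : ℕ∞) (alphaPhi η α r k) := by
  unfold alphaPhi
  apply contDiff_prod
  intro i _
  apply hη.1.comp
  apply ContDiff.div_const
  apply ContDiff.sub _ contDiff_const
  fun_prop

lemma alphaPhi_le_one (hη : IsBump η) (k : Fin d → ℤ) (ξ) : alphaPhi η α r k ξ ≤ 1 :=
  Finset.prod_le_one (fun _ _ => (hη.2.1 _).1) fun _ _ => (hη.2.1 _).2

/-- the sum of all windows -/
def sPhi (η : ℝ → ℝ) (α r : ℝ) {d : ℕ} (ξ : EuclideanSpace ℝ (Fin d)) : ℝ :=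
  ∑' l : Fin d → ℤ, alphaPhi η α r l ξ

lemma loc_finset (h0 : 0 < α) (h1 : α < 1) (hr : 0 < r) (d : ℕ) (ρ : ℝ) :
    ∃ F : Finset (Fin d → ℤ), ∀ (ξ : EuclideanSpace ℝ (Fin d)) (k : Fin d → ℤ), ‖ξ‖ ≤ ρ →
      InWin α r k ξ → k ∈ F := by
  refine ⟨(win_finite h0 h1 hr d ρ).toFinset, fun ξ k h1 h2 => ?_⟩
  simp only [Set.Finite.mem_toFinset]
  exact ⟨ξ, h1, h2⟩

lemma sPhi_eq_sum (hη : IsBump η) (hr : 0 < r) {F : Finset (Fin d → ℤ)}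
    {ξ : EuclideanSpace ℝ (Fin d)} (hF : ∀ k, InWin α r k ξ → k ∈ F) :
    sPhi η α r ξ = ∑ l ∈ F, alphaPhi η α r l ξ := by
  apply tsum_eq_sum
  intro k hk
  exact alphaPhi_eq_zero hη hr fun h => hk (hF k h)

lemma sPhi_contDiff (hη : IsBump η) (h0 : 0 < α) (h1 : α < 1) (hr : 0 < r) :
    ContDiff ℝ (⊤ : ℕ∞) (sPhi η α r (d := d)) := by
  rw [contDiff_iff_contDiffAt]
  intro ξ
  obtain ⟨F, hF⟩ := loc_finset h0 h1 hr d (‖ξ‖ + 1)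
  have : sPhi η α r (d := d) =ᶠ[𝓝 ξ] fun x => ∑ l ∈ F, alphaPhi η α r l x := by
    filter_upwards [Metric.ball_mem_nhds ξ one_pos] with x hx
    apply sPhi_eq_sum hη hr
    intro k hk
    apply hF x k _ hk
    rw [mem_ball_iff_norm] at hx
    have := norm_le_norm_add_norm_sub' x ξ
    linarith
  apply ContDiffAt.congr_of_eventuallyEq _ this
  exact (ContDiff.sum fun l _ => alphaPhi_contDiff hη l).contDiffAt

lemma phi_summable (hη : IsBump η) (h0 : 0 < α) (h1 : α < 1) (hr : 0 < r)
    (ξ : EuclideanSpace ℝ (Fin d)) : Summable fun l : Fin d → ℤ => alphaPhi η α r l ξ := by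
  obtain ⟨F, hF⟩ := loc_finset h0 h1 hr d ‖ξ‖
  apply summable_of_ne_finset_zero (s := F)
  intro k hk
  exact alphaPhi_eq_zero hη hr fun h => hk (hF ξ k le_rfl h)

lemma one_le_sPhi (hη : IsBump η) (h0 : 0 < α) (h1 : α < 1) (hr : 0 < r)
    (hadm : AlphaAdmissible η α r d) (ξ : EuclideanSpace ℝ (Fin d)) : 1 ≤ sPhi η α r ξ := by
  obtain ⟨k, hk⟩ := hadm.1 ξ
  have : alphaPhi η α r k ξ = 1 := alphaPhi_eq_one hη hr hk
  rw [← this]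
  exact (phi_summable hη h0 h1 hr ξ).le_tsum k (fun l _ => alphaPhi_nonneg hη α r l ξ)

lemma alphaPsi_eq (k : Fin d → ℤ) (ξ) : alphaPsi η α r k ξ = alphaPhi η α r k ξ / sPhi η α r ξ := rfl

lemma alphaPsi_contDiff (hη : IsBump η) (h0 : 0 < α) (h1 : α < 1) (hr : 0 < r)
    (hadm : AlphaAdmissible η α r d) (k : Fin d → ℤ) :
    ContDiff ℝ (⊤ : ℕ∞) (alphaPsi η α r k) := by
  apply (alphaPhi_contDiff hη k).div (sPhi_contDiff hη h0 h1 hr)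
  intro ξ
  have := one_le_sPhi hη h0 h1 hr hadm ξ
  linarith

lemma alphaPsi_nonneg (hη : IsBump η) (k : Fin d → ℤ) (ξ) : 0 ≤ alphaPsi η α r k ξ :=
  div_nonneg (alphaPhi_nonneg hη _ _ _ _) (tsum_nonneg fun _ => alphaPhi_nonneg hη _ _ _ _)

lemma alphaPsi_eq_zero (hη : IsBump η) (hr : 0 < r) {k : Fin d → ℤ}
    {ξ : EuclideanSpace ℝ (Fin d)} (h : ¬ InWin α r k ξ) : alphaPsi η α r k ξ = 0 := by
  rw [alphaPsi_eq, alphaPhi_eq_zero hη hr h, zero_div]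

lemma alphaPsi_hasSum (hη : IsBump η) (h0 : 0 < α) (h1 : α < 1) (hr : 0 < r)
    (hadm : AlphaAdmissible η α r d) (ξ : EuclideanSpace ℝ (Fin d)) :
    HasSum (fun k => alphaPsi η α r k ξ) 1 := by
  have h := (phi_summable hη h0 h1 hr ξ).hasSum.div_const (sPhi η α r ξ)
  have h2 := one_le_sPhi hη h0 h1 hr hadm ξ
  change HasSum _ (sPhi η α r ξ / _) at h
  rwa [div_self (by linarith)] at h

lemma alphaPsi_le_one (hη : IsBump η) (h0 : 0 < α) (h1 : α < 1) (hr : 0 < r)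
    (hadm : AlphaAdmissible η α r d) (k : Fin d → ℤ) (ξ : EuclideanSpace ℝ (Fin d)) :
    alphaPsi η α r k ξ ≤ 1 :=
  le_hasSum (alphaPsi_hasSum hη h0 h1 hr hadm ξ) k fun j _ => alphaPsi_nonneg hη j ξ

lemma alphaPsi_compact (hη : IsBump η) (hr : 0 < r) (k : Fin d → ℤ) :
    HasCompactSupport (alphaPsi η α r k) := by
  apply HasCompactSupport.of_support_subset_isCompact
    (isCompact_closedBall (cen α k) (d * (2 * r * lam α k)))
  intro ξ hξ
  rw [mem_closedBall_iff_norm]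
  apply InWin.norm_sub_le
  by_contra h
  exact hξ (alphaPsi_eq_zero hη hr h)

lemma win_count (hη : IsBump η) (h0 : 0 < α) (h1 : α < 1) (hr : 0 < r)
    (hadm : AlphaAdmissible η α r d) :
    ∃ N : ℕ, ∀ (ξ : EuclideanSpace ℝ (Fin d)) (F : Finset (Fin d → ℤ)),
      (∀ k ∈ F, InWin α r k ξ) → F.card ≤ N := by
  obtain ⟨C, hC, hpack⟩ := packing hη hr hadm
  obtain ⟨B, hB, hcomp⟩ := jbr_compare h0 h1 hr d d
  set T : ℝ≥0∞ := C * ENNReal.ofReal ((r + d * (2 * r)) * (B * B)) ^ d with hT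
  have hTt : T ≠ ∞ := by finiteness
  obtain ⟨N, hN⟩ := ENNReal.exists_nat_gt hTt
  refine ⟨N, fun ξ F hF => ?_⟩
  rcases F.eq_empty_or_nonempty with rfl | ⟨k₀, hk₀⟩
  · simp
  have hw0 := hF k₀ hk₀
  have hl0 := lam_pos (α := α) k₀
  have h1 := hpack ξ ((r + d * (2 * r)) * (B * lam α k₀)) (F : Set (Fin d → ℤ)) (by positivity) ?_
  · have hlow : ∀ l ∈ F, ENNReal.ofReal (lam α k₀ / B) ^ d ≤ ENNReal.ofReal (lam α l) ^ d := by
      intro l hl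
      gcongr
      rw [div_le_iff₀ (by positivity)]
      have := (hcomp l ξ k₀ ξ (hF l hl) hw0 le_rfl).2
      linarith
    have h2 : (F.card : ℝ≥0∞) * ENNReal.ofReal (lam α k₀ / B) ^ d ≤
        T * ENNReal.ofReal (lam α k₀ / B) ^ d := by
      calc (F.card : ℝ≥0∞) * ENNReal.ofReal (lam α k₀ / B) ^ d
          = ∑ l ∈ F, ENNReal.ofReal (lam α k₀ / B) ^ d := by simp
        _ ≤ ∑ l ∈ F, ENNReal.ofReal (lam α l) ^ d := Finset.sum_le_sum hlow
        _ = ∑' l, (F : Set (Fin d → ℤ)).indicator (fun l => ENNReal.ofReal (lam α l) ^ d) l := by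
            rw [← Finset.tsum_subtype, ← tsum_subtype]; rfl
        _ ≤ _ := h1
        _ = _ := by
            rw [hT, mul_assoc, ← mul_pow, ← ENNReal.ofReal_mul (by positivity)]
            congr 3
            field_simp
    have h3 := (ENNReal.mul_le_mul_iff_left (by
      have : 0 < lam α k₀ / B := by positivity
      simp [this]) (by finiteness)).mp h2
    exact_mod_cast (h3.trans hN.le)
  · intro l hl x hx
    have hwl := hF l hl
    have := hwl.norm_sub_le
    have h2 := (hcomp k₀ ξ l ξ hw0 hwl le_rfl).2
    rw [mem_closedBall_iff_norm] at hx ⊢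
    calc ‖x - ξ‖ ≤ ‖x - cen α l‖ + ‖ξ - cen α l‖ := by
          have := norm_sub_le (x - cen α l) (ξ - cen α l)
          simpa using this
      _ ≤ r * lam α l + d * (2 * r * lam α l) := by gcongr
      _ = (r + d * (2 * r)) * lam α l := by ring
      _ ≤ _ := by gcongr

/-- all derivatives up to order N of the one dimensional bump are bounded -/
lemma eta_deriv_bound (hη : IsBump η) (N : ℕ) :
    ∃ C : ℝ, 0 ≤ C ∧ ∀ i ≤ N, ∀ t, ‖iteratedFDeriv ℝ i η t‖ ≤ C := by
  have hcs : HasCompactSupport η := by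
    apply HasCompactSupport.of_support_subset_isCompact (isCompact_Icc (a := (-2:ℝ)) (b := 2))
    intro t ht
    by_contra h
    apply ht
    apply hη.2.2.2
    by_contra h2
    apply h
    exact abs_le.mp (not_le.mp h2).le
  have : ∀ i : ℕ, ∃ C : ℝ, ∀ t, ‖iteratedFDeriv ℝ i η t‖ ≤ C := by
    intro i
    exact (hcs.iteratedFDeriv i).exists_bound_of_continuous
      ((hη.1.of_le (by exact_mod_cast le_top)).continuous_iteratedFDeriv')
  choose C hC using this
  refine ⟨∑ i ∈ Finset.range (N+1), |C i|, by positivity, fun i hi t => ?_⟩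
  refine (hC i t).trans ((le_abs_self _).trans ?_)
  exact Finset.single_le_sum (f := fun i => |C i|) (fun i _ => abs_nonneg _) (by simp; omega)

lemma eta_affine_bound (hη : IsBump η) (d N : ℕ) (M : ℝ) :
    ∃ C : ℝ, 0 ≤ C ∧ ∀ (μ b : ℝ) (j : Fin d), |μ| ≤ M → ∀ i ≤ N,
      ∀ ζ : EuclideanSpace ℝ (Fin d), ‖iteratedFDeriv ℝ i (fun ζ : EuclideanSpace ℝ (Fin d) =>
        η (μ * ζ j + b)) ζ‖ ≤ C := by
  obtain ⟨C₀, hC₀, hb⟩ := eta_deriv_bound hη N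
  set D := max 1 M with hD
  have hD1 : 1 ≤ D := le_max_left _ _
  refine ⟨N.factorial * C₀ * D ^ N, by positivity, fun μ b j hμ i hi ζ => ?_⟩
  let L : EuclideanSpace ℝ (Fin d) →L[ℝ] ℝ := μ • (EuclideanSpace.proj j)
  have hLn : ‖L‖ ≤ D := by
    apply ContinuousLinearMap.opNorm_le_bound _ (by positivity)
    intro x
    change ‖μ * x j‖ ≤ _
    rw [norm_mul, Real.norm_eq_abs, Real.norm_eq_abs]
    have := abs_coord_le_norm x j
    gcongr
    exact hμ.trans (le_max_right _ _)
  have hfun : (fun ζ : EuclideanSpace ℝ (Fin d) => η (μ * ζ j + b)) = η ∘ (fun ζ => L ζ + b) := by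
    ext ζ; simp [L]
  rw [hfun]
  have hfder : ∀ ζ, fderiv ℝ (fun ζ => L ζ + b) ζ = L := by
    intro ζ
    simp [fderiv_add_const]
  have := norm_iteratedFDeriv_comp_le (g := η) (f := fun ζ => L ζ + b) (n := i) (N := (⊤ : ℕ∞))
    hη.1 (L.contDiff.add contDiff_const) (by exact_mod_cast le_top) ζ (C := C₀) (D := D)
    (fun i' hi' => hb i' (hi'.trans hi) _) ?_
  · refine this.trans ?_
    gcongr
  · intro i' h1 h2
    obtain ⟨i'', rfl⟩ : ∃ i'', i' = i'' + 1 := ⟨i' - 1, by omega⟩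
    rw [← norm_iteratedFDeriv_fderiv]
    have e : fderiv ℝ (fun ζ => L ζ + b) = fun _ => L := funext hfder
    rw [e]
    rcases i'' with _ | i''
    · simpa using hLn
    · rw [iteratedFDeriv_const_of_ne (by omega)]
      simp; positivity

lemma eta_prod_bound (hη : IsBump η) (d N : ℕ) (M : ℝ) :
    ∃ C : ℝ, 0 ≤ C ∧ ∀ (μ : ℝ) (b : Fin d → ℝ), |μ| ≤ M → ∀ i ≤ N,
      ∀ ζ : EuclideanSpace ℝ (Fin d), ‖iteratedFDeriv ℝ i (fun ζ : EuclideanSpace ℝ (Fin d) =>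
        ∏ j, η (μ * ζ j + b j)) ζ‖ ≤ C := by
  obtain ⟨C₀, hC₀, hb⟩ := eta_affine_bound hη d N M
  classical
  refine ⟨∑ n ∈ Finset.range (N+1), ∑ p ∈ (Finset.univ : Finset (Fin d)).sym n,
    ((p : Multiset (Fin d)).countPerms : ℝ) * C₀ ^ d, by positivity, fun μ b hμ i hi ζ => ?_⟩
  have := norm_iteratedFDeriv_prod_le (𝕜 := ℝ) (u := (Finset.univ : Finset (Fin d)))
    (f := fun j (ζ : EuclideanSpace ℝ (Fin d)) => η (μ * ζ j + b j)) (N := (⊤ : ℕ∞))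
    (fun j _ => hη.1.comp (by fun_prop)) (x := ζ) (n := i) (by exact_mod_cast le_top)
  refine this.trans ?_
  refine le_trans ?_ (Finset.single_le_sum (f := fun n =>
    ∑ p ∈ (Finset.univ : Finset (Fin d)).sym n,
    ((p : Multiset (Fin d)).countPerms : ℝ) * C₀ ^ d) (fun n _ => by positivity)
    (show i ∈ Finset.range (N+1) by simp; omega))
  apply Finset.sum_le_sum
  intro p hp
  gcongr
  calc _ ≤ ∏ j : Fin d, C₀ := by
        apply Finset.prod_le_prod (fun _ _ => norm_nonneg _)
        intro j _
        apply hb μ (b j) j hμ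
        refine le_trans (Multiset.count_le_card j _) ?_
        simp; omega
    _ = _ := by simp

end Smooth

section Scaled

variable {d : ℕ} {η : ℝ → ℝ} {α r : ℝ}

open Set Filter Topology

/-- `φ_{l'}` in the coordinates adapted to `l`. -/
lemma phi_affine_eq (hr : 0 < r) (l l' : Fin d → ℤ) (ζ : EuclideanSpace ℝ (Fin d)) :
    alphaPhi η α r l' (cen α l + lam α l • ζ) =
      ∏ j, η (lam α l / (r * lam α l') * ζ j +
        (alphaCenter α l j - alphaCenter α l' j) / (r * lam α l')) := by
  unfold alphaPhi
  apply Finset.prod_congr rfl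
  intro j _
  congr 1
  have := lam_pos (α := α) l'
  change (alphaCenter α l j + lam α l * ζ j - alphaCenter α l' j) / (r * lam α l') = _
  field_simp
  ring

lemma affine_contDiff (l : Fin d → ℤ) : ContDiff ℝ (⊤ : ℕ∞)
    (fun ζ : EuclideanSpace ℝ (Fin d) => cen α l + lam α l • ζ) := by fun_prop

lemma isClosed_win (l : Fin d → ℤ) : IsClosed {ξ : EuclideanSpace ℝ (Fin d) | InWin α r l ξ} := by
  unfold InWin
  simp only [Set.ofPred_forall]
  apply isClosed_iInter
  intro i
  exact isClosed_le (by fun_prop) continuous_const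

lemma deriv_zero_off_win (l l' : Fin d → ℤ) (i : ℕ)
    {f : EuclideanSpace ℝ (Fin d) → ℝ} (hf : ∀ ξ, ¬ InWin α r l' ξ → f ξ = 0)
    {ζ : EuclideanSpace ℝ (Fin d)} (h : ¬ InWin α r l' (cen α l + lam α l • ζ)) :
    iteratedFDeriv ℝ i (fun ζ => f (cen α l + lam α l • ζ)) ζ = 0 := by
  have : (fun ζ => f (cen α l + lam α l • ζ)) =ᶠ[𝓝 ζ] fun _ => 0 := by
    have ho : IsOpen {ζ : EuclideanSpace ℝ (Fin d) | ¬ InWin α r l' (cen α l + lam α l • ζ)} := by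
      have := (isClosed_win (α := α) (r := r) l').preimage (affine_contDiff (α := α) l).continuous
      exact this.isOpen_compl
    filter_upwards [ho.mem_nhds h] with x hx
    exact hf _ hx
  rw [(this.iteratedFDeriv ℝ i).eq_of_nhds]
  simp

lemma psc_bound (hη : IsBump η) (h0 : 0 < α) (h1 : α < 1) (hr : 0 < r)
    (hadm : AlphaAdmissible η α r d) (N : ℕ) :
    ∃ C : ℝ, 0 ≤ C ∧ ∀ (l : Fin d → ℤ), ∀ i ≤ N, ∀ ζ : EuclideanSpace ℝ (Fin d),
      ‖iteratedFDeriv ℝ i (fun ζ => alphaPsi η α r l (cen α l + lam α l • ζ)) ζ‖ ≤ C := by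
  obtain ⟨B, hB, hcomp⟩ := jbr_compare h0 h1 hr d d
  obtain ⟨N₁, hN₁⟩ := win_count hη h0 h1 hr hadm
  obtain ⟨C₁, hC₁, hphi⟩ := eta_prod_bound hη d N (B / r)
  -- bounds on single windows
  have hA : ∀ l l' : Fin d → ℤ, ∀ ζ, InWin α r l (cen α l + lam α l • ζ) →
      InWin α r l' (cen α l + lam α l • ζ) → ∀ i ≤ N,
      ‖iteratedFDeriv ℝ i (fun ζ => alphaPhi η α r l' (cen α l + lam α l • ζ)) ζ‖ ≤ C₁ := by
    intro l l' ζ hl hl' i hi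
    simp_rw [phi_affine_eq hr l l']
    apply hphi _ _ _ i hi ζ
    have h2 := (hcomp l' _ l _ hl' hl le_rfl).2
    have hp := lam_pos (α := α) l
    have hp' := lam_pos (α := α) l'
    rw [abs_of_pos (by positivity), div_le_div_iff₀ (by positivity) (by positivity)]
    nlinarith
  set D : ℝ := max 1 (N₁ * C₁) with hD
  have hD1 : 1 ≤ D := le_max_left _ _
  have hS : ∀ l : Fin d → ℤ, ∀ ζ, InWin α r l (cen α l + lam α l • ζ) → ∀ i ≤ N,
      ‖iteratedFDeriv ℝ i (fun ζ => sPhi η α r (cen α l + lam α l • ζ)) ζ‖ ≤ D := by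
    intro l ζ hl i hi
    refine le_trans ?_ (le_max_right _ _)
    obtain ⟨F, hF⟩ := loc_finset h0 h1 hr d (‖cen α l + lam α l • ζ‖ + 1)
    have hev : (fun ζ => sPhi η α r (cen α l + lam α l • ζ)) =ᶠ[𝓝 ζ]
        fun ζ => ∑ l' ∈ F, alphaPhi η α r l' (cen α l + lam α l • ζ) := by
      have := (affine_contDiff (α := α) l).continuous.continuousAt (x := ζ)
      filter_upwards [this (Metric.ball_mem_nhds _ one_pos)] with x hx
      apply sPhi_eq_sum hη hr
      intro k hk
      apply hF _ k _ hk
      rw [mem_preimage, mem_ball_iff_norm] at hx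
      have := norm_le_norm_add_norm_sub' (cen α l + lam α l • x) (cen α l + lam α l • ζ)
      linarith
    rw [(hev.iteratedFDeriv ℝ i).eq_of_nhds]
    have hsum : iteratedFDeriv ℝ i (fun ζ => ∑ l' ∈ F, alphaPhi η α r l' (cen α l + lam α l • ζ)) ζ
        = ∑ l' ∈ F, iteratedFDeriv ℝ i (fun ζ => alphaPhi η α r l' (cen α l + lam α l • ζ)) ζ := by
      exact iteratedFDeriv_fun_sum_apply
        (f := fun l' ζ => alphaPhi η α r l' (cen α l + lam α l • ζ))
        (fun j _ => (((alphaPhi_contDiff hη j).comp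
        (affine_contDiff l)).of_le (by exact_mod_cast le_top)).contDiffAt)
    rw [hsum]
    classical
    calc _ ≤ ∑ l' ∈ F, ‖iteratedFDeriv ℝ i
              (fun ζ => alphaPhi η α r l' (cen α l + lam α l • ζ)) ζ‖ := norm_sum_le _ _
      _ ≤ ∑ l' ∈ F, if InWin α r l' (cen α l + lam α l • ζ) then C₁ else 0 := by
          apply Finset.sum_le_sum
          intro l' _
          split_ifs with h
          · exact hA l l' ζ hl h i hi
          · rw [deriv_zero_off_win l l' i (fun ξ hξ => alphaPhi_eq_zero hη hr hξ) h]
            simp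
      _ = (F.filter (fun l' => InWin α r l' (cen α l + lam α l • ζ))).card * C₁ := by
          rw [← Finset.sum_filter]; simp
      _ ≤ N₁ * C₁ := by
          gcongr
          apply hN₁ (cen α l + lam α l • ζ)
          intro k hk
          exact (Finset.mem_filter.mp hk).2
  -- upper bound of the sum
  have hSle : ∀ ξ : EuclideanSpace ℝ (Fin d), sPhi η α r ξ ≤ N₁ := by
    intro ξ
    obtain ⟨F, hF⟩ := loc_finset h0 h1 hr d ‖ξ‖
    classical
    rw [sPhi_eq_sum hη hr (F := F.filter (fun l' => InWin α r l' ξ))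
      (fun k hk => Finset.mem_filter.mpr ⟨hF ξ k le_rfl hk, hk⟩)]
    calc _ ≤ ∑ l ∈ F.filter (fun l' => InWin α r l' ξ), (1:ℝ) :=
          Finset.sum_le_sum fun l _ => alphaPhi_le_one hη l ξ
      _ = (F.filter (fun l' => InWin α r l' ξ)).card := by simp
      _ ≤ N₁ := by
          exact_mod_cast hN₁ ξ _ fun k hk => (Finset.mem_filter.mp hk).2
  -- derivatives of the inverse
  have hinv : ContDiffOn ℝ (⊤ : ℕ∞) (fun t : ℝ => t⁻¹) (Set.Ioi 0) := by
    intro t ht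
    exact (contDiffAt_inv ℝ (ne_of_gt ht)).contDiffWithinAt
  have hinvb : ∀ i : ℕ, ∃ C : ℝ, ∀ t ∈ Set.Icc (1:ℝ) N₁,
      ‖iteratedFDerivWithin ℝ i (fun t : ℝ => t⁻¹) (Set.Ioi 0) t‖ ≤ C := by
    intro i
    apply isCompact_Icc.exists_bound_of_continuousOn
    apply (hinv.continuousOn_iteratedFDerivWithin (m := i) (by exact_mod_cast le_top)
      isOpen_Ioi.uniqueDiffOn).mono
    intro t ht
    exact lt_of_lt_of_le one_pos ht.1
  choose Ci hCi using hinvb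
  set C₂ : ℝ := ∑ i ∈ Finset.range (N+1), |Ci i| with hC₂
  have hC₂b : ∀ i ≤ N, ∀ t ∈ Set.Icc (1:ℝ) N₁,
      ‖iteratedFDerivWithin ℝ i (fun t : ℝ => t⁻¹) (Set.Ioi 0) t‖ ≤ C₂ := by
    intro i hi t ht
    refine (hCi i t ht).trans ((le_abs_self _).trans ?_)
    exact Finset.single_le_sum (f := fun i => |Ci i|) (fun i _ => abs_nonneg _) (by simp; omega)
  have hC₂0 : 0 ≤ C₂ := by positivity
  set C₃ : ℝ := N.factorial * C₂ * D ^ N with hC₃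
  have hC₃0 : 0 ≤ C₃ := by positivity
  have hI : ∀ l : Fin d → ℤ, ∀ ζ, InWin α r l (cen α l + lam α l • ζ) → ∀ i ≤ N,
      ‖iteratedFDeriv ℝ i (fun ζ => (sPhi η α r (cen α l + lam α l • ζ))⁻¹) ζ‖ ≤ C₃ := by
    intro l ζ hl i hi
    have := norm_iteratedFDeriv_comp_le' (g := fun t : ℝ => t⁻¹)
      (f := fun ζ => sPhi η α r (cen α l + lam α l • ζ)) (t := Set.Ioi 0) (n := i)
      (N := (⊤ : ℕ∞)) ?_ isOpen_Ioi.uniqueDiffOn hinv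
      ((sPhi_contDiff hη h0 h1 hr).comp (affine_contDiff l)) (by exact_mod_cast le_top) ζ
      (C := C₂) (D := D)
      (fun i' hi' => hC₂b i' (hi'.trans hi) _ ⟨one_le_sPhi hη h0 h1 hr hadm _, hSle _⟩) ?_
    · refine this.trans ?_
      rw [hC₃]
      gcongr
    · rintro _ ⟨ζ', rfl⟩
      exact lt_of_lt_of_le one_pos (one_le_sPhi hη h0 h1 hr hadm _)
    · intro i' hi1 hi'
      exact (hS l ζ hl i' (hi'.trans hi)).trans (le_self_pow₀ hD1 (by omega))
  refine ⟨2 ^ N * (C₁ * C₃), by positivity, fun l i hi ζ => ?_⟩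
  by_cases hl : InWin α r l (cen α l + lam α l • ζ)
  · have heq : (fun ζ => alphaPsi η α r l (cen α l + lam α l • ζ)) = fun ζ =>
        alphaPhi η α r l (cen α l + lam α l • ζ) * (sPhi η α r (cen α l + lam α l • ζ))⁻¹ := by
      ext ζ; rw [alphaPsi_eq, div_eq_mul_inv]
    rw [heq]
    have hc1 : ContDiff ℝ (⊤ : ℕ∞) fun ζ => alphaPhi η α r l (cen α l + lam α l • ζ) :=
      (alphaPhi_contDiff hη l).comp (affine_contDiff l)
    have hc2 : ContDiff ℝ (⊤ : ℕ∞) fun ζ => (sPhi η α r (cen α l + lam α l • ζ))⁻¹ := by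
      apply ContDiff.inv ((sPhi_contDiff hη h0 h1 hr).comp (affine_contDiff l))
      intro x
      exact (lt_of_lt_of_le one_pos (one_le_sPhi hη h0 h1 hr hadm _)).ne'
    refine (norm_iteratedFDeriv_mul_le (n := i) hc1 hc2 ζ (by exact_mod_cast le_top)).trans ?_
    calc _ ≤ ∑ j ∈ Finset.range (i+1), (i.choose j : ℝ) * (C₁ * C₃) := by
          apply Finset.sum_le_sum
          intro j hj
          rw [mul_assoc]
          have hj' : j ≤ i := by simp at hj; omega
          gcongr
          · exact hA l l ζ hl hl j (hj'.trans hi)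
          · exact hI l ζ hl _ (by omega)
      _ = 2 ^ i * (C₁ * C₃) := by
          rw [← Finset.sum_mul]
          congr 1
          exact_mod_cast Nat.sum_range_choose i
      _ ≤ _ := by
          gcongr
          norm_num
  · rw [deriv_zero_off_win l l i (fun ξ hξ => alphaPsi_eq_zero hη hr hξ) hl]
    simp; positivity

end Scaled

section FTDecay

open Set Filter Topology

variable {V : Type*} [NormedAddCommGroup V] [InnerProductSpace ℝ V] [FiniteDimensional ℝ V]
  [MeasurableSpace V] [BorelSpace V]

/-- Uniform decay of the Fourier transform of compactly supported smooth functions. -/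
lemma ft_decay (N : ℕ) (R C : ℝ) (hC : 0 ≤ C) :
    ∃ C' : ℝ, 0 ≤ C' ∧ ∀ F : V → ℂ, ContDiff ℝ (⊤ : ℕ∞) F → (∀ x, R < ‖x‖ → F x = 0) →
      (∀ i ≤ N, ∀ x, ‖iteratedFDeriv ℝ i F x‖ ≤ C) →
      ∀ w, ‖𝓕⁻ F w‖ ≤ C' * (1 + ‖w‖) ^ (-(N:ℝ)) := by
  set B : ℝ := (volume (Metric.closedBall (0:V) R)).toReal with hB
  have hB0 : 0 ≤ B := ENNReal.toReal_nonneg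
  set I : ℝ := ∑ p ∈ Finset.range 1 ×ˢ Finset.range (N+1), C * B with hI
  have hI0 : 0 ≤ I := by positivity
  refine ⟨2 ^ (N-1) * (I + 2 ^ N * I), by positivity, fun F hF hsupp hder w => ?_⟩
  have hts : tsupport F ⊆ Metric.closedBall (0:V) R := by
    apply closure_minimal _ Metric.isClosed_closedBall
    intro x hx
    by_contra hx'
    apply hx
    apply hsupp
    simpa using hx'
  have hcomp : HasCompactSupport F :=
    HasCompactSupport.of_support_subset_isCompact (isCompact_closedBall (0:V) R)
      ((subset_tsupport F).trans hts)
  have hcont : ∀ i : ℕ, Continuous (iteratedFDeriv ℝ i F) := fun i =>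
    hF.continuous_iteratedFDeriv (by exact_mod_cast le_top)
  have hcs : ∀ i : ℕ, HasCompactSupport (iteratedFDeriv ℝ i F) := fun i => hcomp.iteratedFDeriv i
  have hInteg : ∀ k n : ℕ, Integrable (fun v => ‖v‖ ^ k * ‖iteratedFDeriv ℝ n F v‖) := by
    intro k n
    apply Continuous.integrable_of_hasCompactSupport
    · exact (continuous_norm.pow k).mul (hcont n).norm
    · exact ((hcs n).norm).mul_left
  have hbd : ∀ n ≤ N, ∫ v, ‖v‖ ^ 0 * ‖iteratedFDeriv ℝ n F v‖ ≤ C * B := by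
    intro n hn
    simp only [pow_zero, one_mul]
    have h0 : ∀ v, v ∉ Metric.closedBall (0:V) R → ‖iteratedFDeriv ℝ n F v‖ = 0 := by
      intro v hv
      rw [norm_eq_zero]
      by_contra h
      exact hv (hts (support_iteratedFDeriv_subset n h))
    rw [← setIntegral_eq_integral_of_forall_compl_eq_zero h0]
    refine (le_abs_self _).trans ?_
    rw [← Real.norm_eq_abs]
    refine norm_setIntegral_le_of_norm_le_const measure_closedBall_lt_top ?_
    intro x _
    rw [norm_norm]
    exact hder n hn x
  have key : ∀ n ≤ N, ‖w‖ ^ n * ‖𝓕⁻ F w‖ ≤ 2 ^ n * I := by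
    intro n hn
    have := Real.pow_mul_norm_iteratedFDeriv_fourier_le (f := F) (K := ⊤) (N := ⊤)
      (by exact_mod_cast hF) (fun k n _ _ => hInteg k n) (k := 0) (n := n) le_top le_top (-w)
    rw [norm_neg, norm_iteratedFDeriv_zero] at this
    rw [Real.fourierInv_eq_fourier_neg]
    refine this.trans ?_
    simp only [pow_zero, one_mul, Nat.cast_zero, mul_zero, zero_add]
    gcongr
    rw [hI]
    have hCB : 0 ≤ C * B := by positivity
    refine (Finset.sum_le_sum (g := fun _ => C * B) ?_).trans ?_
    · intro p hp
      simp only [Finset.mem_product, Finset.mem_range, Nat.lt_one_iff, zero_add] at hp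
      rw [hp.1]
      exact hbd _ (by omega)
    · apply Finset.sum_le_sum_of_subset_of_nonneg
      · intro p hp
        simp only [Finset.mem_product, Finset.mem_range, zero_add] at hp ⊢
        omega
      · intros; exact hCB
  have k0 := key 0 (Nat.zero_le _)
  have kN := key N le_rfl
  simp only [pow_zero, one_mul] at k0
  have hp : 0 < (1 + ‖w‖) := by positivity
  rw [Real.rpow_neg hp.le, Real.rpow_natCast, ← div_eq_mul_inv, le_div_iff₀ (by positivity)]
  have h2 := add_pow_le (zero_le_one' ℝ) (norm_nonneg w) N
  rw [one_pow] at h2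
  calc _ ≤ ‖𝓕⁻ F w‖ * (2 ^ (N-1) * (1 + ‖w‖ ^ N)) := by gcongr
    _ = 2 ^ (N-1) * (‖𝓕⁻ F w‖ + ‖w‖ ^ N * ‖𝓕⁻ F w‖) := by ring
    _ ≤ _ := by gcongr

/-- Scaling of the inverse Fourier transform. -/
lemma ft_scale (F : V → ℂ) (c : V) {L : ℝ} (hL : 0 < L) (x : V) :
    ‖𝓕⁻ (fun ξ => F (L⁻¹ • (ξ - c))) x‖ = L ^ (Module.finrank ℝ V) * ‖𝓕⁻ F (L • x)‖ := by
  have h1 : 𝓕⁻ (fun ξ => F (L⁻¹ • (ξ - c))) x =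
      Real.fourierChar (inner ℝ c x) • ∫ ξ, Real.fourierChar (inner ℝ ξ x) • F (L⁻¹ • ξ) := by
    rw [Real.fourierInv_eq]
    rw [← integral_add_right_eq_self _ c, Circle.smul_def, ← integral_smul]
    congr 1
    ext ξ
    rw [inner_add_left, AddChar.map_add_eq_mul, mul_comm]
    simp [Circle.smul_def, mul_assoc]
  have h2 : ∫ ξ, Real.fourierChar (inner ℝ ξ x) • F (L⁻¹ • ξ) =
      L ^ (Module.finrank ℝ V) • 𝓕⁻ F (L • x) := by
    have := Measure.integral_comp_inv_smul (μ := (volume : Measure V))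
      (fun ξ => Real.fourierChar (inner ℝ (L • ξ) x) • F ξ) L
    rw [Real.fourierInv_eq]
    rw [abs_of_pos (by positivity)] at this
    simp_rw [smul_smul, mul_inv_cancel₀ hL.ne', one_smul] at this
    rw [this]
    simp [inner_smul_left, inner_smul_right]
  rw [h1, h2, Circle.norm_smul, norm_smul]
  simp [abs_of_pos hL]

lemma lintegral_comp_smul' (G : V → ℝ≥0∞) (hG : Measurable G) {L : ℝ} (hL : 0 < L) :
    ∫⁻ x, G (L • x) = ENNReal.ofReal ((L ^ (Module.finrank ℝ V))⁻¹) * ∫⁻ x, G x := by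
  have h := Measure.map_addHaar_smul (volume : Measure V) hL.ne'
  have h2 : ∫⁻ x, G (L • x) = ∫⁻ x, G x ∂(Measure.map (L • ·) (volume : Measure V)) := by
    rw [lintegral_map hG (by fun_prop)]
  rw [h2, h, lintegral_smul_measure, abs_of_pos (by positivity)]
  rfl

lemma ft_theta (N : ℕ) (R C θ : ℝ) (hC : 0 ≤ C) (hθ : 0 < θ)
    (hN : (Module.finrank ℝ V : ℝ) < N * θ) :
    ∃ C' : ℝ≥0∞, C' ≠ ∞ ∧ ∀ F : V → ℂ, ContDiff ℝ (⊤ : ℕ∞) F → (∀ x, R < ‖x‖ → F x = 0) →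
      (∀ i ≤ N, ∀ x, ‖iteratedFDeriv ℝ i F x‖ ≤ C) →
      ∀ (c : V) (L : ℝ), 0 < L →
      ∫⁻ x, ‖𝓕⁻ (fun ξ => F (L⁻¹ • (ξ - c))) x‖ₑ ^ θ ≤
        C' * ENNReal.ofReal (L ^ ((Module.finrank ℝ V : ℝ) * (θ - 1))) := by
  obtain ⟨C₁, hC₁, H⟩ := ft_decay (V := V) N R C hC
  set I := ∫⁻ x : V, ENNReal.ofReal ((1 + ‖x‖) ^ (-(N * θ))) with hI
  have hIf : I < ∞ := finite_integral_one_add_norm hN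
  refine ⟨ENNReal.ofReal (C₁ ^ θ) * I, (ENNReal.mul_lt_top ENNReal.ofReal_lt_top hIf).ne, ?_⟩
  intro F hF hs hd c L hL
  have hpt : ∀ x, ‖𝓕⁻ (fun ξ => F (L⁻¹ • (ξ - c))) x‖ₑ ^ θ ≤
      ENNReal.ofReal (L ^ ((Module.finrank ℝ V : ℝ) * θ)) * (ENNReal.ofReal (C₁ ^ θ) *
        ENNReal.ofReal ((1 + ‖L • x‖) ^ (-(N * θ)))) := by
    intro x
    rw [← ofReal_norm_eq_enorm, ft_scale F c hL, ENNReal.ofReal_rpow_of_nonneg (by positivity) hθ.le,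
      ← ENNReal.ofReal_mul (by positivity), ← ENNReal.ofReal_mul (by positivity)]
    apply ENNReal.ofReal_le_ofReal
    rw [Real.mul_rpow (by positivity) (by positivity), ← Real.rpow_natCast,
      ← Real.rpow_mul hL.le]
    gcongr
    refine (Real.rpow_le_rpow (norm_nonneg _) (H F hF hs hd (L • x)) hθ.le).trans ?_
    rw [Real.mul_rpow hC₁ (by positivity), ← Real.rpow_mul (by positivity), neg_mul]
  refine (lintegral_mono hpt).trans ?_
  rw [lintegral_const_mul _ (by fun_prop), lintegral_const_mul _ (by fun_prop),
    lintegral_comp_smul' (fun x => ENNReal.ofReal ((1 + ‖x‖) ^ (-(N * θ)))) (by fun_prop) hL]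
  apply le_of_eq
  have : L ^ ((Module.finrank ℝ V : ℝ) * (θ - 1)) =
    L ^ ((Module.finrank ℝ V : ℝ) * θ) * (L ^ (Module.finrank ℝ V))⁻¹ := by
    rw [mul_sub, mul_one, Real.rpow_sub hL, Real.rpow_natCast, div_eq_mul_inv]
  rw [this, ENNReal.ofReal_mul (by positivity)]
  ring

end FTDecay

section Kernels

open Set Filter Topology

variable {d : ℕ} {η : ℝ → ℝ} {α r : ℝ}

/-- The convolution kernel of `□_l`. -/
def hker (η : ℝ → ℝ) (α r : ℝ) {d : ℕ} (l : Fin d → ℤ) : EuclideanSpace ℝ (Fin d) → ℂ :=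
  𝓕⁻ (fun ξ => (alphaPsi η α r l ξ : ℂ))

lemma hker_bound (hη : IsBump η) (h0 : 0 < α) (h1 : α < 1) (hr : 0 < r)
    (hadm : AlphaAdmissible η α r d) (θ : ℝ) (hθ : 0 < θ) :
    ∃ C : ℝ≥0∞, C ≠ ∞ ∧ ∀ l : Fin d → ℤ,
      ∫⁻ x, ‖hker η α r l x‖ₑ ^ θ ≤ C * ENNReal.ofReal (lam α l ^ (d * (θ - 1))) := by
  obtain ⟨N, hN⟩ := exists_nat_gt ((d:ℝ) / θ)
  obtain ⟨C, hC, hb⟩ := psc_bound hη h0 h1 hr hadm N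
  obtain ⟨C', hC', H⟩ := ft_theta (V := EuclideanSpace ℝ (Fin d)) N (d * (2 * r)) C θ hC hθ
    (by rw [finrank_euclideanSpace_fin]; rwa [div_lt_iff₀ hθ] at hN)
  refine ⟨C', hC', fun l => ?_⟩
  have hl := lam_pos (α := α) l
  have hsm : ContDiff ℝ (⊤ : ℕ∞) (fun ζ => alphaPsi η α r l (cen α l + lam α l • ζ)) :=
    (alphaPsi_contDiff hη h0 h1 hr hadm l).comp (affine_contDiff l)
  have := H (fun ζ => (alphaPsi η α r l (cen α l + lam α l • ζ) : ℂ)) ?_ ?_ ?_ (cen α l)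
    (lam α l) hl
  · rw [finrank_euclideanSpace_fin] at this
    refine le_of_eq_of_le ?_ this
    unfold hker
    congr! 7 with x ξ
    rw [smul_smul, mul_inv_cancel₀ hl.ne', one_smul, add_sub_cancel]
  · exact Complex.ofRealCLM.contDiff.comp hsm
  · intro x hx
    rw [alphaPsi_eq_zero hη hr]
    · simp
    · intro hw
      have := hw.norm_sub_le
      rw [add_sub_cancel_left, norm_smul, Real.norm_of_nonneg hl.le] at this
      have : ‖x‖ ≤ d * (2 * r) := by
        rw [← mul_le_mul_iff_right₀ hl]
        linarith
      linarith
  · intro i hi x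
    have := LinearIsometry.norm_iteratedFDeriv_comp_left (𝕜 := ℝ) Complex.ofRealLI
      (f := fun ζ => alphaPsi η α r l (cen α l + lam α l • ζ)) (x := x) hsm.contDiffAt (i := i)
      (by exact_mod_cast le_top)
    refine le_of_eq_of_le ?_ (hb l i hi x)
    rw [← this]
    rfl

/-- cutoff in the last variable -/
def chi (η : ℝ → ℝ) (c L : ℝ) (τ : ℝ) : ℂ := (η (L⁻¹ * (τ - c)) : ℂ)

lemma eta_smooth (hη : IsBump η) : ContDiff ℝ (⊤ : ℕ∞) (fun t => (η t : ℂ)) :=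
  Complex.ofRealCLM.contDiff.comp hη.1

lemma eta_compact (hη : IsBump η) : HasCompactSupport (fun t => (η t : ℂ)) := by
  apply HasCompactSupport.of_support_subset_isCompact (isCompact_closedBall (0:ℝ) 2)
  intro t ht
  by_contra h
  apply ht
  simp only [Metric.mem_closedBall, dist_zero_right, Real.norm_eq_abs, not_le] at h
  simp [hη.2.2.2 t h.le]

lemma chi_smooth (hη : IsBump η) (c L : ℝ) : ContDiff ℝ (⊤ : ℕ∞) (chi η c L) :=
  (eta_smooth hη).comp (by fun_prop : ContDiff ℝ (⊤ : ℕ∞) fun τ : ℝ => L⁻¹ * (τ - c))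

lemma chi_zero (hη : IsBump η) {c L : ℝ} (hL : 0 < L) {τ : ℝ} (h : 2 * L < |τ - c|) :
    chi η c L τ = 0 := by
  unfold chi
  rw [hη.2.2.2]
  · simp
  · rw [abs_mul, abs_of_pos (inv_pos.2 hL), ← div_eq_inv_mul, le_div_iff₀ hL]
    exact h.le

lemma chi_one (hη : IsBump η) {c L : ℝ} (hL : 0 < L) {τ : ℝ} (h : |τ - c| ≤ L) :
    chi η c L τ = 1 := by
  unfold chi
  rw [hη.2.2.1]
  · simp
  · rw [abs_mul, abs_of_pos (inv_pos.2 hL), ← div_eq_inv_mul, div_le_iff₀ hL]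
    simpa using h

lemma chi_compact (hη : IsBump η) {c L : ℝ} (hL : 0 < L) : HasCompactSupport (chi η c L) := by
  apply HasCompactSupport.of_support_subset_isCompact (isCompact_closedBall c (2 * L))
  intro t ht
  by_contra h
  apply ht
  simp only [Metric.mem_closedBall, Real.dist_eq, not_le] at h
  exact chi_zero hη hL h

lemma rho_bounds (hη : IsBump η) : ∃ C : ℝ≥0∞, C ≠ ∞ ∧ ∀ c L : ℝ, 0 < L →
    (∫⁻ t, ‖𝓕⁻ (chi η c L) t‖ₑ ≤ C) ∧ (∀ t, ‖𝓕⁻ (chi η c L) t‖ₑ ≤ C * ENNReal.ofReal L) := by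
  have hb : ∃ C, ∀ i ≤ 2, ∀ x, ‖iteratedFDeriv ℝ i (fun t => (η t : ℂ)) x‖ ≤ C := by
    have : ∀ i : ℕ, ∃ C, ∀ x, ‖iteratedFDeriv ℝ i (fun t => (η t : ℂ)) x‖ ≤ C := fun i =>
      ((eta_compact hη).iteratedFDeriv i).exists_bound_of_continuous
        ((eta_smooth hη).continuous_iteratedFDeriv (by exact_mod_cast le_top))
    choose C hC using this
    refine ⟨max (C 0) (max (C 1) (C 2)), fun i hi x => (hC i x).trans ?_⟩
    interval_cases i <;> simp
  obtain ⟨C, hC⟩ := hb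
  have hC0 : 0 ≤ C := (norm_nonneg _).trans (hC 0 (by norm_num) 0)
  have hs : ∀ x : ℝ, 2 < ‖x‖ → (η x : ℂ) = 0 := fun x hx => by
    rw [hη.2.2.2 x (by rw [← Real.norm_eq_abs]; exact hx.le)]; simp
  obtain ⟨C₁, hC₁, H₁⟩ := ft_theta (V := ℝ) 2 2 C 1 hC0 one_pos (by simp)
  obtain ⟨C₂, hC₂, H₂⟩ := ft_decay (V := ℝ) 2 2 C hC0
  refine ⟨max C₁ (ENNReal.ofReal C₂), by simp [hC₁], fun c L hL => ⟨?_, fun t => ?_⟩⟩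
  · have := H₁ (fun t => (η t : ℂ)) (eta_smooth hη) hs hC c L hL
    simp only [ENNReal.rpow_one, sub_self, mul_zero, Real.rpow_zero, ENNReal.ofReal_one,
      mul_one] at this
    exact this.trans (le_max_left _ _)
  · have h1 := ft_scale (fun t : ℝ => (η t : ℂ)) c hL t
    have h2 := H₂ (fun t => (η t : ℂ)) (eta_smooth hη) hs hC (L • t)
    rw [Module.finrank_self, pow_one] at h1
    have h3 : ‖𝓕⁻ (chi η c L) t‖ ≤ L * C₂ := by
      refine (le_of_eq h1).trans ?_
      gcongr
      refine h2.trans (mul_le_of_le_one_right hC₂ ?_)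
      apply Real.rpow_le_one_of_one_le_of_nonpos
      · linarith [norm_nonneg (L • t)]
      · simp
    rw [← ofReal_norm_eq_enorm]
    refine (ENNReal.ofReal_le_ofReal h3).trans ?_
    rw [ENNReal.ofReal_mul hL.le, mul_comm]
    gcongr
    exact le_max_right _ _

end Kernels

section Nikolskii

open Set Filter Topology

variable {V : Type*} [NormedAddCommGroup V] [InnerProductSpace ℝ V] [FiniteDimensional ℝ V]
  [MeasurableSpace V] [BorelSpace V]

lemma nikolskii_sup {G : V → ℂ} (hc : Continuous G) (hi : Integrable G) (z : V) (ρ : ℝ)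
    (hs : ∀ ζ, ζ ∉ Metric.closedBall z ρ → 𝓕 G ζ = 0) (y : V) :
    ‖G y‖ₑ ≤ volume (Metric.closedBall z ρ) * ∫⁻ x, ‖G x‖ₑ := by
  have hFc : Continuous (𝓕 G) :=
    VectorFourier.fourierIntegral_continuous Real.continuous_fourierChar
      (by exact continuous_inner) hi
  have hFcs : HasCompactSupport (𝓕 G) :=
    HasCompactSupport.of_support_subset_isCompact (isCompact_closedBall z ρ) (fun x hx => by
      by_contra h; exact hx (hs x h))
  have hFi : Integrable (𝓕 G) := hFc.integrable_of_hasCompactSupport hFcs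
  have hinv := congrFun (hc.fourierInv_fourier_eq hi hFi) y
  rw [← hinv, Real.fourierInv_eq]
  refine (enorm_integral_le_lintegral_enorm _).trans ?_
  have hb : ∀ ζ, ‖Real.fourierChar (inner ℝ ζ y) • 𝓕 G ζ‖ₑ ≤
      (Metric.closedBall z ρ).indicator (fun _ => ∫⁻ x, ‖G x‖ₑ) ζ := by
    intro ζ
    rw [← ofReal_norm, Circle.norm_smul, ofReal_norm]
    by_cases h : ζ ∈ Metric.closedBall z ρ
    · rw [indicator_of_mem h, Real.fourier_eq]
      refine (enorm_integral_le_lintegral_enorm _).trans ?_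
      apply lintegral_mono
      intro x
      dsimp only
      rw [← ofReal_norm, Circle.norm_smul, ofReal_norm]
    · rw [hs ζ h]; simp
  refine (lintegral_mono hb).trans ?_
  rw [lintegral_indicator_const Metric.isClosed_closedBall.measurableSet, mul_comm]

lemma nikolskii {G : V → ℂ} (hc : Continuous G) (hi : Integrable G) (z : V) (ρ : ℝ)
    (hs : ∀ ζ, ζ ∉ Metric.closedBall z ρ → 𝓕 G ζ = 0) {p : ℝ} (hp : 0 < p) (hp1 : p < 1) :
    (∫⁻ x, ‖G x‖ₑ) ^ p ≤ volume (Metric.closedBall z ρ) ^ (1 - p) * ∫⁻ x, ‖G x‖ₑ ^ p := by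
  set I := ∫⁻ x, ‖G x‖ₑ with hI
  set W := volume (Metric.closedBall z ρ) with hW
  have hIf : I ≠ ∞ := hi.2.ne
  by_cases hI0 : I = 0
  · rw [hI0, ENNReal.zero_rpow_of_pos hp]; exact zero_le
  have hq : 0 ≤ 1 - p := by linarith
  have h1 : I ≤ (W * I) ^ (1 - p) * ∫⁻ x, ‖G x‖ₑ ^ p := by
    have hm : AEMeasurable (fun x => ‖G x‖ₑ ^ p) := (hc.enorm.measurable.pow_const p).aemeasurable
    rw [← lintegral_const_mul'' _ hm]
    apply lintegral_mono
    intro x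
    dsimp only
    have : ‖G x‖ₑ = ‖G x‖ₑ ^ (1 - p) * ‖G x‖ₑ ^ p := by
      rw [← ENNReal.rpow_add_of_nonneg _ _ hq hp.le]; simp
    conv_lhs => rw [this]
    gcongr
    exact nikolskii_sup hc hi z ρ hs x
  rw [ENNReal.mul_rpow_of_nonneg _ _ hq] at h1
  have h2 : I = I ^ (1 - p) * I ^ p := by
    rw [← ENNReal.rpow_add_of_nonneg _ _ hq hp.le]; simp
  have hIq0 : I ^ (1 - p) ≠ 0 := by
    simp [ENNReal.rpow_eq_zero_iff, hI0, hIf]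
  have hIqf : I ^ (1 - p) ≠ ∞ := ENNReal.rpow_ne_top_of_nonneg hq hIf
  rw [← ENNReal.mul_le_mul_iff_right hIq0 hIqf, ← h2]
  refine h1.trans (le_of_eq (by ring))

end Nikolskii

section Splitting

open Set Filter Topology

variable {m : ℕ} {η : ℝ → ℝ} {α r : ℝ}

/-- Projection on the first `m` coordinates. -/
def pr (ξ : EuclideanSpace ℝ (Fin (m+1))) : EuclideanSpace ℝ (Fin m) :=
  WithLp.toLp 2 (fun i => ξ i.castSucc)

lemma pr_apply (ξ : EuclideanSpace ℝ (Fin (m+1))) (i : Fin m) : pr ξ i = ξ i.castSucc := rfl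

/-- Embedding of the hyperplane. -/
def emb (x : EuclideanSpace ℝ (Fin m)) : EuclideanSpace ℝ (Fin (m+1)) :=
  (WithLp.equiv 2 (Fin (m+1) → ℝ)).symm (Fin.snoc ((WithLp.equiv 2 (Fin m → ℝ)) x) 0)

lemma emb_castSucc (x : EuclideanSpace ℝ (Fin m)) (i : Fin m) : emb x i.castSucc = x i := by
  simp [emb]

lemma emb_last (x : EuclideanSpace ℝ (Fin m)) : emb x (Fin.last m) = 0 := by
  simp [emb]

lemma pr_continuous : Continuous (pr (m := m)) := by
  unfold pr
  fun_prop

lemma norm_pr_le (ξ : EuclideanSpace ℝ (Fin (m+1))) : ‖pr ξ‖ ≤ ‖ξ‖ := by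
  rw [EuclideanSpace.norm_eq, EuclideanSpace.norm_eq]
  apply Real.sqrt_le_sqrt
  rw [Fin.sum_univ_castSucc]
  simp only [pr_apply]
  exact le_add_of_nonneg_right (by positivity)

lemma inner_split (ξ y : EuclideanSpace ℝ (Fin (m+1))) :
    inner ℝ ξ y = inner ℝ (pr ξ) (pr y) + inner ℝ (ξ (Fin.last m)) (y (Fin.last m)) := by
  simp only [PiLp.inner_apply, Fin.sum_univ_castSucc, pr_apply]

lemma pr_emb (x : EuclideanSpace ℝ (Fin m)) : pr (emb x) = x := by
  ext i
  rw [pr_apply, emb_castSucc]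

lemma inner_emb (ξ : EuclideanSpace ℝ (Fin (m+1))) (y : EuclideanSpace ℝ (Fin m)) :
    inner ℝ ξ (emb y) = inner ℝ (pr ξ) y := by
  rw [inner_split, pr_emb, emb_last]
  simp

lemma norm_emb (x : EuclideanSpace ℝ (Fin m)) : ‖emb x‖ = ‖x‖ := by
  rw [EuclideanSpace.norm_eq, EuclideanSpace.norm_eq, Fin.sum_univ_castSucc]
  simp [emb_castSucc, emb_last]

/-- The embedding as a linear isometry. -/
def embL : EuclideanSpace ℝ (Fin m) →ₗᵢ[ℝ] EuclideanSpace ℝ (Fin (m+1)) where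
  toFun := emb
  map_add' x y := by
    ext i
    induction i using Fin.lastCases with
    | last => simp [emb_last]
    | cast i => simp [emb_castSucc]
  map_smul' c x := by
    ext i
    induction i using Fin.lastCases with
    | last => simp [emb_last]
    | cast i => simp [emb_castSucc]
  norm_map' := norm_emb

/-- The trace as a Schwartz function. -/
def trS (f : SchwartzMap (EuclideanSpace ℝ (Fin (m+1))) ℂ) :
    SchwartzMap (EuclideanSpace ℝ (Fin m)) ℂ :=
  SchwartzMap.compCLMOfAntilipschitz ℝ (g := embL)
    (embL (m := m)).toContinuousLinearMap.hasTemperateGrowth (embL (m := m)).antilipschitz f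

lemma trS_apply (f : SchwartzMap (EuclideanSpace ℝ (Fin (m+1))) ℂ)
    (x : EuclideanSpace ℝ (Fin m)) : trS f x = f (emb x) := rfl

lemma trS_coe (f : SchwartzMap (EuclideanSpace ℝ (Fin (m+1))) ℂ) : traceFn (⇑f) = ⇑(trS f) := rfl

lemma split_mp : MeasurePreserving
    (fun ξ : EuclideanSpace ℝ (Fin (m+1)) => (ξ (Fin.last m), pr ξ))
    volume (volume.prod volume) := by
  have h1 := EuclideanSpace.volume_preserving_symm_measurableEquiv_toLp (Fin (m+1))
  have h2 := volume_preserving_piFinSuccAbove (fun _ : Fin (m+1) => ℝ) (Fin.last m)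
  have h3 := (EuclideanSpace.volume_preserving_symm_measurableEquiv_toLp (Fin m)).symm
  have h4 := (MeasurePreserving.id (volume : Measure ℝ)).prod h3
  have := h4.comp (h2.comp h1)
  refine MeasurePreserving.congr this
    (((by fun_prop : Continuous fun ξ : EuclideanSpace ℝ (Fin (m+1)) => ξ (Fin.last m)).prodMk
      pr_continuous).measurable) (Filter.Eventually.of_forall fun ξ => ?_)
  refine Prod.ext rfl ?_
  ext i
  simp [pr, MeasurableEquiv.piFinSuccAbove]
  rfl

lemma split_me : MeasurableEmbedding
    (fun ξ : EuclideanSpace ℝ (Fin (m+1)) => (ξ (Fin.last m), pr ξ)) := by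
  apply Measurable.measurableEmbedding
  · apply Continuous.measurable
    exact (by fun_prop : Continuous fun ξ : EuclideanSpace ℝ (Fin (m+1)) => ξ (Fin.last m)).prodMk
      pr_continuous
  · intro x y h
    simp only [Prod.mk.injEq] at h
    ext i
    induction i using Fin.lastCases with
    | last => exact h.1
    | cast i => exact congrArg (fun z : EuclideanSpace ℝ (Fin m) => z i) h.2

lemma integral_split (A : EuclideanSpace ℝ (Fin m) → ℂ) (B : ℝ → ℂ) :
    ∫ ξ : EuclideanSpace ℝ (Fin (m+1)), A (pr ξ) * B (ξ (Fin.last m)) = (∫ x, A x) * ∫ t, B t := by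
  have := split_mp.integral_comp split_me (fun z : ℝ × EuclideanSpace ℝ (Fin m) => B z.1 * A z.2)
  rw [integral_prod_mul] at this
  rw [mul_comm, ← this]
  simp_rw [mul_comm]

lemma lintegral_split (A : EuclideanSpace ℝ (Fin m) → ℝ≥0∞) (B : ℝ → ℝ≥0∞)
    (hA : Measurable A) (hB : Measurable B) :
    ∫⁻ ξ : EuclideanSpace ℝ (Fin (m+1)), A (pr ξ) * B (ξ (Fin.last m)) =
      (∫⁻ x, A x) * ∫⁻ t, B t := by
  have := split_mp.lintegral_comp_emb split_me
    (fun z : ℝ × EuclideanSpace ℝ (Fin m) => B z.1 * A z.2)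
  rw [lintegral_prod_mul hB.aemeasurable hA.aemeasurable] at this
  rw [mul_comm, ← this]
  simp_rw [mul_comm]

end Splitting

section Flip

variable {V : Type*} [NormedAddCommGroup V] [InnerProductSpace ℝ V] [FiniteDimensional ℝ V]
  [MeasurableSpace V] [BorelSpace V]

lemma fourier_flip {f g : V → ℂ} (hf : Integrable f) (hg : Integrable g) :
    ∫ ξ, 𝓕 f ξ * g ξ = ∫ x, f x * 𝓕 g x := by
  have := VectorFourier.integral_fourierIntegral_smul_eq_flip (μ := (volume : Measure V))
    (ν := (volume : Measure V)) (L := innerₗ V) Real.continuous_fourierChar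
    (by exact continuous_inner) hf hg
  rw [flip_innerₗ] at this
  exact this

end Flip

section TraceIdentity

open Set Filter Topology

variable {d m : ℕ} {η : ℝ → ℝ} {α r : ℝ}

/-- the character, complex valued -/
def ech (t : ℝ) : ℂ := (Real.fourierChar t : ℂ)

lemma norm_ech (t : ℝ) : ‖ech t‖ = 1 := Circle.norm_coe _

lemma ech_add (s t : ℝ) : ech (s + t) = ech s * ech t := by
  unfold ech
  rw [AddChar.map_add_eq_mul, Circle.coe_mul]

lemma ech_continuous : Continuous ech :=
  continuous_subtype_val.comp Real.continuous_fourierChar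

lemma fourier_ech {V : Type*} [NormedAddCommGroup V] [InnerProductSpace ℝ V] [MeasurableSpace V]
    [BorelSpace V] [FiniteDimensional ℝ V] (f : V → ℂ) (w : V) :
    𝓕 f w = ∫ v, ech (-inner ℝ v w) * f v := Real.fourier_eq f w

lemma fourierInv_ech {V : Type*} [NormedAddCommGroup V] [InnerProductSpace ℝ V]
    [MeasurableSpace V]
    [BorelSpace V] [FiniteDimensional ℝ V] (f : V → ℂ) (w : V) :
    𝓕⁻ f w = ∫ v, ech (inner ℝ v w) * f v := Real.fourierInv_eq f w

lemma psi_smooth (hη : IsBump η) (h0 : 0 < α) (h1 : α < 1) (hr : 0 < r)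
    (hadm : AlphaAdmissible η α r d) (l : Fin d → ℤ) :
    ContDiff ℝ (⊤ : ℕ∞) (fun ξ => (alphaPsi η α r l ξ : ℂ)) :=
  Complex.ofRealCLM.contDiff.comp (alphaPsi_contDiff hη h0 h1 hr hadm l)

lemma psi_compact (hη : IsBump η) (hr : 0 < r) (l : Fin d → ℤ) :
    HasCompactSupport (fun ξ => (alphaPsi η α r l ξ : ℂ)) :=
  (alphaPsi_compact hη hr l).comp_left (g := fun t : ℝ => (t : ℂ)) (by simp)

lemma hker_schwartz (hη : IsBump η) (h0 : 0 < α) (h1 : α < 1) (hr : 0 < r)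
    (hadm : AlphaAdmissible η α r d) (l : Fin d → ℤ) :
    ∃ S : SchwartzMap (EuclideanSpace ℝ (Fin d)) ℂ, ⇑S = hker η α r l := by
  refine ⟨𝓕⁻ ((psi_compact hη hr l).toSchwartzMap (psi_smooth hη h0 h1 hr hadm l)), ?_⟩
  rw [SchwartzMap.fourierInv_coe]
  rfl

lemma hker_fourier (hη : IsBump η) (h0 : 0 < α) (h1 : α < 1) (hr : 0 < r)
    (hadm : AlphaAdmissible η α r d) (l : Fin d → ℤ) (ξ : EuclideanSpace ℝ (Fin d)) :
    𝓕 (hker η α r l) ξ = alphaPsi η α r l ξ := by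
  set S := (psi_compact (α := α) hη hr l).toSchwartzMap (psi_smooth hη h0 h1 hr hadm l) with hS
  have : 𝓕 (𝓕⁻ S) = S := FourierTransform.fourier_fourierInv_eq S
  have h2 := congrArg (fun T : SchwartzMap (EuclideanSpace ℝ (Fin d)) ℂ => T ξ) this
  rw [SchwartzMap.fourier_coe, SchwartzMap.fourierInv_coe] at h2
  exact h2

lemma mod_ft (l : Fin d → ℤ) (x y : EuclideanSpace ℝ (Fin d)) :
    𝓕 (fun ξ => ech (inner ℝ ξ x) * (alphaPsi η α r l ξ : ℂ)) y = hker η α r l (x - y) := by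
  unfold hker
  rw [fourier_ech, fourierInv_ech]
  congr 1
  ext ξ
  rw [inner_sub_right, sub_eq_neg_add, ech_add, mul_assoc]

/-- The operator `J_l[u]`. -/
def Jop (η : ℝ → ℝ) (α r : ℝ) (l : Fin m → ℤ) (u : EuclideanSpace ℝ (Fin (m+1)) → ℂ)
    (x : EuclideanSpace ℝ (Fin m)) : ℂ :=
  ∫ ξ, ech (inner ℝ (pr ξ) x) * (alphaPsi η α r l (pr ξ) : ℂ) * u ξ

lemma modpsi_integrable (hη : IsBump η) (h0 : 0 < α) (h1 : α < 1) (hr : 0 < r)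
    (hadm : AlphaAdmissible η α r d) (l : Fin d → ℤ) (x : EuclideanSpace ℝ (Fin d)) :
    Integrable (fun ξ => ech (inner ℝ ξ x) * (alphaPsi η α r l ξ : ℂ)) := by
  apply Continuous.integrable_of_hasCompactSupport
  · exact (ech_continuous.comp (by fun_prop)).mul (psi_smooth hη h0 h1 hr hadm l).continuous
  · exact (psi_compact hη hr l).mul_left

lemma trace_eq_J (hη : IsBump η) (h0 : 0 < α) (h1 : α < 1) (hr : 0 < r)
    (hadm : AlphaAdmissible η α r m) (l : Fin m → ℤ)
    (f : SchwartzMap (EuclideanSpace ℝ (Fin (m+1))) ℂ) (x : EuclideanSpace ℝ (Fin m)) :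
    alphaBox η α r l (traceFn (⇑f)) x = Jop η α r l (𝓕 (⇑f)) x := by
  obtain ⟨S, hS⟩ := hker_schwartz hη h0 h1 hr hadm l
  have e1 : alphaBox η α r l (traceFn (⇑f)) x = ∫ y, hker η α r l (x - y) * trS f y := by
    unfold alphaBox
    rw [fourierInv_ech, trS_coe]
    simp_rw [← mul_assoc]
    rw [← fourier_flip (modpsi_integrable hη h0 h1 hr hadm l x) (trS f).integrable]
    simp_rw [mod_ft]
  have e2 : ∀ y, trS f y = ∫ ξ, ech (inner ℝ (pr ξ) y) * 𝓕 (⇑f) ξ := by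
    intro y
    have : 𝓕⁻ (𝓕 f) = f := FourierTransform.fourierInv_fourier_eq f
    have h2 := congrArg (fun T : SchwartzMap (EuclideanSpace ℝ (Fin (m+1))) ℂ => T (emb y)) this
    rw [SchwartzMap.fourierInv_coe, SchwartzMap.fourier_coe, fourierInv_ech] at h2
    rw [trS_apply, ← h2]
    simp_rw [inner_emb]
  have hFi : Integrable (𝓕 (⇑f)) := by
    rw [← SchwartzMap.fourier_coe]; exact (𝓕 f).integrable
  have hFc : Continuous (𝓕 (⇑f)) := by
    rw [← SchwartzMap.fourier_coe]; exact (𝓕 f).continuous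
  have hHi : Integrable (fun y => hker η α r l (x - y)) := by
    rw [← hS]; exact S.integrable.comp_sub_left x
  have hHc : Continuous (fun y => hker η α r l (x - y)) := by
    rw [← hS]; exact S.continuous.comp (by fun_prop)
  rw [e1]
  simp_rw [e2, ← integral_const_mul]
  rw [integral_integral_swap]
  · unfold Jop
    congr 1
    ext ξ
    rw [← hker_fourier hη h0 h1 hr hadm, fourier_ech (hker η α r l)]
    rw [← integral_sub_left_eq_self _ _ x, ← integral_const_mul, ← integral_mul_const]
    congr 1
    ext y
    rw [sub_sub_cancel, inner_sub_right, sub_eq_add_neg, ech_add, real_inner_comm y (pr ξ)]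
    ring
  · refine (hHi.mul_prod hFi).mono ?_ ?_
    · apply Continuous.aestronglyMeasurable
      apply Continuous.mul (hHc.comp continuous_fst)
      apply Continuous.mul
      · apply ech_continuous.comp
        exact (pr_continuous.comp continuous_snd).inner continuous_fst
      · exact hFc.comp continuous_snd
    · refine Eventually.of_forall fun z => ?_
      simp [Function.uncurry, norm_ech]

end TraceIdentity

section Decomp

open Set Filter Topology

variable {m : ℕ} {η : ℝ → ℝ} {α r : ℝ}

lemma box_schwartz {d : ℕ} (hη : IsBump η) (h0 : 0 < α) (h1 : α < 1) (hr : 0 < r)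
    (hadm : AlphaAdmissible η α r d) (k : Fin d → ℤ)
    (f : SchwartzMap (EuclideanSpace ℝ (Fin d)) ℂ) :
    ∃ g : SchwartzMap (EuclideanSpace ℝ (Fin d)) ℂ, ⇑g = alphaBox η α r k (⇑f) ∧
      ∀ ξ, 𝓕 (⇑g) ξ = (alphaPsi η α r k ξ : ℂ) * 𝓕 (⇑f) ξ := by
  have hcs : HasCompactSupport (fun ξ => (alphaPsi η α r k ξ : ℂ) * (𝓕 f) ξ) :=
    (psi_compact hη hr k).mul_right
  have hsm : ContDiff ℝ (⊤ : ℕ∞) (fun ξ => (alphaPsi η α r k ξ : ℂ) * (𝓕 f) ξ) :=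
    (psi_smooth hη h0 h1 hr hadm k).mul ((𝓕 f).smooth ⊤)
  refine ⟨𝓕⁻ (hcs.toSchwartzMap hsm), ?_, fun ξ => ?_⟩
  · rw [SchwartzMap.fourierInv_coe]
    rfl
  · have h1 : 𝓕 (𝓕⁻ (hcs.toSchwartzMap hsm)) = hcs.toSchwartzMap hsm :=
      FourierTransform.fourier_fourierInv_eq _
    have h2 := congrArg (fun T : SchwartzMap (EuclideanSpace ℝ (Fin d)) ℂ => T ξ) h1
    rw [SchwartzMap.fourier_coe] at h2
    exact h2

lemma J_decomp (hη : IsBump η) (h0 : 0 < α) (h1 : α < 1) (hr : 0 < r)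
    (hadm : AlphaAdmissible η α r (m+1)) (hadm' : AlphaAdmissible η α r m) (l : Fin m → ℤ)
    (f : SchwartzMap (EuclideanSpace ℝ (Fin (m+1))) ℂ) (x : EuclideanSpace ℝ (Fin m)) :
    ‖Jop η α r l (𝓕 (⇑f)) x‖ₑ ≤
      ∑' k : Fin (m+1) → ℤ,
        ‖Jop η α r l (fun ξ => (alphaPsi η α r k ξ : ℂ) * 𝓕 (⇑f) ξ) x‖ₑ := by
  have hFi : Integrable (𝓕 (⇑f)) := by
    rw [← SchwartzMap.fourier_coe]; exact (𝓕 f).integrable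
  have hFc : Continuous (𝓕 (⇑f)) := by
    rw [← SchwartzMap.fourier_coe]; exact (𝓕 f).continuous
  set a : EuclideanSpace ℝ (Fin (m+1)) → ℂ :=
    fun ξ => ech (inner ℝ (pr ξ) x) * (alphaPsi η α r l (pr ξ) : ℂ) with ha
  have hac : Continuous a := by
    apply Continuous.mul
    · exact ech_continuous.comp (pr_continuous.inner continuous_const)
    · exact (psi_smooth hη h0 h1 hr hadm' l).continuous.comp pr_continuous
  have ha1 : ∀ ξ, ‖a ξ‖ₑ ≤ 1 := by
    intro ξ
    have : ‖a ξ‖ ≤ 1 := by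
      rw [ha]
      simp only [norm_mul, norm_ech, one_mul, Complex.norm_real]
      rw [Real.norm_of_nonneg (alphaPsi_nonneg hη l _)]
      exact alphaPsi_le_one hη h0 h1 hr hadm' l _
    rw [← ofReal_norm]
    exact ENNReal.ofReal_le_one.mpr this
  have hterm : ∀ ξ, a ξ * 𝓕 (⇑f) ξ = ∑' k : Fin (m+1) → ℤ,
      a ξ * ((alphaPsi η α r k ξ : ℂ) * 𝓕 (⇑f) ξ) := by
    intro ξ
    have hs := alphaPsi_hasSum hη h0 h1 hr hadm ξ
    have hs' : HasSum (fun k : Fin (m+1) → ℤ => (alphaPsi η α r k ξ : ℂ)) ((1:ℝ):ℂ) :=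
      Complex.hasSum_ofReal.mpr hs
    have := (hs'.mul_right (𝓕 (⇑f) ξ)).mul_left (a ξ)
    rw [this.tsum_eq]
    simp
  have hsm : ∀ k : Fin (m+1) → ℤ,
      Continuous (fun ξ => a ξ * ((alphaPsi η α r k ξ : ℂ) * 𝓕 (⇑f) ξ)) := fun k =>
    hac.mul ((psi_smooth hη h0 h1 hr hadm k).continuous.mul hFc)
  have hfin : ∑' k : Fin (m+1) → ℤ,
      ∫⁻ ξ, ‖a ξ * ((alphaPsi η α r k ξ : ℂ) * 𝓕 (⇑f) ξ)‖ₑ ≠ ∞ := by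
    rw [← lintegral_tsum (fun k => (hsm k).enorm.measurable.aemeasurable)]
    refine ne_top_of_le_ne_top hFi.2.ne (lintegral_mono fun ξ => ?_)
    have hs := alphaPsi_hasSum hη h0 h1 hr hadm ξ
    have h3 : ∑' k : Fin (m+1) → ℤ, ‖(alphaPsi η α r k ξ : ℂ)‖ₑ = 1 := by
      have := ENNReal.ofReal_tsum_of_nonneg (fun k => alphaPsi_nonneg hη k ξ) hs.summable
      rw [hs.tsum_eq, ENNReal.ofReal_one] at this
      rw [this]
      congr 1
      ext k
      rw [← ofReal_norm, Complex.norm_real, Real.norm_of_nonneg (alphaPsi_nonneg hη k ξ)]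
    simp_rw [enorm_mul]
    rw [ENNReal.tsum_mul_left, ENNReal.tsum_mul_right, h3, one_mul]
    exact mul_le_of_le_one_left zero_le (ha1 ξ)
  have : Jop η α r l (𝓕 (⇑f)) x = ∑' k : Fin (m+1) → ℤ,
      Jop η α r l (fun ξ => (alphaPsi η α r k ξ : ℂ) * 𝓕 (⇑f) ξ) x := by
    unfold Jop
    rw [← integral_tsum (fun k => (hsm k).aestronglyMeasurable) hfin]
    congr 1
    ext ξ
    exact hterm ξ
  rw [this]
  exact enorm_tsum_le_tsum_enorm

lemma J_zero (hη : IsBump η) (hr : 0 < r) {k : Fin (m+1) → ℤ} {l : Fin m → ℤ}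
    {u : EuclideanSpace ℝ (Fin (m+1)) → ℂ} (hu : ∀ ξ, ¬ InWin α r k ξ → u ξ = 0)
    (h : ¬ ∃ ξ, InWin α r k ξ ∧ InWin α r l (pr ξ)) (x : EuclideanSpace ℝ (Fin m)) :
    Jop η α r l u x = 0 := by
  unfold Jop
  have : ∀ ξ, ech (inner ℝ (pr ξ) x) * (alphaPsi η α r l (pr ξ) : ℂ) * u ξ = 0 := by
    intro ξ
    by_cases h1 : InWin α r k ξ
    · have h2 : ¬ InWin α r l (pr ξ) := fun h2 => h ⟨ξ, h1, h2⟩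
      rw [alphaPsi_eq_zero hη hr h2]; simp
    · rw [hu ξ h1, mul_zero]
  simp [this]

/-- The kernel in the last variable. -/
def rho (η : ℝ → ℝ) (α r : ℝ) (k : Fin (m+1) → ℤ) : ℝ → ℂ :=
  𝓕⁻ (chi η (alphaCenter α k (Fin.last m)) (2 * r * lam α k))

/-- The multiplier. -/
def mulM (η : ℝ → ℝ) (α r : ℝ) (k : Fin (m+1) → ℤ) (l : Fin m → ℤ)
    (x : EuclideanSpace ℝ (Fin m)) (ξ : EuclideanSpace ℝ (Fin (m+1))) : ℂ :=
  (ech (inner ℝ (pr ξ) x) * (alphaPsi η α r l (pr ξ) : ℂ)) *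
    chi η (alphaCenter α k (Fin.last m)) (2 * r * lam α k) (ξ (Fin.last m))

lemma mulM_fourier (k : Fin (m+1) → ℤ) (l : Fin m → ℤ)
    (x : EuclideanSpace ℝ (Fin m)) (y : EuclideanSpace ℝ (Fin (m+1))) :
    𝓕 (mulM η α r k l x) y = hker η α r l (x - pr y) * rho η α r k (-(y (Fin.last m))) := by
  rw [← mod_ft, fourier_ech, fourier_ech, rho, fourierInv_ech, ← integral_split]
  congr 1
  ext ξ
  rw [inner_split, neg_add, ech_add, inner_neg_right]
  unfold mulM
  ring

lemma mulM_supp (hη : IsBump η) (hr : 0 < r) {k : Fin (m+1) → ℤ} {l : Fin m → ℤ}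
    {x : EuclideanSpace ℝ (Fin m)} {ξ : EuclideanSpace ℝ (Fin (m+1))}
    (h : mulM η α r k l x ξ ≠ 0) : InWin α r l (pr ξ) ∧
      |ξ (Fin.last m) - alphaCenter α k (Fin.last m)| ≤ 4 * r * lam α k := by
  have hl := lam_pos (α := α) k
  constructor
  · by_contra hw
    apply h
    unfold mulM
    rw [alphaPsi_eq_zero hη hr hw]; simp
  · by_contra hw
    push Not at hw
    apply h
    unfold mulM
    rw [chi_zero hη (by positivity) (by linarith)]; simp

lemma mulM_continuous (hη : IsBump η) (h0 : 0 < α) (h1 : α < 1) (hr : 0 < r)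
    (hadm' : AlphaAdmissible η α r m) (k : Fin (m+1) → ℤ) (l : Fin m → ℤ)
    (x : EuclideanSpace ℝ (Fin m)) : Continuous (mulM η α r k l x) := by
  apply Continuous.mul
  · apply Continuous.mul
    · exact ech_continuous.comp (pr_continuous.inner continuous_const)
    · exact (psi_smooth hη h0 h1 hr hadm' l).continuous.comp pr_continuous
  · exact (chi_smooth hη _ _).continuous.comp (by fun_prop)

/-- base point -/
def wpt (α : ℝ) (k : Fin (m+1) → ℤ) (l : Fin m → ℤ) : EuclideanSpace ℝ (Fin (m+1)) :=
  WithLp.toLp 2 (Fin.snoc (α := fun _ => ℝ) (alphaCenter α l) (alphaCenter α k (Fin.last m)))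

lemma mulM_norm (hη : IsBump η) (hr : 0 < r) {k : Fin (m+1) → ℤ} {l : Fin m → ℤ}
    {x : EuclideanSpace ℝ (Fin m)} {ξ : EuclideanSpace ℝ (Fin (m+1))}
    (h : mulM η α r k l x ξ ≠ 0) :
    ‖ξ - wpt α k l‖ ≤ m * (2 * r * lam α l) + 4 * r * lam α k := by
  obtain ⟨h1, h2⟩ := mulM_supp hη hr h
  refine (norm_le_sum_abs _).trans ?_
  rw [Fin.sum_univ_castSucc]
  apply add_le_add
  · calc _ ≤ ∑ i : Fin m, 2 * r * lam α l := by
          apply Finset.sum_le_sum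
          intro i _
          simpa [wpt, pr_apply] using h1 i
      _ = _ := by simp
  · simpa [wpt] using h2

lemma mulM_integrable (hη : IsBump η) (h0 : 0 < α) (h1 : α < 1) (hr : 0 < r)
    (hadm' : AlphaAdmissible η α r m) (k : Fin (m+1) → ℤ) (l : Fin m → ℤ)
    (x : EuclideanSpace ℝ (Fin m)) : Integrable (mulM η α r k l x) := by
  apply (mulM_continuous hη h0 h1 hr hadm' k l x).integrable_of_hasCompactSupport
  apply HasCompactSupport.of_support_subset_isCompact
    (isCompact_closedBall (wpt α k l) (m * (2 * r * lam α l) + 4 * r * lam α k))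
  intro ξ hξ
  rw [mem_closedBall_iff_norm]
  exact mulM_norm hη hr hξ

lemma J_eq (hη : IsBump η) (h0 : 0 < α) (h1 : α < 1) (hr : 0 < r)
    (hadm' : AlphaAdmissible η α r m) (k : Fin (m+1) → ℤ) (l : Fin m → ℤ)
    (g : SchwartzMap (EuclideanSpace ℝ (Fin (m+1))) ℂ)
    (hg : ∀ ξ, ¬ InWin α r k ξ → 𝓕 (⇑g) ξ = 0) (x : EuclideanSpace ℝ (Fin m)) :
    Jop η α r l (𝓕 (⇑g)) x = ∫ y, 𝓕 (mulM η α r k l x) y * g y := by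
  rw [fourier_flip (mulM_integrable hη h0 h1 hr hadm' k l x) g.integrable]
  unfold Jop
  congr 1
  ext ξ
  by_cases h : InWin α r k ξ
  · unfold mulM
    rw [chi_one hη (mul_pos (by positivity) (lam_pos k)) (h (Fin.last m)), mul_one]
  · rw [hg ξ h, mul_zero, mul_zero]

lemma FmulM_continuous (hη : IsBump η) (h0 : 0 < α) (h1 : α < 1) (hr : 0 < r)
    (hadm' : AlphaAdmissible η α r m) (k : Fin (m+1) → ℤ) (l : Fin m → ℤ)
    (x : EuclideanSpace ℝ (Fin m)) : Continuous (𝓕 (mulM η α r k l x)) :=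
  VectorFourier.fourierIntegral_continuous Real.continuous_fourierChar
      (by exact continuous_inner) (mulM_integrable hη h0 h1 hr hadm' k l x)

lemma prod_integrable (hη : IsBump η) (h0 : 0 < α) (h1 : α < 1) (hr : 0 < r)
    (hadm' : AlphaAdmissible η α r m) (k : Fin (m+1) → ℤ) (l : Fin m → ℤ)
    (g : SchwartzMap (EuclideanSpace ℝ (Fin (m+1))) ℂ) (x : EuclideanSpace ℝ (Fin m)) :
    Integrable (fun y => 𝓕 (mulM η α r k l x) y * g y) :=
  g.integrable.bdd_mul (FmulM_continuous hη h0 h1 hr hadm' k l x).aestronglyMeasurable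
    (Eventually.of_forall fun y => VectorFourier.norm_fourierIntegral_le_integral_norm _ _ _ _ y)

lemma prod_supp (hη : IsBump η) (h0 : 0 < α) (h1 : α < 1) (hr : 0 < r)
    (hadm' : AlphaAdmissible η α r m) (k : Fin (m+1) → ℤ) (l : Fin m → ℤ)
    (g : SchwartzMap (EuclideanSpace ℝ (Fin (m+1))) ℂ)
    (hg : ∀ ξ, ¬ InWin α r k ξ → 𝓕 (⇑g) ξ = 0) (x : EuclideanSpace ℝ (Fin m))
    (ζ : EuclideanSpace ℝ (Fin (m+1)))
    (hζ : ζ ∉ Metric.closedBall (cen α k - wpt α k l)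
      ((m+1) * (2 * r * lam α k) + (m * (2 * r * lam α l) + 4 * r * lam α k))) :
    𝓕 (fun y => 𝓕 (mulM η α r k l x) y * g y) ζ = 0 := by
  have hgi : Integrable (fun y => ech (-inner ℝ y ζ) * g y) :=
    g.integrable.bdd_mul (c := 1)
      (ech_continuous.comp (by fun_prop)).aestronglyMeasurable
      (Eventually.of_forall fun y => (norm_ech _).le)
  rw [fourier_ech]
  have e1 : ∀ y, ech (-inner ℝ y ζ) * (𝓕 (mulM η α r k l x) y * g y) =
      𝓕 (mulM η α r k l x) y * (ech (-inner ℝ y ζ) * g y) := fun y => by ring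
  simp_rw [e1]
  rw [fourier_flip (mulM_integrable hη h0 h1 hr hadm' k l x) hgi]
  have e2 : ∀ ξ, 𝓕 (fun y => ech (-inner ℝ y ζ) * g y) ξ = 𝓕 (⇑g) (ξ + ζ) := by
    intro ξ
    rw [fourier_ech, fourier_ech]
    congr 1
    ext y
    rw [inner_add_right, neg_add, ech_add, mul_assoc]
  simp_rw [e2]
  have : ∀ ξ, mulM η α r k l x ξ * 𝓕 (⇑g) (ξ + ζ) = 0 := by
    intro ξ
    by_contra h
    have hM := left_ne_zero_of_mul h
    have hG := right_ne_zero_of_mul h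
    have hw : InWin α r k (ξ + ζ) := by
      by_contra hw; exact hG (hg _ hw)
    apply hζ
    rw [mem_closedBall_iff_norm]
    have e3 : ζ - (cen α k - wpt α k l) = (ξ + ζ - cen α k) - (ξ - wpt α k l) := by abel
    rw [e3]
    refine (norm_sub_le _ _).trans (add_le_add ?_ (mulM_norm hη hr hM))
    have := hw.norm_sub_le
    push_cast at this
    exact this
  simp [this]

end Decomp

section KeyEstimate

open Set Filter Topology

variable {m : ℕ} {η : ℝ → ℝ} {α r : ℝ}

lemma jensen_w {X : Type*} [MeasurableSpace X] (μ : Measure X) {w g : X → ℝ≥0∞}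
    (hw : Measurable w) (hg : Measurable g) {p : ℝ} (hp : 1 ≤ p) :
    (∫⁻ x, w x * g x ∂μ) ^ p ≤ (∫⁻ x, w x ∂μ) ^ (p - 1) * ∫⁻ x, w x * g x ^ p ∂μ := by
  rcases hp.eq_or_lt with rfl | hp
  · simp
  have hc := Real.HolderConjugate.conjExponent hp
  set q := p.conjExponent with hq
  have hp0 : 0 < p := by linarith
  have hq0 : 0 < q := hc.symm.pos
  have h := ENNReal.lintegral_mul_le_Lp_mul_Lq μ hc
    (f := fun x => w x ^ (1/p) * g x) (g := fun x => w x ^ (1/q))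
    ((hw.pow_const _).mul hg).aemeasurable (hw.pow_const _).aemeasurable
  have e1 : ∀ x, ((fun x => w x ^ (1/p) * g x) * (fun x => w x ^ (1/q))) x = w x * g x := by
    intro x
    have : w x = w x ^ (1/p) * w x ^ (1/q) := by
      rw [← ENNReal.rpow_add_of_nonneg _ _ (by positivity) (by positivity), one_div, one_div,
        hc.inv_add_inv_eq_one, ENNReal.rpow_one]
    simp only [Pi.mul_apply]
    conv_rhs => rw [this]
    ring
  have e2 : ∀ x, (w x ^ (1/p) * g x) ^ p = w x * g x ^ p := by
    intro x
    rw [ENNReal.mul_rpow_of_nonneg _ _ hp0.le, ← ENNReal.rpow_mul, one_div,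
      inv_mul_cancel₀ hp0.ne', ENNReal.rpow_one]
  have e3 : ∀ x, (w x ^ (1/q)) ^ q = w x := by
    intro x
    rw [← ENNReal.rpow_mul, one_div, inv_mul_cancel₀ hq0.ne', ENNReal.rpow_one]
  simp_rw [e1, e2, e3] at h
  refine (ENNReal.rpow_le_rpow h hp0.le).trans (le_of_eq ?_)
  rw [ENNReal.mul_rpow_of_nonneg _ _ hp0.le, ← ENNReal.rpow_mul, ← ENNReal.rpow_mul, one_div,
    inv_mul_cancel₀ hp0.ne', ENNReal.rpow_one, mul_comm]
  congr 2
  rw [hq, Real.conjExponent]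
  field_simp

lemma rho_continuous (hη : IsBump η) (hr : 0 < r) (k : Fin (m+1) → ℤ) :
    Continuous (rho η α r k) := by
  have hL : 0 < 2 * r * lam α k := mul_pos (by positivity) (lam_pos k)
  have := (𝓕⁻ ((chi_compact hη hL (c := alphaCenter α k (Fin.last m))).toSchwartzMap
    (chi_smooth hη _ _))).continuous
  rw [SchwartzMap.fourierInv_coe] at this
  exact this

lemma hker_continuous (hη : IsBump η) (h0 : 0 < α) (h1 : α < 1) (hr : 0 < r)
    (hadm' : AlphaAdmissible η α r m) (l : Fin m → ℤ) : Continuous (hker η α r l) := by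
  obtain ⟨S, hS⟩ := hker_schwartz hη h0 h1 hr hadm' l
  rw [← hS]; exact S.continuous

lemma J_le (hη : IsBump η) (h0 : 0 < α) (h1 : α < 1) (hr : 0 < r)
    (hadm' : AlphaAdmissible η α r m) (k : Fin (m+1) → ℤ) (l : Fin m → ℤ)
    (g : SchwartzMap (EuclideanSpace ℝ (Fin (m+1))) ℂ)
    (hg : ∀ ξ, ¬ InWin α r k ξ → 𝓕 (⇑g) ξ = 0) (x : EuclideanSpace ℝ (Fin m)) :
    ‖Jop η α r l (𝓕 (⇑g)) x‖ₑ ≤ ∫⁻ y, ‖𝓕 (mulM η α r k l x) y‖ₑ * ‖g y‖ₑ := by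
  rw [J_eq hη h0 h1 hr hadm' k l g hg x]
  refine (enorm_integral_le_lintegral_enorm _).trans (le_of_eq ?_)
  simp_rw [enorm_mul]

/-- Integration of the pointwise estimate. -/
lemma int_common (hη : IsBump η) (h0 : 0 < α) (h1 : α < 1) (hr : 0 < r)
    (hadm' : AlphaAdmissible η α r m) (k : Fin (m+1) → ℤ) (l : Fin m → ℤ)
    (g : SchwartzMap (EuclideanSpace ℝ (Fin (m+1))) ℂ) (P θ : ℝ) (hθ : 0 < θ) (R : ℝ≥0∞)
    (hR : ∀ t, ‖rho η α r k t‖ₑ ≤ R) :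
    ∫⁻ x, ∫⁻ y, ‖𝓕 (mulM η α r k l x) y‖ₑ ^ θ * ‖g y‖ₑ ^ P ≤
      (∫⁻ x, ‖hker η α r l x‖ₑ ^ θ) * R ^ θ * ∫⁻ y, ‖g y‖ₑ ^ P := by
  have hH := hker_continuous hη h0 h1 hr hadm' l
  have hrho := rho_continuous (α := α) hη hr k
  simp_rw [mulM_fourier]
  rw [lintegral_lintegral_swap]
  · rw [← lintegral_const_mul]
    · apply lintegral_mono
      intro y
      dsimp only
      rw [lintegral_mul_const]
      · gcongr
        rw [← lintegral_sub_right_eq_self (fun x => ‖hker η α r l x‖ₑ ^ θ) (pr y), ← lintegral_mul_const]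
        · apply lintegral_mono
          intro x
          dsimp only
          rw [enorm_mul, ENNReal.mul_rpow_of_nonneg _ _ hθ.le]
          gcongr
          exact hR _
        · apply Measurable.pow_const
          exact (hH.comp (by fun_prop)).enorm.measurable
      · apply Measurable.pow_const
        exact ((hH.comp (by fun_prop)).mul continuous_const).enorm.measurable
    · exact (g.continuous.enorm.measurable).pow_const _
  · apply Measurable.aemeasurable
    apply Measurable.mul
    · apply Measurable.pow_const
      apply Continuous.measurable
      apply Continuous.enorm
      apply Continuous.mul
      · exact hH.comp (continuous_fst.sub (pr_continuous.comp continuous_snd))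
      · exact hrho.comp (by fun_prop)
    · exact ((g.continuous.comp continuous_snd).enorm.measurable).pow_const _

lemma close_est {X Y : Type*} [MeasurableSpace X] [MeasurableSpace Y] {μ : Measure X}
    {ν : Measure Y} {J : X → ℂ} {g : Y → ℂ} {p : ℝ≥0∞} (hp : 0 < p) (hpt : p ≠ ∞)
    {C E : ℝ≥0∞} (h : ∫⁻ x, ‖J x‖ₑ ^ p.toReal ∂μ ≤ C * E ^ p.toReal * ∫⁻ y, ‖g y‖ₑ ^ p.toReal ∂ν) :
    eLpNorm J p μ ≤ C ^ (1 / p.toReal) * E * eLpNorm g p ν := by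
  have hP : 0 < p.toReal := ENNReal.toReal_pos hp.ne' hpt
  rw [eLpNorm_eq_lintegral_rpow_enorm_toReal hp.ne' hpt,
    eLpNorm_eq_lintegral_rpow_enorm_toReal hp.ne' hpt]
  refine (ENNReal.rpow_le_rpow h (by positivity)).trans (le_of_eq ?_)
  rw [ENNReal.mul_rpow_of_nonneg _ _ (by positivity), ENNReal.mul_rpow_of_nonneg _ _ (by positivity),
    ← ENNReal.rpow_mul E, mul_one_div_cancel hP.ne', ENNReal.rpow_one]

lemma mulM_int (hη : IsBump η) (h0 : 0 < α) (h1 : α < 1) (hr : 0 < r)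
    (hadm' : AlphaAdmissible η α r m) (k : Fin (m+1) → ℤ) (l : Fin m → ℤ)
    (x : EuclideanSpace ℝ (Fin m)) :
    ∫⁻ y, ‖𝓕 (mulM η α r k l x) y‖ₑ = (∫⁻ x, ‖hker η α r l x‖ₑ) * ∫⁻ t, ‖rho η α r k t‖ₑ := by
  have hH := hker_continuous hη h0 h1 hr hadm' l
  have hrho := rho_continuous (α := α) hη hr k
  simp_rw [mulM_fourier, enorm_mul]
  rw [lintegral_split (fun z => ‖hker η α r l (x - z)‖ₑ) (fun t => ‖rho η α r k (-t)‖ₑ)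
    (hH.comp (by fun_prop)).enorm.measurable (hrho.comp (by fun_prop)).enorm.measurable]
  rw [lintegral_sub_left_eq_self (fun z => ‖hker η α r l z‖ₑ) x,
    lintegral_neg_eq_self (fun t => ‖rho η α r k t‖ₑ)]

/-- Case `p = ∞`. -/
lemma key_top (hη : IsBump η) (h0 : 0 < α) (h1 : α < 1) (hr : 0 < r)
    (hadm' : AlphaAdmissible η α r m) :
    ∃ C : ℝ≥0∞, C ≠ ∞ ∧ ∀ (k : Fin (m+1) → ℤ) (l : Fin m → ℤ)
      (g : SchwartzMap (EuclideanSpace ℝ (Fin (m+1))) ℂ),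
      (∀ ξ, ¬ InWin α r k ξ → 𝓕 (⇑g) ξ = 0) →
      eLpNorm (Jop η α r l (𝓕 (⇑g))) ∞ volume ≤ C * eLpNorm (⇑g) ∞ volume := by
  obtain ⟨C₁, hC₁, H₁⟩ := hker_bound hη h0 h1 hr hadm' 1 one_pos
  obtain ⟨C₂, hC₂, H₂⟩ := rho_bounds hη
  refine ⟨C₁ * C₂, ENNReal.mul_ne_top hC₁ hC₂, fun k l g hg => ?_⟩
  rw [eLpNorm_exponent_top, eLpNorm_exponent_top]
  apply eLpNormEssSup_le_of_ae_enorm_bound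
  refine Eventually.of_forall fun x => ?_
  refine (J_le hη h0 h1 hr hadm' k l g hg x).trans ?_
  calc _ ≤ ∫⁻ y, ‖𝓕 (mulM η α r k l x) y‖ₑ * eLpNormEssSup (⇑g) volume := by
        apply lintegral_mono_ae
        filter_upwards [enorm_ae_le_eLpNormEssSup (⇑g) volume] with y hy
        gcongr
    _ = (∫⁻ y, ‖𝓕 (mulM η α r k l x) y‖ₑ) * eLpNormEssSup (⇑g) volume := by
        rw [lintegral_mul_const]
        exact (FmulM_continuous hη h0 h1 hr hadm' k l x).enorm.measurable
    _ ≤ _ := by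
        rw [mulM_int hη h0 h1 hr hadm']
        gcongr
        · simpa using H₁ l
        · exact (H₂ _ _ (mul_pos (by positivity) (lam_pos k))).1

/-- Case `1 ≤ p < ∞`. -/
lemma key_ge_one (hη : IsBump η) (h0 : 0 < α) (h1 : α < 1) (hr : 0 < r)
    (hadm' : AlphaAdmissible η α r m) (p : ℝ≥0∞) (hp : 1 ≤ p) (hpt : p ≠ ∞) :
    ∃ C : ℝ≥0∞, C ≠ ∞ ∧ ∀ (k : Fin (m+1) → ℤ) (l : Fin m → ℤ)
      (g : SchwartzMap (EuclideanSpace ℝ (Fin (m+1))) ℂ),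
      (∀ ξ, ¬ InWin α r k ξ → 𝓕 (⇑g) ξ = 0) →
      eLpNorm (Jop η α r l (𝓕 (⇑g))) p volume ≤
        C * ENNReal.ofReal (lam α k ^ (1 / p.toReal)) * eLpNorm (⇑g) p volume := by
  obtain ⟨C₁, hC₁, H₁⟩ := hker_bound hη h0 h1 hr hadm' 1 one_pos
  obtain ⟨C₂, hC₂, H₂⟩ := rho_bounds hη
  have hp0 : 0 < p := lt_of_lt_of_le one_pos hp
  have hP : 1 ≤ p.toReal := by
    rw [← ENNReal.toReal_one]; exact ENNReal.toReal_mono hpt hp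
  have hP0 : 0 < p.toReal := by linarith
  set D : ℝ≥0∞ := (C₁ * C₂) ^ (p.toReal - 1) * (C₁ * (C₂ * ENNReal.ofReal (2 * r))) with hD
  have hDf : D ≠ ∞ := by
    apply ENNReal.mul_ne_top
    · exact ENNReal.rpow_ne_top_of_nonneg (by linarith) (ENNReal.mul_ne_top hC₁ hC₂)
    · exact ENNReal.mul_ne_top hC₁ (ENNReal.mul_ne_top hC₂ ENNReal.ofReal_ne_top)
  refine ⟨D ^ (1 / p.toReal), ENNReal.rpow_ne_top_of_nonneg (by positivity) hDf,
    fun k l g hg => ?_⟩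
  have hl := lam_pos (α := α) k
  have hL : 0 < 2 * r * lam α k := by positivity
  have hH1 : ∫⁻ x, ‖hker η α r l x‖ₑ ≤ C₁ := by simpa using H₁ l
  have hR1 : ∫⁻ t, ‖rho η α r k t‖ₑ ≤ C₂ := (H₂ _ _ hL).1
  apply close_est hp0 hpt
  have hpt2 : ∀ x, ‖Jop η α r l (𝓕 (⇑g)) x‖ₑ ^ p.toReal ≤ (C₁ * C₂) ^ (p.toReal - 1) *
      ∫⁻ y, ‖𝓕 (mulM η α r k l x) y‖ₑ ^ (1:ℝ) * ‖g y‖ₑ ^ p.toReal := by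
    intro x
    refine (ENNReal.rpow_le_rpow (J_le hη h0 h1 hr hadm' k l g hg x) hP0.le).trans ?_
    refine (jensen_w volume (FmulM_continuous hη h0 h1 hr hadm' k l x).enorm.measurable
      g.continuous.enorm.measurable hP).trans ?_
    rw [mulM_int hη h0 h1 hr hadm']
    simp_rw [ENNReal.rpow_one]
    gcongr
  refine (lintegral_mono hpt2).trans ?_
  rw [lintegral_const_mul' _ _
    (ENNReal.rpow_ne_top_of_nonneg (by linarith) (ENNReal.mul_ne_top hC₁ hC₂))]
  have := int_common hη h0 h1 hr hadm' k l g p.toReal 1 one_pos _ (H₂ _ _ hL).2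
  calc _ ≤ (C₁ * C₂) ^ (p.toReal - 1) * (C₁ * (C₂ * ENNReal.ofReal (2 * r * lam α k)) *
        ∫⁻ y, ‖g y‖ₑ ^ p.toReal) := by
        gcongr
        refine this.trans ?_
        simp_rw [ENNReal.rpow_one]
        gcongr
    _ = _ := by
        rw [hD, ENNReal.ofReal_rpow_of_pos (by positivity), ← Real.rpow_mul hl.le,
          one_div, inv_mul_cancel₀ hP0.ne', Real.rpow_one, ENNReal.ofReal_mul (by positivity)]
        ring

/-- Case `p < 1`. -/
lemma key_lt_one (hη : IsBump η) (h0 : 0 < α) (h1 : α < 1) (hr : 0 < r)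
    (hadm' : AlphaAdmissible η α r m) (p : ℝ≥0∞) (hp : 0 < p) (hp1 : p < 1) :
    ∃ C : ℝ≥0∞, C ≠ ∞ ∧ ∀ (k : Fin (m+1) → ℤ) (l : Fin m → ℤ),
      (∃ ξ, InWin α r k ξ ∧ InWin α r l (pr ξ)) →
      ∀ (g : SchwartzMap (EuclideanSpace ℝ (Fin (m+1))) ℂ),
      (∀ ξ, ¬ InWin α r k ξ → 𝓕 (⇑g) ξ = 0) →
      eLpNorm (Jop η α r l (𝓕 (⇑g))) p volume ≤
        C * ENNReal.ofReal ((lam α k / lam α l) ^ (m * (1 / p.toReal - 1)) *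
          lam α k ^ (1 / p.toReal)) * eLpNorm (⇑g) p volume := by
  have hpt : p ≠ ∞ := (hp1.trans ENNReal.one_lt_top).ne
  have hP0 : 0 < p.toReal := ENNReal.toReal_pos hp.ne' hpt
  have hP1 : p.toReal < 1 := by
    rw [← ENNReal.toReal_one]; exact ENNReal.toReal_strict_mono ENNReal.one_ne_top hp1
  set P := p.toReal with hP
  have hQ : 0 ≤ 1 - P := by linarith
  obtain ⟨C₁, hC₁, H₁⟩ := hker_bound hη h0 h1 hr hadm' P hP0
  obtain ⟨C₂, hC₂, H₂⟩ := rho_bounds hη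
  obtain ⟨B, hB, hcomp⟩ := jbr_compare h0 h1 hr (m+1) m
  set T : ℝ := (m+1) * (2 * r) + (m * (2 * r * B) + 4 * r) with hT
  have hT0 : 0 < T := by positivity
  set U : ℝ≥0∞ := volume (Metric.ball (0 : EuclideanSpace ℝ (Fin (m+1))) 1) with hU
  have hUf : U ≠ ∞ := measure_ball_lt_top.ne
  set A : ℝ≥0∞ := (ENNReal.ofReal (T ^ (m+1)) * U) ^ (1 - P) with hA
  have hAf : A ≠ ∞ := ENNReal.rpow_ne_top_of_nonneg hQ
    (ENNReal.mul_ne_top ENNReal.ofReal_ne_top hUf)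
  set D : ℝ≥0∞ := A * (C₁ * (C₂ * ENNReal.ofReal (2 * r)) ^ P) with hD
  have hDf : D ≠ ∞ := by
    apply ENNReal.mul_ne_top hAf
    apply ENNReal.mul_ne_top hC₁
    exact ENNReal.rpow_ne_top_of_nonneg hP0.le (ENNReal.mul_ne_top hC₂ ENNReal.ofReal_ne_top)
  refine ⟨D ^ (1 / P), ENNReal.rpow_ne_top_of_nonneg (by positivity) hDf, ?_⟩
  rintro k l ⟨ξ₀, hξk, hξl⟩ g hg
  have hk := lam_pos (α := α) k
  have hl := lam_pos (α := α) l
  have hlk : lam α l ≤ B * lam α k := (hcomp k ξ₀ l (pr ξ₀) hξk hξl (norm_pr_le ξ₀)).2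
  have hL : 0 < 2 * r * lam α k := by positivity
  apply close_est hp hpt
  rw [← hP]
  have hpt2 : ∀ x, ‖Jop η α r l (𝓕 (⇑g)) x‖ₑ ^ P ≤
      (A * ENNReal.ofReal (lam α k ^ ((m+1) * (1 - P)))) *
      ∫⁻ y, ‖𝓕 (mulM η α r k l x) y‖ₑ ^ P * ‖g y‖ₑ ^ P := by
    intro x
    refine (ENNReal.rpow_le_rpow (J_le hη h0 h1 hr hadm' k l g hg x) hP0.le).trans ?_
    have := nikolskii (G := fun y => 𝓕 (mulM η α r k l x) y * g y) ((FmulM_continuous hη h0 h1 hr hadm' k l x).mul g.continuous)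
      (prod_integrable hη h0 h1 hr hadm' k l g x) _ _
      (prod_supp hη h0 h1 hr hadm' k l g hg x) hP0 hP1
    simp_rw [enorm_mul, ENNReal.mul_rpow_of_nonneg _ _ hP0.le] at this
    refine this.trans ?_
    gcongr
    calc _ ≤ (volume (Metric.closedBall (cen α k - wpt α k l) (T * lam α k))) ^ (1 - P) := by
          gcongr
          rw [hT]
          have : 2 * r * lam α l ≤ 2 * r * (B * lam α k) := by gcongr
          have : m * (2 * r * lam α l) ≤ m * (2 * r * (B * lam α k)) := by gcongr
          linarith
      _ = _ := by
          rw [Measure.addHaar_closedBall _ _ (by positivity), finrank_euclideanSpace_fin, hA,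
            mul_pow, ENNReal.ofReal_mul (by positivity), mul_right_comm,
            ENNReal.mul_rpow_of_nonneg _ _ hQ,
            ENNReal.ofReal_rpow_of_pos (by positivity), ← Real.rpow_natCast (lam α k),
            ← Real.rpow_mul hk.le]
          push_cast
          rfl
  refine (lintegral_mono hpt2).trans ?_
  rw [lintegral_const_mul' _ _ (ENNReal.mul_ne_top hAf ENNReal.ofReal_ne_top)]
  have := int_common hη h0 h1 hr hadm' k l g P P hP0 _ (H₂ _ _ hL).2
  have hid : ((lam α k / lam α l) ^ (m * (1 / P - 1)) * lam α k ^ (1 / P)) ^ P =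
      lam α k ^ ((m+1) * (1 - P)) * lam α l ^ (m * (P - 1)) * lam α k ^ P := by
    rw [Real.mul_rpow (by positivity) (by positivity), ← Real.rpow_mul (by positivity),
      ← Real.rpow_mul hk.le, one_div, inv_mul_cancel₀ hP0.ne', Real.rpow_one]
    have e : (m:ℝ) * (P⁻¹ - 1) * P = m * (1 - P) := by field_simp
    rw [e, Real.div_rpow hk.le hl.le, mul_right_comm, ← Real.rpow_add hk]
    have e2 : ((m:ℝ) + 1) * (1 - P) + P = m * (1 - P) + 1 := by ring
    rw [e2, Real.rpow_add hk, Real.rpow_one]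
    have e3 : (m:ℝ) * (P - 1) = -(m * (1 - P)) := by ring
    rw [e3, Real.rpow_neg hl.le]
    field_simp
  calc _ ≤ (A * ENNReal.ofReal (lam α k ^ ((m+1) * (1 - P)))) *
        ((C₁ * ENNReal.ofReal (lam α l ^ (m * (P - 1)))) *
          (C₂ * ENNReal.ofReal (2 * r * lam α k)) ^ P * ∫⁻ y, ‖g y‖ₑ ^ P) := by
        gcongr
        refine this.trans ?_
        gcongr
        exact H₁ l
    _ = _ := by
        have e1 : ENNReal.ofReal (2 * r * lam α k) =
            ENNReal.ofReal (2 * r) * ENNReal.ofReal (lam α k) := ENNReal.ofReal_mul (by positivity)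
        have e2 : ENNReal.ofReal (lam α k ^ ((m+1) * (1 - P)) * lam α l ^ (m * (P - 1)) *
            lam α k ^ P) = ENNReal.ofReal (lam α k ^ ((m+1) * (1 - P))) *
            ENNReal.ofReal (lam α l ^ (m * (P - 1))) * ENNReal.ofReal (lam α k ^ P) := by
          rw [ENNReal.ofReal_mul (by positivity), ENNReal.ofReal_mul (by positivity)]
        rw [ENNReal.ofReal_rpow_of_pos (by positivity), hid, e2, e1, hD, ← mul_assoc C₂,
          ENNReal.mul_rpow_of_nonneg (C₂ * ENNReal.ofReal (2 * r)) _ hP0.le,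
          ENNReal.ofReal_rpow_of_pos hk]
        ring

/-- The key estimate. -/
lemma key_est (hη : IsBump η) (h0 : 0 < α) (h1 : α < 1) (hr : 0 < r)
    (hadm' : AlphaAdmissible η α r m) (p : ℝ≥0∞) (hp : 0 < p) :
    ∃ C : ℝ≥0∞, C ≠ ∞ ∧ ∀ (k : Fin (m+1) → ℤ) (l : Fin m → ℤ),
      (∃ ξ, InWin α r k ξ ∧ InWin α r l (pr ξ)) →
      ∀ (g : SchwartzMap (EuclideanSpace ℝ (Fin (m+1))) ℂ),
      (∀ ξ, ¬ InWin α r k ξ → 𝓕 (⇑g) ξ = 0) →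
      eLpNorm (Jop η α r l (𝓕 (⇑g))) p volume ≤
        C * ENNReal.ofReal ((lam α k / lam α l) ^ (m * (1 / (min p 1).toReal - 1)) *
          lam α k ^ (1 / p.toReal)) * eLpNorm (⇑g) p volume := by
  rcases lt_or_ge p 1 with hp1 | hp1
  · rw [min_eq_left hp1.le]
    exact key_lt_one hη h0 h1 hr hadm' p hp hp1
  · rw [min_eq_right hp1]
    rcases eq_or_ne p ∞ with rfl | hpt
    · obtain ⟨C, hC, H⟩ := key_top hη h0 h1 hr hadm'
      refine ⟨C, hC, fun k l _ g hg => ?_⟩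
      simpa using H k l g hg
    · obtain ⟨C, hC, H⟩ := key_ge_one hη h0 h1 hr hadm' p hp1 hpt
      refine ⟨C, hC, fun k l _ g hg => ?_⟩
      simpa using H k l g hg

end KeyEstimate

section Minkowski

/-- Countable Minkowski inequality for nonnegative functions. -/
lemma mink_tsum {ι X : Type*} [Countable ι] [MeasurableSpace X] {μ : Measure X} {p : ℝ≥0∞}
    (hp : 1 ≤ p) (F : ι → X → ℝ≥0∞) (hF : ∀ k, Measurable (F k)) :
    eLpNorm (fun x => ∑' k, F k x) p μ ≤ ∑' k, eLpNorm (F k) p μ := by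
  classical
  rcases eq_or_ne p ∞ with rfl | hpt
  · rw [eLpNorm_exponent_top]
    have h : ∀ᵐ x ∂μ, ∀ k, F k x ≤ eLpNorm (F k) ∞ μ := by
      rw [ae_all_iff]
      intro k
      have := ae_le_eLpNormEssSup (f := F k) (μ := μ)
      filter_upwards [this] with x hx
      simpa [eLpNorm_exponent_top] using hx
    refine essSup_le_of_ae_le _ ?_
    filter_upwards [h] with x hx
    rw [enorm_eq_self]
    exact ENNReal.tsum_le_tsum hx
  · have hp0 : p ≠ 0 := (zero_lt_one.trans_le hp).ne'
    have hP : 0 < p.toReal := ENNReal.toReal_pos hp0 hpt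
    have key : ∀ s : Finset ι, ∫⁻ x, (∑ k ∈ s, F k x) ^ p.toReal ∂μ ≤
        (∑' k, eLpNorm (F k) p μ) ^ p.toReal := by
      intro s
      have h1 := eLpNorm_sum_le (μ := μ) (p := p) (f := F) (s := s)
        (fun i _ => (hF i).aestronglyMeasurable) hp
      have h2 := h1.trans (ENNReal.sum_le_tsum s)
      rw [eLpNorm_eq_lintegral_rpow_enorm_toReal hp0 hpt, one_div,
        ENNReal.rpow_inv_le_iff hP] at h2
      simpa using h2
    rw [eLpNorm_eq_lintegral_rpow_enorm_toReal hp0 hpt, one_div, ENNReal.rpow_inv_le_iff hP]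
    simp_rw [enorm_eq_self, ENNReal.tsum_eq_iSup_sum]
    have e : ∀ x, (⨆ s : Finset ι, ∑ k ∈ s, F k x) ^ p.toReal =
        ⨆ s : Finset ι, (∑ k ∈ s, F k x) ^ p.toReal := by
      intro x
      exact (ENNReal.orderIsoRpow p.toReal hP).map_iSup _
    simp_rw [e]
    rw [lintegral_iSup_directed]
    · apply iSup_le
      intro s
      rw [← ENNReal.tsum_eq_iSup_sum]
      exact key s
    · intro s
      exact ((Finset.measurable_sum s fun k _ => hF k).pow_const _).aemeasurable
    · apply directed_of_isDirected_le
      intro s t hst x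
      dsimp only
      gcongr

lemma mink {ι X : Type*} [Countable ι] [MeasurableSpace X] {μ : Measure X} {p : ℝ≥0∞}
    {u : ℝ} (hu : 0 < u) (hup : ENNReal.ofReal u ≤ p) (F : ι → X → ℝ≥0∞)
    (hF : ∀ k, Measurable (F k)) (G : X → ℝ≥0∞) (hG : ∀ x, G x ^ u ≤ ∑' k, F k x ^ u) :
    eLpNorm G p μ ^ u ≤ ∑' k, eLpNorm (F k) p μ ^ u := by
  have hu0 : ENNReal.ofReal u ≠ 0 := by simpa using hu
  have hp' : 1 ≤ p / ENNReal.ofReal u := by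
    rw [ENNReal.le_div_iff_mul_le (Or.inl hu0) (Or.inl ENNReal.ofReal_ne_top), one_mul]
    exact hup
  have hpe : p / ENNReal.ofReal u * ENNReal.ofReal u = p :=
    ENNReal.div_mul_cancel hu0 ENNReal.ofReal_ne_top
  have e : ∀ H : X → ℝ≥0∞, eLpNorm H p μ ^ u =
      eLpNorm (fun x => H x ^ u) (p / ENNReal.ofReal u) μ := by
    intro H
    have := eLpNorm_enorm_rpow (p := p / ENNReal.ofReal u) (μ := μ) H hu
    rw [hpe] at this
    simpa using this.symm
  simp_rw [e]
  refine le_trans ?_ (mink_tsum hp' (fun k x => F k x ^ u) fun k => (hF k).pow_const _)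
  apply eLpNorm_mono_enorm
  intro x
  simpa using hG x

lemma rpow_tsum_le {ι : Type*} (a : ι → ℝ≥0∞) {u : ℝ} (hu : 0 < u) (hu1 : u ≤ 1) :
    (∑' k, a k) ^ u ≤ ∑' k, a k ^ u := by
  classical
  have key : ∀ s : Finset ι, (∑ k ∈ s, a k) ^ u ≤ ∑ k ∈ s, a k ^ u := by
    intro s
    induction s using Finset.induction_on with
    | empty => simp [hu]
    | insert i s hi ih =>
      rw [Finset.sum_insert hi, Finset.sum_insert hi]
      refine (ENNReal.rpow_add_le_add_rpow _ _ hu.le hu1).trans ?_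
      gcongr
  rw [ENNReal.tsum_eq_iSup_sum]
  have e : (⨆ s : Finset ι, ∑ k ∈ s, a k) ^ u = ⨆ s : Finset ι, (∑ k ∈ s, a k) ^ u :=
    (ENNReal.orderIsoRpow u hu).map_iSup _
  rw [e]
  exact iSup_le fun s => (key s).trans (ENNReal.sum_le_tsum s)

lemma lqSum_eq {ι : Type*} [MeasurableSpace ι] [MeasurableSingletonClass ι] {q : ℝ≥0∞}
    (hq : 0 < q) (a : ι → ℝ≥0∞) : lqSum q a = eLpNorm a q Measure.count := by
  unfold lqSum
  split_ifs with h
  · subst h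
    rw [eLpNorm_exponent_top, eLpNormEssSup, essSup_count]
    simp
  · rw [eLpNorm_eq_lintegral_rpow_enorm_toReal hq.ne' h, lintegral_count]
    simp

end Minkowski

section Final

variable {m : ℕ} {η : ℝ → ℝ} {α r : ℝ}

/-- The indices `l` whose window meets the projection of the window of `k`. -/
def Lset (α r : ℝ) {m : ℕ} (k : Fin (m+1) → ℤ) : Set (Fin m → ℤ) :=
  {l | ∃ ξ, InWin α r k ξ ∧ InWin α r l (pr ξ)}

lemma lqSum_const_mul {ι : Type*} {q : ℝ≥0∞} (hq : 0 < q) (c : ℝ≥0∞) (a : ι → ℝ≥0∞) :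
    lqSum q (fun i => c * a i) = c * lqSum q a := by
  unfold lqSum
  split_ifs with h
  · rw [ENNReal.mul_iSup]
  · have hQ : 0 < q.toReal := ENNReal.toReal_pos hq.ne' h
    simp_rw [ENNReal.mul_rpow_of_nonneg _ _ hQ.le]
    rw [ENNReal.tsum_mul_left, ENNReal.mul_rpow_of_nonneg _ _ (by positivity),
      ← ENNReal.rpow_mul, mul_one_div_cancel hQ.ne', ENNReal.rpow_one]

lemma lqSum_mono {ι : Type*} {q : ℝ≥0∞} {a b : ι → ℝ≥0∞} (h : ∀ i, a i ≤ b i) :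
    lqSum q a ≤ lqSum q b := by
  unfold lqSum
  split_ifs with hq
  · exact iSup_mono h
  · apply ENNReal.rpow_le_rpow _ (by positivity)
    exact ENNReal.tsum_le_tsum fun i => ENNReal.rpow_le_rpow (h i) ENNReal.toReal_nonneg

lemma pack_Lset (hη : IsBump η) (h0 : 0 < α) (h1 : α < 1) (hr : 0 < r)
    (hadm' : AlphaAdmissible η α r m) :
    ∃ C : ℝ≥0∞, C ≠ ∞ ∧ ∀ k : Fin (m+1) → ℤ,
      ∑' l, (Lset α r k).indicator (fun l => ENNReal.ofReal (lam α l) ^ m) l ≤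
        C * ENNReal.ofReal (lam α k) ^ m := by
  obtain ⟨C, hC, H⟩ := packing hη hr hadm'
  obtain ⟨B, hB, hcomp⟩ := jbr_compare h0 h1 hr (m+1) m
  set T : ℝ := r * B + m * (2 * r * B) + (m+1) * (2 * r) with hT
  have hT0 : 0 ≤ T := by positivity
  refine ⟨C * ENNReal.ofReal T ^ m, ENNReal.mul_ne_top hC (by finiteness), fun k => ?_⟩
  have hk := lam_pos (α := α) k
  refine (H (pr (cen α k)) (T * lam α k) (Lset α r k) (by positivity) ?_).trans (le_of_eq ?_)
  · rintro l ⟨ξ, hξk, hξl⟩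
    have hl := lam_pos (α := α) l
    have hlk := (hcomp k ξ l (pr ξ) hξk hξl (norm_pr_le ξ)).2
    apply Metric.closedBall_subset_closedBall'
    have d1 : dist (pr ξ) (cen α l) ≤ m * (2 * r * lam α l) := by
      rw [dist_eq_norm]; exact hξl.norm_sub_le
    have d2 : dist (pr ξ) (pr (cen α k)) ≤ (m+1) * (2 * r * lam α k) := by
      rw [dist_eq_norm]
      have e : pr ξ - pr (cen α k) = pr (ξ - cen α k) := by
        ext i; simp [pr_apply]
      rw [e]
      refine (norm_pr_le _).trans ?_
      have := hξk.norm_sub_le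
      push_cast at this
      exact this
    have d3 := dist_triangle_left (cen α l) (pr (cen α k)) (pr ξ)
    have e1 : r * lam α l ≤ r * (B * lam α k) := by gcongr
    have e2 : m * (2 * r * lam α l) ≤ m * (2 * r * (B * lam α k)) := by gcongr
    rw [hT]
    linarith
  · rw [ENNReal.ofReal_mul hT0, mul_pow, mul_assoc]

lemma lam_sum (hη : IsBump η) (h0 : 0 < α) (h1 : α < 1) (hr : 0 < r)
    (hadm' : AlphaAdmissible η α r m) (q : ℝ≥0∞) (hq : 0 < q) (σ : ℝ)
    (hσ : α / (1 - α) * m * (if q = ∞ then 0 else 1 / q.toReal) ≤ σ) :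
    ∃ C : ℝ≥0∞, C ≠ ∞ ∧ ∀ k : Fin (m+1) → ℤ,
      lqSum q ((Lset α r k).indicator (fun l => ENNReal.ofReal ((jbr l / jbr k) ^ σ))) ≤ C := by
  obtain ⟨B, hB, hcomp⟩ := jbr_compare h0 h1 hr (m+1) m
  have ha := aexp_pos h0 h1
  have hratio : ∀ (k : Fin (m+1) → ℤ), ∀ l ∈ Lset α r k, jbr l / jbr k ≤ B := by
    rintro k l ⟨ξ, hξk, hξl⟩
    rw [div_le_iff₀ (jbr_pos k)]
    exact (hcomp k ξ l (pr ξ) hξk hξl (norm_pr_le ξ)).1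
  unfold lqSum
  split_ifs at hσ ⊢ with hqt
  · have hσ0 : 0 ≤ σ := by simpa using hσ
    refine ⟨ENNReal.ofReal (B ^ σ), ENNReal.ofReal_ne_top, fun k => iSup_le fun l => ?_⟩
    by_cases hl : l ∈ Lset α r k
    · rw [Set.indicator_of_mem hl]
      apply ENNReal.ofReal_le_ofReal
      exact Real.rpow_le_rpow (div_nonneg (jbr_pos l).le (jbr_pos k).le) (hratio k l hl) hσ0
    · rw [Set.indicator_of_notMem hl]; exact zero_le
  · have hQ : 0 < q.toReal := ENNReal.toReal_pos hq.ne' hqt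
    set Q := q.toReal with hQd
    set a := α / (1 - α) with had
    have hσQ : 0 ≤ σ * Q - a * m := by
      rw [mul_one_div, div_le_iff₀ hQ] at hσ
      linarith
    obtain ⟨C, hC, H⟩ := pack_Lset hη h0 h1 hr hadm'
    set D : ℝ≥0∞ := ENNReal.ofReal (B ^ (σ * Q - a * m)) with hD
    refine ⟨(D * C) ^ (1 / Q), ENNReal.rpow_ne_top_of_nonneg (by positivity)
      (ENNReal.mul_ne_top ENNReal.ofReal_ne_top hC), fun k => ?_⟩
    apply ENNReal.rpow_le_rpow _ (by positivity)
    have hk := lam_pos (α := α) k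
    have hK := jbr_pos k
    set κ : ℝ≥0∞ := ENNReal.ofReal (lam α k) ^ m with hκ
    have hκ0 : κ ≠ 0 := by
      rw [hκ]; apply pow_ne_zero; simpa using hk
    have hκt : κ ≠ ∞ := by rw [hκ]; finiteness
    have hterm : ∀ l, ((Lset α r k).indicator
        (fun l => ENNReal.ofReal ((jbr l / jbr k) ^ σ)) l) ^ Q ≤
        D * κ⁻¹ * (Lset α r k).indicator (fun l => ENNReal.ofReal (lam α l) ^ m) l := by
      intro l
      by_cases hl : l ∈ Lset α r k
      · rw [Set.indicator_of_mem hl, Set.indicator_of_mem hl]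
        have hll := lam_pos (α := α) l
        have hL := jbr_pos l
        have hx : 0 < jbr l / jbr k := by positivity
        rw [ENNReal.ofReal_rpow_of_pos (by positivity), ← Real.rpow_mul hx.le]
        have e : (jbr l / jbr k) ^ (σ * Q) ≤
            B ^ (σ * Q - a * m) * ((lam α k ^ m)⁻¹ * lam α l ^ m) := by
          have e1 : (jbr l / jbr k) ^ (σ * Q) =
              (jbr l / jbr k) ^ (σ * Q - a * m) * (jbr l / jbr k) ^ (a * m) := by
            rw [← Real.rpow_add hx]; congr 1; ring
          have e2 : (jbr l / jbr k) ^ (a * m) = (lam α k ^ m)⁻¹ * lam α l ^ m := by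
            rw [Real.rpow_mul hx.le, Real.div_rpow hL.le hK.le, Real.rpow_natCast, div_pow,
              div_eq_inv_mul]
            rfl
          rw [e1, e2]
          gcongr
          exact hratio k l hl
        refine (ENNReal.ofReal_le_ofReal e).trans (le_of_eq ?_)
        rw [ENNReal.ofReal_mul (by positivity), ENNReal.ofReal_mul (by positivity),
          ENNReal.ofReal_inv_of_pos (by positivity), ENNReal.ofReal_pow hk.le,
          ENNReal.ofReal_pow hll.le, mul_assoc]
      · rw [Set.indicator_of_notMem hl, ENNReal.zero_rpow_of_pos hQ]; exact zero_le
    refine (ENNReal.tsum_le_tsum hterm).trans ?_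
    rw [ENNReal.tsum_mul_left]
    calc _ ≤ D * κ⁻¹ * (C * κ) := by gcongr; exact H k
      _ = D * C * (κ⁻¹ * κ) := by ring
      _ = _ := by rw [ENNReal.inv_mul_cancel hκ0 hκt, mul_one]

lemma weight_id (h0 : 0 < α) (h1 : α < 1) {d d' : ℕ} (k : Fin d → ℤ) (l : Fin d' → ℤ)
    (s e b : ℝ) :
    jbr l ^ (s / (1 - α)) * ((lam α k / lam α l) ^ e * lam α k ^ (1 / b)) =
      jbr k ^ ((s + α / b) / (1 - α)) * (jbr l / jbr k) ^ ((s - α * e) / (1 - α)) := by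
  have hK := jbr_pos k
  have hL := jbr_pos l
  have h : 1 - α ≠ 0 := by linarith
  unfold lam
  rw [← Real.div_rpow hK.le hL.le, ← Real.rpow_mul (by positivity), ← Real.rpow_mul hK.le,
    Real.div_rpow hK.le hL.le, Real.div_rpow hL.le hK.le,
    div_eq_mul_inv (jbr k ^ _), div_eq_mul_inv (jbr l ^ _), ← Real.rpow_neg hL.le, ← Real.rpow_neg hK.le]
  have e1 : jbr l ^ ((s - α * e) / (1 - α)) =
      jbr l ^ (s / (1 - α)) * jbr l ^ (-(α / (1 - α) * e)) := by
    rw [← Real.rpow_add hL]; congr 1; ring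
  have e2 : jbr k ^ (α / (1 - α) * e) * jbr k ^ (α / (1 - α) * (1 / b)) =
      jbr k ^ ((s + α / b) / (1 - α)) * jbr k ^ (-((s - α * e) / (1 - α))) := by
    rw [← Real.rpow_add hK, ← Real.rpow_add hK]; congr 1; ring
  rw [e1]
  calc _ = jbr l ^ (s / (1 - α)) * jbr l ^ (-(α / (1 - α) * e)) *
        (jbr k ^ (α / (1 - α) * e) * jbr k ^ (α / (1 - α) * (1 / b))) := by ring
    _ = _ := by rw [e2]; ring

end Final

/-- For `n = m+1 ≥ 2`, `0 < α < 1`, `0 < p, q ≤ ∞`,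
`s_p = (n-1)(1/min(p,1) - 1)` and `s ≥ α(n-1)/q + α s_p`, the trace satisfies
`‖Tr f‖_{M^{s,α}_{p,q}(ℝ^{n-1})} ≤ C ‖f‖_{M^{s+α/p,α}_{p,min(p,q,1)}(ℝⁿ)}`. -/
theorem trace_alpha_modulation_bound
    (m : ℕ) (hm : 1 ≤ m) (η : ℝ → ℝ) (hη : IsBump η)
    (α : ℝ) (hα0 : 0 < α) (hα1 : α < 1)
    (r : ℝ) (hr : 0 < r)
    (hadm : AlphaAdmissible η α r (m+1)) (hadm' : AlphaAdmissible η α r m)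
    (p q : ℝ≥0∞) (hp : 0 < p) (hq : 0 < q) (s : ℝ)
    (hs : s ≥ α * m * (if q = ∞ then 0 else 1 / q.toReal) +
            α * (m * (1 / (min p 1).toReal - 1))) :
    ∃ C : ℝ≥0∞, 0 < C ∧ C ≠ ∞ ∧
      ∀ f : SchwartzMap (EuclideanSpace ℝ (Fin (m+1))) ℂ,
        alphaModNorm η α r s p q (traceFn (⇑f)) ≤
          C * alphaModNorm η α r (s + α / p.toReal) p (min p (min q 1)) (⇑f) := by
  obtain ⟨C₁, hC₁, H₁⟩ := key_est hη hα0 hα1 hr hadm' p hp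
  set e : ℝ := m * (1 / (min p 1).toReal - 1) with he
  have h1α : 0 < 1 - α := by linarith
  obtain ⟨C₂, hC₂, H₂⟩ := lam_sum hη hα0 hα1 hr hadm' q hq ((s - α * e) / (1 - α)) (by
    rw [le_div_iff₀ h1α]
    have h : α / (1 - α) * m * (if q = ∞ then 0 else 1 / q.toReal) * (1 - α) =
        α * m * (if q = ∞ then 0 else 1 / q.toReal) := by
      field_simp
    rw [h]
    linarith)
  set σ := (s - α * e) / (1 - α) with hσ
  set u := min p (min q 1) with hu
  have hu0 : 0 < u := lt_min hp (lt_min hq one_pos)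
  have hu1 : u ≤ 1 := (min_le_right _ _).trans (min_le_right _ _)
  have hut : u ≠ ∞ := (hu1.trans_lt ENNReal.one_lt_top).ne
  set U := u.toReal with hU
  have hU0 : 0 < U := ENNReal.toReal_pos hu0.ne' hut
  have hU1 : U ≤ 1 := by
    rw [← ENNReal.toReal_one]; exact ENNReal.toReal_mono ENNReal.one_ne_top hu1
  have hUu : ENNReal.ofReal U = u := ENNReal.ofReal_toReal hut
  have hUp : ENNReal.ofReal U ≤ p := hUu.trans_le (min_le_left _ _)
  have hUq : ENNReal.ofReal U ≤ q :=
    hUu.trans_le ((min_le_right _ _).trans (min_le_left _ _))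
  refine ⟨C₁ * C₂ + 1, by positivity,
    ENNReal.add_ne_top.2 ⟨ENNReal.mul_ne_top hC₁ hC₂, ENNReal.one_ne_top⟩, fun f => ?_⟩
  choose g hg hFg using fun k => box_schwartz hη hα0 hα1 hr hadm k f
  have hFg0 : ∀ k ξ, ¬ InWin α r k ξ → 𝓕 (⇑(g k)) ξ = 0 := by
    intro k ξ h
    rw [hFg, alphaPsi_eq_zero hη hr h]; simp
  have hcont : ∀ k l, Continuous (Jop η α r l (𝓕 (⇑(g k)))) := by
    intro k l
    obtain ⟨S, hS, -⟩ := box_schwartz hη hα0 hα1 hr hadm' l (trS (g k))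
    have e : Jop η α r l (𝓕 (⇑(g k))) = ⇑S := by
      funext x
      rw [← trace_eq_J hη hα0 hα1 hr hadm' l (g k) x, hS, trS_coe]
    rw [e]; exact S.continuous
  set b : (Fin (m+1) → ℤ) → ℝ≥0∞ := fun k =>
    ENNReal.ofReal (jbr k ^ ((s + α / p.toReal) / (1 - α))) *
      eLpNorm (alphaBox η α r k (⇑f)) p volume with hb
  set I : (Fin (m+1) → ℤ) → (Fin m → ℤ) → ℝ≥0∞ := fun k =>
    (Lset α r k).indicator (fun l => ENNReal.ofReal ((jbr l / jbr k) ^ σ)) with hI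
  have step1 : ∀ l : Fin m → ℤ, eLpNorm (alphaBox η α r l (traceFn (⇑f))) p volume ^ U ≤
      ∑' k, eLpNorm (Jop η α r l (𝓕 (⇑(g k)))) p volume ^ U := by
    intro l
    have := mink (μ := (volume : Measure (EuclideanSpace ℝ (Fin m)))) hU0 hUp
      (fun k x => ‖Jop η α r l (𝓕 (⇑(g k))) x‖ₑ)
      (fun k => (hcont k l).enorm.measurable)
      (fun x => ‖alphaBox η α r l (traceFn (⇑f)) x‖ₑ) (by
        intro x
        rw [trace_eq_J hη hα0 hα1 hr hadm' l f x]
        refine le_trans ?_ (rpow_tsum_le _ hU0 hU1)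
        apply ENNReal.rpow_le_rpow _ hU0.le
        refine (J_decomp hη hα0 hα1 hr hadm hadm' l f x).trans (le_of_eq ?_)
        congr 1
        funext k
        have e : (fun ξ => (alphaPsi η α r k ξ : ℂ) * 𝓕 (⇑f) ξ) = 𝓕 (⇑(g k)) :=
          funext fun ξ => (hFg k ξ).symm
        rw [e])
    simpa only [eLpNorm_enorm] using this
  have step2 : ∀ k l, ENNReal.ofReal (jbr l ^ (s / (1 - α))) *
      eLpNorm (Jop η α r l (𝓕 (⇑(g k)))) p volume ≤ C₁ * b k * I k l := by
    intro k l
    by_cases hl : l ∈ Lset α r k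
    · have h := H₁ k l hl (g k) (hFg0 k)
      rw [hg] at h
      have hk := jbr_pos k
      have hl' := jbr_pos l
      have hid := congrArg ENNReal.ofReal (weight_id hα0 hα1 k l s e p.toReal)
      rw [ENNReal.ofReal_mul (Real.rpow_nonneg hl'.le _),
        ENNReal.ofReal_mul (p := jbr k ^ _) (Real.rpow_nonneg hk.le _), ← hσ] at hid
      simp only [hI, hb]
      rw [Set.indicator_of_mem hl]
      rw [hg]
      calc _ ≤ _ := mul_le_mul_right h _
        _ = C₁ * (ENNReal.ofReal (jbr l ^ (s / (1 - α))) *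
            ENNReal.ofReal ((lam α k / lam α l) ^ e * lam α k ^ (1 / p.toReal))) *
            eLpNorm (alphaBox η α r k (⇑f)) p volume := by ring
        _ = _ := by rw [hid]; ring
    · have z : Jop η α r l (𝓕 (⇑(g k))) = 0 :=
        funext fun x => J_zero hη hr (hFg0 k) hl x
      rw [z]; simp
  have step3 : lqSum q (fun l : Fin m → ℤ => ENNReal.ofReal (jbr l ^ (s / (1 - α))) *
      eLpNorm (alphaBox η α r l (traceFn (⇑f))) p volume) ^ U ≤
      ∑' k, lqSum q (fun l => C₁ * b k * I k l) ^ U := by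
    simp_rw [lqSum_eq hq]
    apply mink hU0 hUq _ (fun k => measurable_of_countable _)
    intro l
    rw [ENNReal.mul_rpow_of_nonneg _ _ hU0.le]
    calc _ ≤ _ := mul_le_mul_right (step1 l) _
      _ = ∑' k, (ENNReal.ofReal (jbr l ^ (s / (1 - α))) *
          eLpNorm (Jop η α r l (𝓕 (⇑(g k)))) p volume) ^ U := by
        rw [← ENNReal.tsum_mul_left]
        simp_rw [ENNReal.mul_rpow_of_nonneg _ _ hU0.le]
      _ ≤ _ := ENNReal.tsum_le_tsum fun k => ENNReal.rpow_le_rpow (step2 k l) hU0.le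
  have step4 : ∀ k, lqSum q (fun l => C₁ * b k * I k l) ≤ (C₁ * C₂ + 1) * b k := by
    intro k
    rw [lqSum_const_mul hq]
    calc _ ≤ C₁ * b k * C₂ := mul_le_mul_right (H₂ k) _
      _ = (C₁ * C₂) * b k := by ring
      _ ≤ _ := by gcongr; exact le_self_add
  unfold alphaModNorm
  rw [← lqSum_const_mul hu0]
  have e5 : ∀ a : (Fin (m+1) → ℤ) → ℝ≥0∞, lqSum u a = (∑' k, a k ^ U) ^ (1 / U) := by
    intro a; unfold lqSum; rw [if_neg hut]
  rw [e5, one_div, ENNReal.le_rpow_inv_iff hU0]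
  exact step3.trans (ENNReal.tsum_le_tsum fun k => ENNReal.rpow_le_rpow (step4 k) hU0.le)
end
end
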